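/- Let R be a complete noetherian local domain of mixed characteristic (0,p) with perfect residue field, and fix an absolute integral closure R⁺ of R. Then there exists an R⁺-algebra C such that C, viewed as an R-algebra via the composite R → R⁺ → C, is an 𝔪_R-adically complete (big) Cohen-Macaulay R-algebra. -/

import Mathlib

/-- A finite sequence `y` of elements of a commutative ring `B` is a regular sequence on `B`:
for each `i`, multiplication by `y i` is injective on `B/(y_1,…,y_{i-1})B`,
and `B ≠ (y_1,…,y_m)B`. -/
def IsRegSeq {B : Type*} [CommRing B] {m : ℕ} (y : Fin m → B) : Prop :=
  (∀ i : Fin m, ∀ b : B,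
      y i * b ∈ Ideal.span (y '' {j : Fin m | j < i}) →
        b ∈ Ideal.span (y '' {j : Fin m | j < i})) ∧
  Ideal.span (Set.range y) ≠ ⊤

/-- A `B`-algebra (given by a ring hom `φ : R →+* B`) is Cohen-Macaulay with respect to a
sequence `x` of elements of `R` if `x` becomes a regular sequence in `B`. -/
def IsCMwrt {R B : Type*} [CommRing R] [CommRing B] (φ : R →+* B)
    {d : ℕ} (x : Fin d → R) : Prop :=
  IsRegSeq fun i => φ (x i)

/-- `x` is a system of parameters of the noetherian local ring `R`: `d` is the Krull dimension,
all `x i` lie in the maximal ideal, and they generate an ideal whose radical is the maximal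
ideal. -/
def IsSOP (R : Type*) [CommRing R] [IsLocalRing R] {d : ℕ} (x : Fin d → R) : Prop :=
  (d : WithBot ℕ∞) = ringKrullDim R ∧
  (∀ i, x i ∈ IsLocalRing.maximalIdeal R) ∧
  (Ideal.span (Set.range x)).radical = IsLocalRing.maximalIdeal R

/-- `B` (via the structure map `φ`) is a big Cohen-Macaulay `R`-algebra: it is Cohen-Macaulay
with respect to every system of parameters of `R`. -/
def IsBigCM {R B : Type*} [CommRing R] [IsLocalRing R] [CommRing B] (φ : R →+* B) : Prop :=
  ∀ (d : ℕ) (x : Fin d → R), IsSOP R x → IsCMwrt φ x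

/-- `A` (as an `R`-algebra) is an absolute integral closure of the domain `R`:
it is a domain containing `R`, integral over `R`, and absolutely integrally closed
(every monic polynomial of positive degree has a root); equivalently, it is the
integral closure of `R` in an algebraic closure of its fraction field. -/
structure IsAbsIntClosure (R A : Type*) [CommRing R] [CommRing A] [Algebra R A] : Prop where
  isDomain : IsDomain A
  injective : Function.Injective (algebraMap R A)
  isIntegral : Algebra.IsIntegral R A
  monic_root : ∀ P : Polynomial A, P.Monic → 0 < P.degree → ∃ a : A, P.IsRoot a

/-- `B` is `π^{1/p^∞}`-almost Cohen-Macaulay with respect to `x`, where `π : ℕ → B` is a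
compatible system of `p`-th power roots. -/
def IsAlmostCMwrt {R B : Type*} [CommRing R] [CommRing B] (φ : R →+* B)
    (π : ℕ → B) {d : ℕ} (x : Fin d → R) : Prop :=
  (∀ i : Fin d, ∀ b : B,
      φ (x i) * b ∈ Ideal.span ((fun j => φ (x j)) '' {j : Fin d | j < i}) →
        ∀ e : ℕ, π e * b ∈ Ideal.span ((fun j => φ (x j)) '' {j : Fin d | j < i})) ∧
  ¬ Ideal.span (Set.range π) ≤ Ideal.span (Set.range fun j => φ (x j))

/-! ### Frobenius powers of ideals -/

section FrobeniusIdeals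

/-- Membership in a span of finitely many elements, as a linear combination. -/
theorem mem_span_image_iff_exists_sum {J B : Type*} [Fintype J] [CommRing B] (y : J → B)
    (s : Set J) (z : B) :
    z ∈ Ideal.span (y '' s) ↔ ∃ c : J → B, (∀ j, j ∉ s → c j = 0) ∧ z = ∑ j, c j * y j := by
  classical
  constructor
  · intro h
    refine Submodule.span_induction (p := fun z _ => ∃ c : J → B, (∀ j, j ∉ s → c j = 0) ∧
      z = ∑ j, c j * y j) ?_ ?_ ?_ ?_ h
    · rintro _ ⟨j, hj, rfl⟩
      refine ⟨Pi.single j 1, ?_, ?_⟩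
      · intro i hi
        rw [Pi.single_apply, if_neg]
        rintro rfl
        exact hi hj
      · simp [Pi.single_apply]
    · exact ⟨0, by simp, by simp⟩
    · rintro a b - - ⟨c, hc, rfl⟩ ⟨c', hc', rfl⟩
      refine ⟨c + c', fun j hj => by simp [hc j hj, hc' j hj], ?_⟩
      simp [add_mul, Finset.sum_add_distrib]
    · rintro r a - ⟨c, hc, rfl⟩
      refine ⟨r • c, fun j hj => by simp [hc j hj], ?_⟩
      simp [Finset.mul_sum, mul_assoc]
  · rintro ⟨c, hc, rfl⟩
    refine Ideal.sum_mem _ fun j _ => ?_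
    by_cases hj : j ∈ s
    · exact Ideal.mul_mem_left _ _ (Ideal.subset_span ⟨j, hj, rfl⟩)
    · simp [hc j hj]

theorem mem_span_image_of_exists_sum {J B : Type*} [Fintype J] [CommRing B] {y : J → B}
    {s : Set J} {z : B} (c : J → B) (hc : ∀ j, j ∉ s → c j = 0) (hz : z = ∑ j, c j * y j) :
    z ∈ Ideal.span (y '' s) :=
  (mem_span_image_iff_exists_sum y s z).2 ⟨c, hc, hz⟩

theorem map_mem_span_image {J B C : Type*} [CommRing B] [CommRing C] (f : B →+* C)
    {y : J → B} {s : Set J} {z : B} (h : z ∈ Ideal.span (y '' s)) :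
    f z ∈ Ideal.span ((fun j => f (y j)) '' s) := by
  have := Ideal.mem_map_of_mem f h
  rwa [Ideal.map_span, Set.image_image] at this

variable (p : ℕ) [Fact p.Prime]

theorem pow_mem_span_pow {J B : Type*} [Fintype J] [CommRing B] [CharP B p] {y : J → B}
    {s : Set J} {z : B} (e : ℕ) (h : z ∈ Ideal.span (y '' s)) :
    z ^ p ^ e ∈ Ideal.span ((fun j => y j ^ p ^ e) '' s) := by
  have := map_mem_span_image (iterateFrobenius B p e) h
  simpa [iterateFrobenius_def] using this

theorem pow_mem_span_pow_iff {J B : Type*} [Fintype J] [CommRing B] [CharP B p]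
    [PerfectRing B p] {y : J → B} {s : Set J} {z : B} (e : ℕ) :
    z ^ p ^ e ∈ Ideal.span ((fun j => y j ^ p ^ e) '' s) ↔ z ∈ Ideal.span (y '' s) := by
  refine ⟨fun h => ?_, pow_mem_span_pow p e⟩
  have h2 := map_mem_span_image (iterateFrobeniusEquiv B p e).symm.toRingHom h
  have key : ∀ w : B, (iterateFrobeniusEquiv B p e).symm (w ^ p ^ e) = w := fun w => by
    rw [RingEquiv.symm_apply_eq, iterateFrobeniusEquiv_apply, iterateFrobenius_def]
  simpa [key] using h2

end FrobeniusIdeals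

/-! ### Perfect closures -/

section PerfectClosure

variable (p : ℕ) [hp : Fact p.Prime]

theorem PerfectClosure.exists_pow_eq_of {C : Type*} [CommRing C] [CharP C p]
    (z : PerfectClosure C p) : ∃ e w, z ^ p ^ e = PerfectClosure.of C p w := by
  refine PerfectClosure.induction_on z fun x => ⟨x.1, x.2, ?_⟩
  rw [← iterateFrobenius_def, coe_iterateFrobenius, PerfectClosure.iterate_frobenius_mk]

theorem PerfectClosure.exists_pow_eq_of_of_eq {C : Type*} [CommRing C] [CharP C p]
    {a b : C} (h : PerfectClosure.of C p a = PerfectClosure.of C p b) :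
    ∃ e, a ^ p ^ e = b ^ p ^ e := by
  rw [PerfectClosure.of_apply, PerfectClosure.of_apply, PerfectClosure.mk_eq_iff] at h
  obtain ⟨e, he⟩ := h
  refine ⟨e, ?_⟩
  simpa [← iterateFrobenius_def, coe_iterateFrobenius] using he

theorem PerfectClosure.exists_pow_eq_of_le {C : Type*} [CommRing C] [CharP C p] {ι : Type*}
    [Fintype ι] (z : ι → PerfectClosure C p) (e0 : ℕ) :
    ∃ e, e0 ≤ e ∧ ∃ w : ι → C, ∀ i, z i ^ p ^ e = PerfectClosure.of C p (w i) := by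
  choose e w h using fun i => PerfectClosure.exists_pow_eq_of p (z i)
  refine ⟨e0 + ∑ i, e i, by omega, fun i => w i ^ p ^ (e0 + ∑ i, e i - e i), fun i => ?_⟩
  have : e i ≤ ∑ i, e i := Finset.single_le_sum (fun _ _ => Nat.zero_le _) (Finset.mem_univ i)
  rw [map_pow, ← h, ← pow_mul, ← pow_add]
  congr 2; omega

theorem PerfectClosure.mem_span_image_iff {C : Type*} [CommRing C] [CharP C p] {J : Type*}
    [Fintype J] (y : J → C) (s : Set J) (z : C) :
    PerfectClosure.of C p z ∈ Ideal.span ((fun j => PerfectClosure.of C p (y j)) '' s) ↔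
      ∃ e, z ^ p ^ e ∈ Ideal.span ((fun j => y j ^ p ^ e) '' s) := by
  constructor
  · intro h
    obtain ⟨c, hc, h⟩ := (mem_span_image_iff_exists_sum _ _ _).1 h
    obtain ⟨e, -, w, hw⟩ := PerfectClosure.exists_pow_eq_of_le p c 0
    classical
    let w' : J → C := fun j => if j ∈ s then w j else 0
    have hw' : ∀ j, c j ^ p ^ e = PerfectClosure.of C p (w' j) := by
      intro j
      by_cases hj : j ∈ s
      · simp [w', hj, hw]
      · simp [w', hj, hc j hj, hp.out.ne_zero]
    have : PerfectClosure.of C p (z ^ p ^ e) =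
        PerfectClosure.of C p (∑ j, w' j * y j ^ p ^ e) := by
      rw [map_pow, h, ← iterateFrobenius_def, map_sum, map_sum]
      refine Finset.sum_congr rfl fun j _ => ?_
      rw [iterateFrobenius_def, mul_pow, hw', map_mul, map_pow]
    obtain ⟨e', he'⟩ := PerfectClosure.exists_pow_eq_of_of_eq p this
    refine ⟨e + e', ?_⟩
    have h2 : ∑ j, w' j * y j ^ p ^ e ∈ Ideal.span ((fun j => y j ^ p ^ e) '' s) :=
      mem_span_image_of_exists_sum w' (fun j hj => by simp [w', hj]) rfl
    have h3 := pow_mem_span_pow p e' h2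
    rw [← he'] at h3
    simpa [← pow_mul, ← pow_add] using h3
  · rintro ⟨e, h⟩
    have := map_mem_span_image (PerfectClosure.of C p) h
    rw [← pow_mem_span_pow_iff p e]
    simpa using this

theorem PerfectClosure.charP_of_nontrivial {P : Type*} [CommRing P] [CharP P p] {C : Type*}
    [CommRing C] [Nontrivial C] (f : P →+* C) : CharP C p :=
  (CharP.charP_iff_prime_eq_zero hp.out).2 (by rw [← map_natCast f, CharP.cast_eq_zero, map_zero])

end PerfectClosure

/-! ### Test sequences over a power series ring in characteristic `p` -/

section TestSequences

/-- Exponents `(2, M, …, M)`. -/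
def twoThen {n : ℕ} (M : ℕ) : Fin (n + 1) → ℕ := Fin.cons 2 fun _ => M

/-- The sequence `y = (t, x₁, …, xₙ)` in the `D`-algebra `C`, with all its elements raised to the
power `N`, is weakly regular, nonzero elements of `D` are regular modulo `t`, and `t g` is small
in the `(t, x)`-adic topology only if `g` is. -/
structure IsTestSeq (N : ℕ) {D C : Type} [CommRing D] [CommRing C] {n : ℕ} (x : Fin n → D)
    (φ : D →+* C) (y : Fin (n + 1) → C) : Prop where
  map_x : ∀ i, y i.succ = φ (x i)
  colon : ∀ i z, y i ^ N * z ∈ Ideal.span ((fun j => y j ^ N) '' {j | j < i}) →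
    z ∈ Ideal.span ((fun j => y j ^ N) '' {j | j < i})
  reg : ∀ g, g ≠ 0 → ∀ z, y 0 ∣ φ g * z → y 0 ∣ z
  ntriv : ∀ g M, g ∉ Ideal.span (Set.range fun i => x i ^ M) →
    (y 0 * φ g) ^ N ∉ Ideal.span ((fun j => (y j ^ twoThen M j) ^ N) '' Set.univ)

variable {D C : Type} [CommRing D] [CommRing C] {n : ℕ} {x : Fin n → D}
    {φ : D →+* C} {y : Fin (n + 1) → C}

theorem IsTestSeq.mul_left_injective {N : ℕ} (h : IsTestSeq N x φ y) (hN : N ≠ 0) {z : C}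
    (hz : y 0 * z = 0) : z = 0 := by
  have := h.colon 0 z
  simp only [Fin.not_lt_zero, Set.ofPred_false, Set.image_empty, Ideal.span_empty,
    Ideal.mem_bot] at this
  apply this
  obtain ⟨k, rfl⟩ := Nat.exists_eq_succ_of_ne_zero hN
  rw [pow_succ, mul_assoc, hz, mul_zero]

/-- If `g` is regular modulo the nonzerodivisor `t`, then `g ^ M` is regular modulo `t ^ N`. -/
theorem pow_dvd_of_pow_dvd_mul {t g : C} (ht : ∀ z, t * z = 0 → z = 0)
    (hg : ∀ z, t ∣ g * z → t ∣ z) (M N : ℕ) (z : C) (h : t ^ N ∣ g ^ M * z) : t ^ N ∣ z := by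
  have hgM : ∀ M z, t ∣ g ^ M * z → t ∣ z := by
    intro M
    induction M with
    | zero => simp
    | succ M ih =>
      intro z hz
      rw [pow_succ, mul_assoc] at hz
      exact hg _ (ih _ hz)
  induction N generalizing z with
  | zero => simp
  | succ N ih =>
    obtain ⟨z', rfl⟩ := hgM M z ((dvd_pow_self t N.succ_ne_zero).trans h)
    rw [pow_succ']
    refine mul_dvd_mul_left t (ih _ ?_)
    obtain ⟨w, hw⟩ := h
    refine ⟨w, sub_eq_zero.1 (ht _ ?_)⟩
    rw [pow_succ'] at hw
    linear_combination hw

variable (p : ℕ) [hp : Fact p.Prime]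

theorem dvd_of_pow_dvd_pow [CharP C p] [PerfectRing C p] {t z : C} (e : ℕ)
    (h : t ^ p ^ e ∣ z ^ p ^ e) : t ∣ z := by
  have := pow_mem_span_pow_iff p (B := C) (y := fun _ : Unit => t) (s := Set.univ) (z := z) e
  simp only [Set.image_univ, Set.range_const, Ideal.mem_span_singleton] at this
  exact this.1 h

theorem IsTestSeq.pow [CharP C p] [PerfectRing C p] (h : IsTestSeq 1 x φ y) (e : ℕ) :
    IsTestSeq (p ^ e) x φ y where
  map_x := h.map_x
  reg := h.reg
  colon := by
    intro i z hz
    obtain ⟨w, rfl⟩ := (iterateFrobeniusEquiv C p e).surjective z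
    rw [iterateFrobeniusEquiv_apply, iterateFrobenius_def] at hz ⊢
    rw [← mul_pow, pow_mem_span_pow_iff] at hz
    rw [pow_mem_span_pow_iff]
    simpa using h.colon i w (by simpa using hz)
  ntriv := by
    intro g M hg hz
    rw [pow_mem_span_pow_iff] at hz
    exact h.ntriv g M hg (by simpa using hz)

theorem IsTestSeq.perfectClosure [CharP C p] (h : ∀ e, IsTestSeq (p ^ e) x φ y) :
    IsTestSeq 1 x ((PerfectClosure.of C p).comp φ) (fun j => PerfectClosure.of C p (y j)) where
  map_x i := by simp [(h 0).map_x]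
  colon := by
    intro i z hz
    simp only [pow_one] at hz ⊢
    obtain ⟨e, w, hw⟩ := PerfectClosure.exists_pow_eq_of p z
    have h1 := pow_mem_span_pow p e hz
    rw [mul_pow, hw, ← map_pow, ← map_mul] at h1
    simp only [← map_pow] at h1
    rw [PerfectClosure.mem_span_image_iff] at h1
    obtain ⟨e', he'⟩ := h1
    simp only [mul_pow, ← pow_mul, ← pow_add] at he'
    have h2 := map_mem_span_image (PerfectClosure.of C p) ((h (e + e')).colon i _ he')
    rw [map_pow, ← hw, ← pow_mul, ← pow_add] at h2
    simp only [map_pow] at h2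
    exact (pow_mem_span_pow_iff p (e + e')).1 h2
  reg := by
    intro g hg z hz
    obtain ⟨e, w, hw⟩ := PerfectClosure.exists_pow_eq_of p z
    have h1 := pow_dvd_pow_of_dvd hz (p ^ e)
    rw [mul_pow, hw, ← map_pow, RingHom.comp_apply, ← map_pow, ← map_mul] at h1
    have := PerfectClosure.mem_span_image_iff p (fun _ : Unit => y 0 ^ p ^ e) Set.univ
      (φ g ^ p ^ e * w)
    simp only [Set.image_univ, Set.range_const, Ideal.mem_span_singleton] at this
    obtain ⟨e', he'⟩ := this.1 h1
    simp only [mul_pow, ← pow_mul, ← pow_add] at he'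
    have h2 := pow_dvd_of_pow_dvd_mul
      (fun _ => (h 0).mul_left_injective (pow_ne_zero _ hp.out.ne_zero))
      ((h 0).reg g hg) _ _ _ he'
    have h3 := map_dvd (PerfectClosure.of C p) h2
    rw [map_pow, map_pow, ← hw, ← pow_mul, ← pow_add] at h3
    exact dvd_of_pow_dvd_pow p _ h3
  ntriv := by
    intro g M hg hz
    rw [pow_one, RingHom.comp_apply, ← map_mul] at hz
    simp only [pow_one, ← map_pow] at hz
    rw [PerfectClosure.mem_span_image_iff] at hz
    obtain ⟨e, he⟩ := hz
    exact (h e).ntriv g M hg he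

end TestSequences

/-! ### Extensions free modulo `t` -/

section FreeModulo

variable {P C : Type} [CommRing P] [CommRing C]

/-- `t` is a nonzerodivisor on the `P`-algebra `C` and `C/tC` has a nonempty basis over `P/tP`. -/
def IsFreeModulo (f : P →+* C) (t : P) : Prop :=
  (∀ z, f t * z = 0 → z = 0) ∧ ∃ (ι : Type) (_ : Nonempty ι) (e : ι → C),
    (∀ z, ∃ v : ι →₀ P, f t ∣ z - v.sum fun i a => f a * e i) ∧
    ∀ v : ι →₀ P, (f t ∣ v.sum fun i a => f a * e i) → ∀ i, t ∣ v i

/-- The basis property lifts from `t` to its powers. -/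
theorem IsFreeModulo.pow {f : P →+* C} {t : P} (h : IsFreeModulo f t)
    (N : ℕ) : IsFreeModulo f (t ^ N) := by
  obtain ⟨ht, ι, hι, e, hgen, hind⟩ := h
  refine ⟨?_, ι, hι, e, ?_, ?_⟩
  · intro z hz
    rw [map_pow] at hz
    induction N with
    | zero => simpa using hz
    | succ N ih =>
      rw [pow_succ', mul_assoc] at hz
      exact ih (ht _ hz)
  · induction N with
    | zero => exact fun z => ⟨0, by simp⟩
    | succ N ih =>
      intro z
      obtain ⟨v, w, hw⟩ := ih z
      obtain ⟨v', hv'⟩ := hgen w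
      refine ⟨v + v'.mapRange (fun a => t ^ N * a) (by simp), ?_⟩
      rw [Finsupp.sum_add_index' (by simp) (by intros; simp [add_mul]),
        Finsupp.sum_mapRange_index (by simp)]
      have : (v'.sum fun i a => f (t ^ N * a) * e i) = f (t ^ N) *
          v'.sum fun i a => f a * e i := by
        rw [Finsupp.mul_sum]
        simp [mul_assoc]
      rw [this, ← sub_sub, hw, ← mul_sub, pow_succ, map_mul]
      exact mul_dvd_mul_left _ hv'
  · classical
    induction N with
    | zero => simp
    | succ N ih =>
      intro v hv
      have h1 : ∀ i, t ∣ v i := hind v (by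
        rw [pow_succ, map_mul] at hv
        exact (Dvd.intro_left _ rfl).trans hv)
      choose c hc using h1
      let v' : ι →₀ P := Finsupp.onFinset v.support (fun i => if v i = 0 then 0 else c i)
        (fun i hi => by
          rw [Finsupp.mem_support_iff]
          rintro h0
          simp [h0] at hi)
      have hv' : v = v'.mapRange (fun a => t * a) (by simp) := by
        ext i
        by_cases h0 : v i = 0
        · simp [v', h0]
        · simp [v', h0, ← hc]
      have hsum : (v.sum fun i a => f a * e i) = f t * v'.sum fun i a => f a * e i := by
        rw [hv', Finsupp.sum_mapRange_index (by simp), Finsupp.mul_sum]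
        simp [mul_assoc]
      rw [hsum] at hv
      have := ih v' (by
        obtain ⟨w, hw⟩ := hv
        refine ⟨w, sub_eq_zero.1 (ht _ ?_)⟩
        rw [pow_succ', map_mul] at hw
        linear_combination hw)
      intro i
      rw [hv', Finsupp.mapRange_apply, pow_succ']
      exact mul_dvd_mul_left _ (this i)

/-- If `C/tC` is free over `P/tP` and `t ∈ I`, the ideal `IC` is described by coordinates. -/
theorem IsFreeModulo.mem_map_iff {f : P →+* C} {t : P} (h : IsFreeModulo f t) :
    ∃ (ι : Type) (_ : Nonempty ι) (e : ι → C) (c : C → ι → P),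
      (∀ I : Ideal P, t ∈ I → ∀ z a, f a * z ∈ I.map f ↔ ∀ i, a * c z i ∈ I) ∧
      ∀ I : Ideal P, t ∈ I → ∀ i a, f a * e i ∈ I.map f → a ∈ I := by
  obtain ⟨ht, ι, hι, e, hgen, hind⟩ := h
  have key : ∀ I : Ideal P, t ∈ I → ∀ v : ι →₀ P,
      (v.sum fun i a => f a * e i) ∈ I.map f → ∀ i, v i ∈ I := by
    intro I hI v hv
    have hex : ∀ z ∈ I.map f, ∃ v : ι →₀ P, (∀ i, v i ∈ I) ∧
        f t ∣ z - v.sum fun i a => f a * e i := by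
      intro z hz
      refine Submodule.span_induction (p := fun z _ => ∃ v : ι →₀ P, (∀ i, v i ∈ I) ∧
        f t ∣ z - v.sum fun i a => f a * e i) ?_ ?_ ?_ ?_ (by simpa [Ideal.map] using hz)
      · rintro _ ⟨a, ha, rfl⟩
        obtain ⟨v, hv⟩ := hgen 1
        refine ⟨v.mapRange (fun b => a * b) (by simp), ?_, ?_⟩
        · intro i; simpa using I.mul_mem_right _ ha
        · rw [Finsupp.sum_mapRange_index (by simp)]
          have : (v.sum fun i b => f (a * b) * e i) = f a * v.sum fun i a => f a * e i := by
            rw [Finsupp.mul_sum]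
            simp [mul_assoc]
          rw [this]
          simpa [mul_sub] using Dvd.dvd.mul_left hv (f a)
      · exact ⟨0, by simp, by simp⟩
      · rintro a b - - ⟨v, hv, h⟩ ⟨v', hv', h'⟩
        refine ⟨v + v', fun i => I.add_mem (hv i) (hv' i), ?_⟩
        rw [Finsupp.sum_add_index' (by simp) (by intros; simp [add_mul])]
        convert dvd_add h h' using 1
        ring
      · rintro r z - ⟨v, hv, h⟩
        choose w hw using hgen
        refine ⟨v.sum fun i a => (w (r * e i)).mapRange (fun b => a * b) (by simp), ?_, ?_⟩
        · intro i
          rw [Finsupp.sum, Finsupp.finsetSum_apply]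
          exact I.sum_mem fun j _ => by simpa using I.mul_mem_right _ (hv j)
        · rw [Finsupp.sum_sum_index (by simp) (by intros; simp [add_mul])]
          have : ∀ j a, (((w (r * e j)).mapRange (fun b => a * b) (by simp)).sum
              fun i b => f b * e i) = f a * (w (r * e j)).sum fun i b => f b * e i := by
            intro j a
            rw [Finsupp.sum_mapRange_index (by simp), Finsupp.mul_sum]
            simp [mul_assoc]
          simp only [this]
          have h1 : f t ∣ r • z - r * v.sum fun i a => f a * e i := by
            rw [smul_eq_mul, ← mul_sub]; exact h.mul_left _
          have h2 : f t ∣ r * (v.sum fun i a => f a * e i) -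
              v.sum fun j a => f a * (w (r * e j)).sum fun i b => f b * e i := by
            rw [Finsupp.mul_sum, Finsupp.sum, Finsupp.sum, ← Finset.sum_sub_distrib]
            refine Finset.dvd_sum fun j _ => ?_
            rw [mul_left_comm, ← mul_sub]
            exact (hw _).mul_left _
          convert dvd_add h1 h2 using 1
          ring
    obtain ⟨v', hv', h'⟩ := hex _ hv
    have h3 := hind (v - v') (by
      rwa [Finsupp.sum_sub_index (by intros; simp [sub_mul])])
    intro i
    have h4 : v i = (v - v') i + v' i := by simp
    rw [h4]
    exact I.add_mem (I.mem_of_dvd (h3 i) hI) (hv' i)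
  choose w hw using hgen
  refine ⟨ι, hι, e, fun z => w z, ?_, ?_⟩
  · intro I hI z a
    have h1 : f a * (z - (w z).sum fun i a => f a * e i) ∈ I.map f :=
      Ideal.mul_mem_left _ _ (Ideal.mem_of_dvd _ (hw z) (Ideal.mem_map_of_mem f hI))
    have h2 : (((w z).mapRange (fun b => a * b) (by simp)).sum fun i b => f b * e i) =
        f a * (w z).sum fun i a => f a * e i := by
      rw [Finsupp.sum_mapRange_index (by simp), Finsupp.mul_sum]
      simp [mul_assoc]
    constructor
    · intro hz
      have := key I hI ((w z).mapRange (fun b => a * b) (by simp)) (by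
        rw [h2]
        have := Ideal.sub_mem _ hz h1
        rwa [← mul_sub, sub_sub_cancel] at this)
      simpa using this
    · intro hz
      have h3 : f a * (w z).sum (fun i a => f a * e i) ∈ I.map f := by
        rw [← h2, Finsupp.sum_mapRange_index (by simp)]
        exact Ideal.sum_mem _ fun i _ =>
          Ideal.mul_mem_right _ _ (Ideal.mem_map_of_mem f (hz i))
      have := Ideal.add_mem _ h1 h3
      rwa [← mul_add, sub_add_cancel] at this
  · intro I hI i a h
    have := key I hI (Finsupp.single i a) (by simpa using h)
    simpa using this i

variable {D : Type} [CommRing D] {n : ℕ} {x : Fin n → D} {φ : D →+* P} {y : Fin (n + 1) → P}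

theorem IsTestSeq.of_isFreeModulo {N : ℕ} (h : IsTestSeq N x φ y) {f : P →+* C}
    (hf : IsFreeModulo f (y 0)) : IsTestSeq N x (f.comp φ) (fun j => f (y j)) where
  map_x i := by simp [h.map_x]
  colon := by
    intro i z hz
    rcases Fin.eq_zero_or_eq_succ i with rfl | ⟨i, rfl⟩
    · have := (hf.pow N).1 z
      simp only [Fin.not_lt_zero, Set.ofPred_false, Set.image_empty, Ideal.span_empty,
        Ideal.mem_bot] at hz ⊢
      apply this
      simpa using hz
    · obtain ⟨ι, -, -, c, hc, -⟩ := (hf.pow N).mem_map_iff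
      have hI : ((Ideal.span ((fun j => y j ^ N) '' {j | j < i.succ})).map f) =
          Ideal.span ((fun j => f (y j) ^ N) '' {j | j < i.succ}) := by
        rw [Ideal.map_span, Set.image_image]
        simp
      have h0 : y 0 ^ N ∈ Ideal.span ((fun j => y j ^ N) '' {j | j < i.succ}) :=
        Ideal.subset_span ⟨0, Fin.succ_pos i, rfl⟩
      rw [← hI, ← map_pow, hc _ h0] at hz
      have := (hc _ h0 z 1).2 fun j => by simpa using h.colon _ _ (hz j)
      rw [← hI]
      simpa using this
  reg := by
    intro g hg z hz
    obtain ⟨ι, -, -, c, hc, -⟩ := hf.mem_map_iff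
    have hI : ∀ w, f (y 0) ∣ w ↔ w ∈ (Ideal.span {y 0}).map f := by
      intro w
      rw [Ideal.map_span, Set.image_singleton, Ideal.mem_span_singleton]
    rw [hI, RingHom.comp_apply, hc _ (Ideal.mem_span_singleton_self _)] at hz
    have := (hc _ (Ideal.mem_span_singleton_self _) z 1).2 fun j => by
      rw [one_mul, Ideal.mem_span_singleton]
      exact h.reg _ hg _ (Ideal.mem_span_singleton.1 (hz j))
    rw [hI]
    simpa using this
  ntriv := by
    intro g M hg hz
    obtain ⟨ι, ⟨i⟩, e, -, -, he⟩ := (hf.pow (2 * N)).mem_map_iff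
    refine h.ntriv g M hg (he (Ideal.span ((fun j => (y j ^ twoThen M j) ^ N) '' Set.univ))
      (Ideal.subset_span ⟨0, trivial, ?_⟩) i _ ?_)
    · simp [twoThen, pow_mul]
    · rw [Ideal.map_span, Set.image_image]
      refine Ideal.mul_mem_right _ _ ?_
      simpa using hz

end FreeModulo

/-! ### Reduced products -/

section ReducedProduct

open Filter

variable {I : Type} (F : Filter I) (B : I → Type) [∀ i, CommRing (B i)]

/-- The ideal of families that vanish eventually along the filter `F`. -/
def eventuallyZeroIdeal : Ideal (∀ i, B i) where
  carrier := {f | ∀ᶠ i in F, f i = 0}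
  add_mem' := by
    intro a b ha hb
    filter_upwards [ha, hb] with i h1 h2
    simp [h1, h2]
  zero_mem' := by simp
  smul_mem' := by
    intro c a ha
    filter_upwards [ha] with i h1
    simp [h1]

/-- The reduced product of a family of rings along a filter. -/
abbrev ReducedProduct : Type := (∀ i, B i) ⧸ eventuallyZeroIdeal F B

/-- The class of a family in the reduced product. -/
abbrev ReducedProduct.mk : (∀ i, B i) →+* ReducedProduct F B :=
  Ideal.Quotient.mk (eventuallyZeroIdeal F B)

variable {F B}

namespace ReducedProduct

theorem mk_eq_iff {f g : ∀ i, B i} : mk F B f = mk F B g ↔ ∀ᶠ i in F, f i = g i := by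
  rw [Ideal.Quotient.eq]
  change (∀ᶠ i in F, (f - g) i = 0) ↔ _
  simp [sub_eq_zero]

theorem mk_eq_zero_iff {f : ∀ i, B i} : mk F B f = 0 ↔ ∀ᶠ i in F, f i = 0 := by
  rw [← map_zero (mk F B), mk_eq_iff]; rfl

theorem mk_mem_span_image_iff {J : Type*} [Fintype J] (y : J → ∀ i, B i) (s : Set J)
    (z : ∀ i, B i) :
    mk F B z ∈ Ideal.span ((fun j => mk F B (y j)) '' s) ↔
      ∀ᶠ i in F, z i ∈ Ideal.span ((fun j => y j i) '' s) := by
  constructor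
  · intro h
    obtain ⟨c, hc, h⟩ := (mem_span_image_iff_exists_sum _ _ _).1 h
    choose c' hc' using fun j => Ideal.Quotient.mk_surjective (c j)
    have h2 : mk F B z = mk F B (∑ j, c' j * y j) := by
      rw [h, map_sum]
      simp [hc']
    rw [mk_eq_iff] at h2
    have h3 : ∀ j, ∀ᶠ i in F, j ∉ s → c' j i = 0 := by
      intro j
      by_cases hj : j ∈ s
      · simp [hj]
      · have := hc j hj
        rw [← hc', mk_eq_zero_iff] at this
        filter_upwards [this] with i hi _ using hi
    filter_upwards [h2, eventually_all.2 h3] with i h4 h5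
    exact mem_span_image_of_exists_sum (fun j => c' j i) h5 (by simpa using h4)
  · intro h
    have h1 : ∀ i, ∃ c : J → B i, (∀ j, j ∉ s → c j = 0) ∧
        (z i ∈ Ideal.span ((fun j => y j i) '' s) → z i = ∑ j, c j * y j i) := by
      intro i
      by_cases hi : z i ∈ Ideal.span ((fun j => y j i) '' s)
      · obtain ⟨c, hc, hz⟩ := (mem_span_image_iff_exists_sum _ _ _).1 hi
        exact ⟨c, hc, fun _ => hz⟩
      · exact ⟨0, by simp, fun h => absurd h hi⟩
    choose c hc hz using h1
    refine mem_span_image_of_exists_sum (fun j => mk F B fun i => c i j) ?_ ?_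
    · intro j hj
      rw [mk_eq_zero_iff]
      exact Eventually.of_forall fun i => hc i j hj
    · rw [← Finset.sum_congr rfl fun j _ => map_mul _ _ _, ← map_sum, mk_eq_iff]
      filter_upwards [h] with i hi
      simpa using hz i hi

theorem mk_dvd_mk_iff (y z : ∀ i, B i) :
    mk F B y ∣ mk F B z ↔ ∀ᶠ i in F, y i ∣ z i := by
  simpa [Ideal.mem_span_singleton] using
    mk_mem_span_image_iff (F := F) (fun _ : Unit => y) Set.univ z

theorem nontrivial [F.NeBot] [∀ i, Nontrivial (B i)] : Nontrivial (ReducedProduct F B) := by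
  refine ⟨0, 1, fun h => ?_⟩
  rw [← map_one (mk F B), eq_comm, mk_eq_zero_iff] at h
  obtain ⟨i, hi⟩ := h.exists
  exact one_ne_zero hi

variable (p : ℕ) [hp : Fact p.Prime]

theorem charP [F.NeBot] [∀ i, CharP (B i) p] : CharP (ReducedProduct F B) p := by
  have : ∀ i, Nontrivial (B i) := fun i => CharP.nontrivial_of_char_ne_one hp.out.ne_one
  have := nontrivial (F := F) (B := B)
  refine (CharP.charP_iff_prime_eq_zero hp.out).2 ?_
  rw [← map_natCast (mk F B), mk_eq_zero_iff]
  exact Eventually.of_forall fun i => by simp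

theorem perfectRing [F.NeBot] [∀ i, CharP (B i) p] [∀ i, PerfectRing (B i) p]
    [CharP (ReducedProduct F B) p] : PerfectRing (ReducedProduct F B) p := by
  refine ⟨?_, ?_⟩
  · change Function.Injective (frobenius (ReducedProduct F B) p)
    rw [injective_iff_map_eq_zero]
    intro a ha
    obtain ⟨a, rfl⟩ := Ideal.Quotient.mk_surjective a
    rw [frobenius_def, ← map_pow, mk_eq_zero_iff] at ha
    rw [mk_eq_zero_iff]
    filter_upwards [ha] with i hi
    exact (injective_iff_map_eq_zero _).1 (bijective_frobenius (B i) p).1 _ (by simpa [frobenius_def])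
  · intro a
    obtain ⟨a, rfl⟩ := Ideal.Quotient.mk_surjective a
    choose b hb using fun i => (bijective_frobenius (B i) p).2 (a i)
    refine ⟨mk F B b, ?_⟩
    change mk F B b ^ p = _
    rw [← map_pow]
    congr 1
    ext i
    exact hb i

theorem isTestSeq [F.NeBot] {N : ℕ} {D : Type} [CommRing D] {n : ℕ} {x : Fin n → D}
    {φ : ∀ i, D →+* B i} {y : Fin (n + 1) → ∀ i, B i}
    (h : ∀ i, IsTestSeq N x (φ i) fun j => y j i) :
    IsTestSeq N x ((mk F B).comp (RingHom.pi φ)) fun j => mk F B (y j) where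
  map_x j := by
    rw [RingHom.comp_apply]
    congr 1
    ext i
    exact (h i).map_x j
  colon := by
    intro j z hz
    obtain ⟨z, rfl⟩ := Ideal.Quotient.mk_surjective z
    simp only [← map_pow] at hz ⊢
    rw [← map_mul] at hz
    rw [mk_mem_span_image_iff (fun j => y j ^ N)] at hz ⊢
    filter_upwards [hz] with i hi
    exact (h i).colon j (z i) hi
  reg := by
    intro g hg z hz
    obtain ⟨z, rfl⟩ := Ideal.Quotient.mk_surjective z
    rw [RingHom.comp_apply, ← map_mul, mk_dvd_mk_iff] at hz
    rw [mk_dvd_mk_iff]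
    filter_upwards [hz] with i hi
    exact (h i).reg g hg (z i) hi
  ntriv := by
    intro g M hg hz
    rw [RingHom.comp_apply, ← map_mul] at hz
    simp only [← map_pow] at hz
    rw [mk_mem_span_image_iff (fun j => (y j ^ twoThen M j) ^ N)] at hz
    obtain ⟨i, hi⟩ := hz.exists
    exact (h i).ntriv g M hg hi

end ReducedProduct

end ReducedProduct

/-! ### The polynomial ring over a power series ring -/

section PowerSeriesBase

open MvPowerSeries

/-- Membership in an ideal generated by powers of some of the variables. -/
theorem MvPowerSeries.mem_span_X_pow_iff {σ k : Type*} [CommRing k] (a : σ → ℕ)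
    (s : Finset σ) (z : MvPowerSeries σ k) :
    z ∈ Ideal.span ((fun i => (X i : MvPowerSeries σ k) ^ a i) '' s) ↔
      ∀ ν : σ →₀ ℕ, (∀ i ∈ s, ν i < a i) → coeff ν z = 0 := by
  classical
  constructor
  · intro hz ν hν
    refine Submodule.span_induction (p := fun z _ => ∀ ν : σ →₀ ℕ, (∀ i ∈ s, ν i < a i) →
      coeff ν z = 0) ?_ ?_ ?_ ?_ hz ν hν
    · rintro _ ⟨i, hi, rfl⟩ ν hν
      exact X_pow_dvd_iff.1 dvd_rfl ν (hν i hi)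
    · simp
    · intro x y _ _ hx hy ν hν
      rw [map_add, hx ν hν, hy ν hν, add_zero]
    · intro r x _ hx ν hν
      rw [smul_eq_mul, coeff_mul]
      refine Finset.sum_eq_zero fun q hq => ?_
      rw [hx q.2, mul_zero]
      intro i hi
      refine lt_of_le_of_lt ?_ (hν i hi)
      rw [← Finset.HasAntidiagonal.mem_antidiagonal.1 hq]
      simp
  · induction s using Finset.induction_on generalizing z with
    | empty =>
      intro h
      have : z = 0 := by
        ext ν
        exact h ν (by simp)
      simp [this]
    | insert j s hj ih =>
      intro h
      let z1 : MvPowerSeries σ k := fun ν => if a j ≤ ν j then coeff ν z else 0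
      let z2 : MvPowerSeries σ k := fun ν => if a j ≤ ν j then 0 else coeff ν z
      have hz1 : ∀ ν, coeff ν z1 = if a j ≤ ν j then coeff ν z else 0 := fun ν => rfl
      have hz2 : ∀ ν, coeff ν z2 = if a j ≤ ν j then 0 else coeff ν z := fun ν => rfl
      have hz : z = z1 + z2 := by
        ext ν
        rw [map_add, hz1, hz2]
        split_ifs <;> simp
      rw [hz]
      refine Ideal.add_mem _ ?_ ?_
      · refine Ideal.mem_of_dvd _ (b := z1) (X_pow_dvd_iff.2 fun ν hν => ?_)
          (Ideal.subset_span ⟨j, by simp, rfl⟩)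
        rw [hz1, if_neg (by omega)]
      · refine Ideal.span_mono (Set.image_mono ?_) (ih z2 fun ν hν => ?_)
        · simp
        · rw [hz2]
          split_ifs with h1
          · rfl
          · apply h
            intro i hi
            rcases Finset.mem_insert.1 hi with rfl | hi
            · omega
            · exact hν i hi

/-- Membership in the ideal of `D[T]` generated by a power of `T` and an ideal of `D`. -/
theorem Polynomial.mem_span_X_pow_sup_iff {D : Type*} [CommRing D] (I : Ideal D) (N : ℕ)
    (z : Polynomial D) :
    z ∈ Ideal.span {Polynomial.X ^ N} ⊔ I.map Polynomial.C ↔ ∀ m < N, z.coeff m ∈ I := by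
  constructor
  · intro hz m hm
    obtain ⟨u, hu, v, hv, rfl⟩ := Submodule.mem_sup.1 hz
    rw [Ideal.mem_span_singleton] at hu
    rw [Polynomial.coeff_add, Polynomial.X_pow_dvd_iff.1 hu m hm, zero_add]
    exact Ideal.mem_map_C_iff.1 hv m
  · intro h
    rw [← Polynomial.sum_C_mul_X_pow_eq z, Polynomial.sum]
    refine Ideal.sum_mem _ fun m _ => ?_
    by_cases hm : m < N
    · exact Ideal.mul_mem_right _ _ (Ideal.mem_sup_right (Ideal.mem_map_of_mem _ (h m hm)))
    · refine Ideal.mul_mem_left _ _ (Ideal.mem_sup_left (Ideal.mem_span_singleton.2 ?_))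
      exact pow_dvd_pow _ (not_lt.1 hm)

/-- The sequence `(T, x₁, …, xₙ)` in `k⟦x₁, …, xₙ⟧[T]`. -/
noncomputable def baseSeq (k : Type) [CommRing k] (n : ℕ) :
    Fin (n + 1) → Polynomial (MvPowerSeries (Fin n) k) :=
  Fin.cons Polynomial.X fun i => Polynomial.C (X i)

theorem mem_span_baseSeq_pow_iff (k : Type) [CommRing k] (n : ℕ) (b : ℕ) (a : Fin n → ℕ)
    (s : Finset (Fin n)) (z : Polynomial (MvPowerSeries (Fin n) k)) :
    z ∈ Ideal.span ((fun j => baseSeq k n j ^ (Fin.cons b a : Fin (n + 1) → ℕ) j) ''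
        (insert 0 (Fin.succ '' s))) ↔
      ∀ m < b, ∀ ν : Fin n →₀ ℕ, (∀ i ∈ s, ν i < a i) → coeff ν (z.coeff m) = 0 := by
  have : Ideal.span ((fun j => baseSeq k n j ^ (Fin.cons b a : Fin (n + 1) → ℕ) j) ''
        (insert 0 (Fin.succ '' s))) = Ideal.span {Polynomial.X ^ b} ⊔
        (Ideal.span ((fun i => (X i : MvPowerSeries (Fin n) k) ^ a i) '' s)).map
          Polynomial.C := by
    rw [Set.image_insert_eq, Ideal.span_insert, Ideal.map_span, Set.image_image, Set.image_image]
    simp [baseSeq]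
  rw [this, Polynomial.mem_span_X_pow_sup_iff]
  simp only [MvPowerSeries.mem_span_X_pow_iff]

theorem isTestSeq_baseSeq (p : ℕ) [hp : Fact p.Prime] (k : Type) [Field k] [CharP k p] (n : ℕ)
    (e : ℕ) : IsTestSeq (p ^ e) (X : Fin n → MvPowerSeries (Fin n) k) Polynomial.C
      (baseSeq k n) where
  map_x i := by simp [baseSeq]
  colon := by
    intro i z hz
    rcases Fin.eq_zero_or_eq_succ i with rfl | ⟨i, rfl⟩
    · simp only [Fin.not_lt_zero, Set.ofPred_false, Set.image_empty, Ideal.span_empty,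
        Ideal.mem_bot] at hz ⊢
      simpa [baseSeq] using hz
    · have hset : {j | j < i.succ} = insert 0 (Fin.succ '' (Finset.Iio i : Set (Fin n))) := by
        ext j
        rcases Fin.eq_zero_or_eq_succ j with rfl | ⟨j, rfl⟩
        · simp
        · simp
      have hexp : (fun j => baseSeq k n j ^ p ^ e) = fun j => baseSeq k n j ^
          (Fin.cons (p ^ e) (fun _ => p ^ e) : Fin (n + 1) → ℕ) j := by
        ext1 j
        refine Fin.cases ?_ (fun j => ?_) j <;> simp
      rw [hexp, hset, mem_span_baseSeq_pow_iff] at hz ⊢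
      intro m hm ν hν
      have := hz m hm (ν + Finsupp.single i (p ^ e)) (by
        intro j hj
        have hji : j ≠ i := (by simpa using hj : j < i).ne
        simpa [Finsupp.single_apply, hji.symm] using hν j hj)
      rw [baseSeq, Fin.cons_succ, ← map_pow, Polynomial.coeff_C_mul, X_pow_eq, add_comm,
        coeff_add_monomial_mul, one_mul] at this
      exact this
  reg := by
    intro g hg z hz
    have h0 : baseSeq k n 0 = Polynomial.X := rfl
    rw [h0, Polynomial.X_dvd_iff] at hz ⊢
    rw [Polynomial.coeff_C_mul] at hz
    exact (mul_eq_zero.1 hz).resolve_left hg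
  ntriv := by
    intro g M hg hz
    have hset : (Set.univ : Set (Fin (n + 1))) =
        insert 0 (Fin.succ '' ((Finset.univ : Finset (Fin n)) : Set (Fin n))) := by
      ext j
      refine Fin.cases ?_ (fun j => ?_) j <;> simp
    have hexp : (fun j => (baseSeq k n j ^ twoThen M j) ^ p ^ e) = fun j => baseSeq k n j ^
        (Fin.cons (2 * p ^ e) (fun _ => M * p ^ e) : Fin (n + 1) → ℕ) j := by
      ext1 j
      refine Fin.cases ?_ (fun j => ?_) j <;> simp [twoThen, pow_mul]
    rw [hexp, hset, mem_span_baseSeq_pow_iff] at hz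
    apply hg
    have := MvPowerSeries.mem_span_X_pow_iff (fun _ => M) Finset.univ g
    rw [Finset.coe_univ, Set.image_univ] at this
    rw [this]
    intro ν hν
    have hpe : 0 < p ^ e := pow_pos hp.out.pos e
    have h1 := hz (p ^ e) (by omega) (p ^ e • ν) (by
      intro i hi
      rw [Finsupp.smul_apply, smul_eq_mul, mul_comm]
      exact Nat.mul_lt_mul_of_pos_right (hν i hi) hpe)
    have h0 : baseSeq k n 0 = Polynomial.X := rfl
    rw [h0, mul_pow, ← map_pow, Polynomial.X_pow_mul, Polynomial.coeff_C_mul_X_pow,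
      if_pos rfl, ← MvPowerSeries.map_iterateFrobenius_expand (hp := hp.out.ne_zero), coeff_map,
      coeff_expand_smul, iterateFrobenius_def] at h1
    exact (pow_eq_zero_iff hpe.ne').1 h1

end PowerSeriesBase

/-! ### Witt vector preliminaries -/

section WittPreliminaries

namespace WittVector

variable {p : ℕ} [hp : Fact p.Prime] {R : Type*} [CommRing R]

theorem add_iterate_verschiebung_coeff_lt (x y : WittVector p R) {i j : ℕ} (hj : j < i) :
    (x + verschiebung^[i] y).coeff j = x.coeff j ∧
      (x + verschiebung^[i] y).coeff i = x.coeff i + y.coeff 0 := by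
  have htail : tail i x = verschiebung^[i] ((tail i x).shift i) := by
    refine eq_iterate_verschiebung fun k hk => ?_
    simp [tail, select, hk.not_ge]
  have hx : x + verschiebung^[i] y = init i x + verschiebung^[i] ((tail i x).shift i + y) := by
    rw [iterate_map_add, ← htail, ← add_assoc, init_add_tail]
  have hdis : ∀ n, (init i x).coeff n = 0 ∨
      (verschiebung^[i] ((tail i x).shift i + y)).coeff n = 0 := by
    intro n
    rcases lt_or_ge n i with h | h
    · exact Or.inr (iterate_verschiebung_coeff_eq_zero _ h)
    · exact Or.inl (by simp [init, select, h.not_gt])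
  rw [hx, coeff_add_of_disjoint _ _ _ hdis, coeff_add_of_disjoint _ _ _ hdis,
    iterate_verschiebung_coeff_eq_zero _ hj]
  refine ⟨by simp [init, select, hj], ?_⟩
  have h := iterate_verschiebung_coeff ((tail i x).shift i + y) i 0
  rw [zero_add] at h
  rw [h, add_coeff_zero, shift_coeff]
  simp [init, tail, select]

theorem add_iterate_verschiebung_coeff_self (x y : WittVector p R) (i : ℕ) :
    (x + verschiebung^[i] y).coeff i = x.coeff i + y.coeff 0 := by
  rcases Nat.eq_zero_or_pos i with rfl | h
  · simp [add_coeff_zero]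
  · exact (add_iterate_verschiebung_coeff_lt x y h).2

theorem teichmuller_mul_iterate_verschiebung [CharP R p] (t y : R) (i : ℕ) :
    teichmuller p t * verschiebung^[i] (teichmuller p y) =
      verschiebung^[i] (teichmuller p (t ^ p ^ i * y)) := by
  have hF : ∀ i, (frobenius^[i] (teichmuller p t) : WittVector p R) =
      teichmuller p (t ^ p ^ i) := by
    intro i
    induction i with
    | zero => simp
    | succ i ih =>
      rw [Function.iterate_succ_apply', ih, frobenius_eq_map_frobenius, map_teichmuller,
        _root_.frobenius_def, ← pow_mul, pow_succ]
  rw [mul_comm, iterate_verschiebung_mul_left, hF, ← map_mul, mul_comm]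

end WittVector

end WittPreliminaries

/-! ### Adjoining a Teichmüller root of a monic polynomial modulo `p - [t]` -/

section TeichmullerRoot

open Polynomial

variable {P : Type} [CommRing P] {t : P}

theorem isFreeModulo_of_surjective {C M : Type} [CommRing C] [CommRing M] [Nontrivial M]
    [Algebra (P ⧸ Ideal.span {t}) M] [Module.Free (P ⧸ Ideal.span {t}) M] {f : P →+* C}
    (ht : ∀ z, f t * z = 0 → z = 0) (π : C →+* M) (hπ : Function.Surjective π)
    (hker : ∀ z, π z = 0 ↔ f t ∣ z)
    (hf : ∀ a, π (f a) = algebraMap _ M (Ideal.Quotient.mk (Ideal.span {t}) a)) :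
    IsFreeModulo f t := by
  classical
  let b := Module.Free.chooseBasis (P ⧸ Ideal.span {t}) M
  choose e he using fun i => hπ (b i)
  refine ⟨ht, _, b.index_nonempty, e, fun z => ?_, fun v hv i => ?_⟩
  · choose s hs using Ideal.Quotient.mk_surjective (I := Ideal.span {t})
    refine ⟨Finsupp.onFinset (b.repr (π z)).support
      (fun i => if b.repr (π z) i = 0 then 0 else s (b.repr (π z) i)) fun i hi => ?_, ?_⟩
    · rw [Finsupp.mem_support_iff]
      rintro h0
      simp [h0] at hi
    · rw [← hker, map_sub, sub_eq_zero]
      rw [Finsupp.onFinset_sum _ (by simp), map_sum]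
      conv_lhs => rw [← b.linearCombination_repr (π z), Finsupp.linearCombination_apply,
        Finsupp.sum]
      refine Finset.sum_congr rfl fun i hi => ?_
      rw [Finsupp.mem_support_iff] at hi
      rw [if_neg hi, map_mul, hf, hs, he, Algebra.smul_def]
  · rw [← hker, Finsupp.sum, map_sum] at hv
    have h := linearIndependent_iff'.1 b.linearIndependent v.support
      (fun i => Ideal.Quotient.mk _ (v i)) (by
        rw [← hv]
        exact Finset.sum_congr rfl fun i _ => by rw [map_mul, hf, he, Algebra.smul_def])
    by_cases hi : i ∈ v.support
    · exact Ideal.mem_span_singleton.1 (Ideal.Quotient.eq_zero_iff_mem.1 (h i hi))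
    · rw [Finsupp.notMem_support_iff.1 hi]
      exact dvd_zero _

variable {p : ℕ} [hp : Fact p.Prime]

/-- The coefficient of index `i` of `b * p - (F([a]) + [t] * b)`, computed naively. -/
noncomputable def rootDefect (F : (WittVector p P)[X]) {C : Type} [CommRing C] (f : P →+* C) (t : P)
    (a : C) (b : WittVector p C) (i : ℕ) : C :=
  (b * p).coeff i -
    (F.eval₂ (WittVector.map f) (WittVector.teichmuller p a) +
      WittVector.teichmuller p (f t) * b).coeff i

/-- `a` and the first `i` coefficients of `b` solve the first `i` coefficients of the equation
`F([a]) + [t] * b = b * p`; modulo `t`, the algebra `C` is a polynomial ring over a free algebra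
in a variable in which the next defect is monic. -/
structure IsRootStage (F : (WittVector p P)[X]) (t : P) (i : ℕ) {C E : Type} [CommRing C] [CommRing E]
    [Algebra (P ⧸ Ideal.span {t}) E] (f : P →+* C) (a : C) (b : WittVector p C)
    (π : C →+* E[X]) (m : E[X]) : Prop where
  nzd : ∀ z, f t * z = 0 → z = 0
  surj : Function.Surjective π
  ker : ∀ z, π z = 0 ↔ f t ∣ z
  const : ∀ c, π (f c) = Polynomial.C (algebraMap _ E (Ideal.Quotient.mk (Ideal.span {t}) c))
  coeff_lt : ∀ j < i, rootDefect F f t a b j = 0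
  coeff_ge : ∀ j, i ≤ j → b.coeff j = 0
  monic : m.Monic
  pos : 0 < m.natDegree
  defect : π (rootDefect F f t a b i) = m ∨ π (rootDefect F f t a b i) = -m

theorem isRootStage_zero [CharP P p] [Nontrivial (P ⧸ Ideal.span {t})] (ht : ∀ z, t * z = 0 → z = 0)
    {F : (WittVector p P)[X]} (hF : F.Monic) (hd : 0 < F.natDegree) :
    ∃ m : (P ⧸ Ideal.span {t})[X], IsRootStage F t 0 (Polynomial.C : P →+* P[X]) X 0
      (mapRingHom (Ideal.Quotient.mk (Ideal.span {t}))) m := by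
  have hdvd : ∀ z : P[X], Polynomial.C t ∣ z ↔ ∀ j, t ∣ z.coeff j := fun z => C_dvd_iff_dvd_coeff _ _
  let Fbar : P[X] := F.map WittVector.constantCoeff
  have hdef : rootDefect F (Polynomial.C : P →+* P[X]) t X 0 0 = - Fbar := by
    have h1 : (F.eval₂ (WittVector.map Polynomial.C)
        (WittVector.teichmuller p (X : P[X]))).coeff 0 = Fbar := by
      change WittVector.constantCoeff _ = _
      rw [hom_eval₂]
      have : (WittVector.constantCoeff : WittVector p P[X] →+* P[X]).comp
          (WittVector.map Polynomial.C) = Polynomial.C.comp WittVector.constantCoeff := by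
        ext; simp
      rw [this]
      have hX : (WittVector.constantCoeff : WittVector p P[X] →+* P[X])
          (WittVector.teichmuller p X) = X := by simp
      rw [hX, ← eval₂_map, eval₂_C_X]
    simp [rootDefect, h1]
  refine ⟨Fbar.map (Ideal.Quotient.mk _), ?_, ?_, ?_, ?_, ?_, ?_, ?_, ?_, ?_⟩
  · intro z hz
    ext j
    exact ht _ (by simpa using congrArg (fun q => q.coeff j) hz)
  · exact map_surjective _ Ideal.Quotient.mk_surjective
  · intro z
    rw [hdvd, Polynomial.ext_iff]
    simp [Ideal.Quotient.eq_zero_iff_mem, Ideal.mem_span_singleton]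
  · simp
  · simp
  · simp
  · exact (hF.map _).map _
  · have := (Ideal.Quotient.mk (Ideal.span {t})).domain_nontrivial
    rw [(hF.map _).natDegree_map, hF.natDegree_map _]
    exact hd
  · right
    rw [hdef]
    simp

theorem rootDefect_map (F : (WittVector p P)[X]) {C C' : Type} [CommRing C] [CommRing C']
    (f : P →+* C) (g : C →+* C') (t : P) (a : C) (b : WittVector p C) (i : ℕ) :
    rootDefect F (g.comp f) t (g a) (WittVector.map g b) i = g (rootDefect F f t a b i) := by
  have h1 : (WittVector.map (p := p) (g.comp f)) = (WittVector.map g).comp (WittVector.map f) := by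
    ext; simp
  rw [rootDefect, rootDefect, map_sub, ← WittVector.map_coeff, ← WittVector.map_coeff, map_mul,
    map_natCast, map_add, hom_eval₂, map_mul, WittVector.map_teichmuller,
    WittVector.map_teichmuller, h1, RingHom.comp_apply]

theorem exists_rootDefect_eq_zero {F : (WittVector p P)[X]} {C C' : Type} [CommRing C]
    [CommRing C'] [CharP C' p] (f : P →+* C) (g : C →+* C') (t : P) (a : C) (b : WittVector p C)
    (i : ℕ) (hlt : ∀ j < i, rootDefect F f t a b j = 0) (hge : ∀ j, i ≤ j → b.coeff j = 0)
    (z : C') (hz : g (f (t ^ p ^ i)) * z = g (rootDefect F f t a b i)) :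
    ∃ b' : WittVector p C', (∀ j < i + 1, rootDefect F (g.comp f) t (g a) b' j = 0) ∧
      (∀ j, i + 1 ≤ j → b'.coeff j = 0) ∧ b'.coeff i = z := by
  let b' : WittVector p C' :=
    WittVector.map g b + WittVector.verschiebung^[i] (WittVector.teichmuller p z)
  have hb'lt : ∀ j < i, b'.coeff j = (WittVector.map g b).coeff j := fun j hj =>
    (WittVector.add_iterate_verschiebung_coeff_lt _ _ hj).1
  have hb'p : ∀ j ≤ i, (b' * p).coeff j = (WittVector.map g b * p).coeff j := by
    rintro (_ | j) hj
    · rw [WittVector.mul_charP_coeff_zero, WittVector.mul_charP_coeff_zero]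
    · rw [WittVector.mul_charP_coeff_succ, WittVector.mul_charP_coeff_succ, hb'lt j hj]
  have htb' : WittVector.teichmuller p (g (f t)) * b' =
      WittVector.teichmuller p (g (f t)) * WittVector.map g b + WittVector.verschiebung^[i]
        (WittVector.teichmuller p (g (rootDefect F f t a b i))) := by
    rw [mul_add, WittVector.teichmuller_mul_iterate_verschiebung, ← hz]
    simp
  refine ⟨b', ?_, ?_, ?_⟩
  · intro j hj
    have h1 := rootDefect_map F f g t a b j
    have hj' : j ≤ i := Nat.lt_succ_iff.1 hj
    rw [rootDefect, hb'p j hj', RingHom.comp_apply, htb', ← add_assoc]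
    rcases hj'.lt_or_eq with hlt' | rfl
    · rw [(WittVector.add_iterate_verschiebung_coeff_lt _ _ hlt').1]
      rw [hlt j hlt', map_zero] at h1
      exact h1
    · rw [WittVector.add_iterate_verschiebung_coeff_self, ← sub_sub]
      rw [rootDefect, RingHom.comp_apply] at h1
      rw [h1]
      simp
  · intro j hj
    have hdis : ∀ n, (WittVector.map g b).coeff n = 0 ∨
        (WittVector.verschiebung^[i] (WittVector.teichmuller p z)).coeff n = 0 := by
      intro n
      rcases lt_or_ge n i with h | h
      · exact Or.inr (WittVector.iterate_verschiebung_coeff_eq_zero _ h)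
      · exact Or.inl (by rw [WittVector.map_coeff, hge n h, map_zero])
    obtain ⟨k, rfl⟩ := Nat.exists_eq_add_of_le' hj
    simp only [b']
    rw [WittVector.coeff_add_of_disjoint _ _ _ hdis, WittVector.map_coeff, hge _ (by lia),
      show k + (i + 1) = (k + 1) + i by ring, WittVector.iterate_verschiebung_coeff,
      WittVector.teichmuller_coeff_pos _ _ _ k.succ_pos]
    simp
  · rw [WittVector.add_iterate_verschiebung_coeff_self, WittVector.map_coeff, hge i le_rfl]
    simp

/-- If `q` is regular modulo the nonzerodivisor `t`, then `t` is a nonzerodivisor on `C[X] / (q)`. -/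
theorem adjoinRoot_nzd {C : Type} [CommRing C] {t : C} {q : C[X]} (ht : ∀ z, t * z = 0 → z = 0)
    (hq : ∀ w, Polynomial.C t ∣ q * w → Polynomial.C t ∣ w) (z : AdjoinRoot q)
    (hz : AdjoinRoot.of q t * z = 0) : z = 0 := by
  obtain ⟨z, rfl⟩ := AdjoinRoot.mk_surjective z
  rw [← AdjoinRoot.mk_C, ← map_mul, AdjoinRoot.mk_eq_zero] at hz
  obtain ⟨w, hw⟩ := hz
  obtain ⟨v, rfl⟩ := hq w ⟨z, hw.symm⟩
  rw [AdjoinRoot.mk_eq_zero]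
  refine ⟨v, ?_⟩
  rw [← sub_eq_zero]
  ext j
  rw [coeff_zero]
  apply ht
  have := congrArg (fun k => k.coeff j) (show Polynomial.C t * (z - q * v) = 0 by
    rw [mul_sub, hw]; ring)
  simpa using this

/-- If `ρ : C → E` is surjective with kernel `(t, u)` and `t ∣ s`, then `C[X] / (s X - u)` modulo
`t` is `E[X]`. -/
theorem exists_adjoin_hom {C E : Type} [CommRing C] [CommRing E] {t s u : C}
    (ht : ∀ z, t * z = 0 → z = 0) (hu : ∀ z, t ∣ u * z → t ∣ z)
    (ρ : C →+* E) (hρ : Function.Surjective ρ) (hs : t ∣ s)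
    (hker : ∀ z, ρ z = 0 ↔ ∃ c d, z = t * c + u * d) :
    ∃ (C' : Type) (_ : CommRing C') (g : C →+* C') (r : C') (π : C' →+* E[X]),
      g s * r = g u ∧ (∀ z, g t * z = 0 → z = 0) ∧ Function.Surjective π ∧
      (∀ z, π z = 0 ↔ g t ∣ z) ∧ (∀ c, π (g c) = Polynomial.C (ρ c)) ∧ π r = X := by
  set q : C[X] := Polynomial.C s * X - Polynomial.C u with hq
  have hρt : ρ t = 0 := (hker t).2 ⟨1, 0, by ring⟩
  have hρu : ρ u = 0 := (hker u).2 ⟨0, 1, by ring⟩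
  have hρs : ρ s = 0 := by obtain ⟨c, rfl⟩ := hs; rw [map_mul, hρt, zero_mul]
  have hq0 : q.eval₂ (Polynomial.C.comp ρ) X = 0 := by simp [q, hρs, hρu]
  have hroot : AdjoinRoot.of q s * AdjoinRoot.root q = AdjoinRoot.of q u := by
    have : AdjoinRoot.mk q (Polynomial.C s * X - Polynomial.C u) = 0 := AdjoinRoot.mk_self
    rwa [map_sub, map_mul, AdjoinRoot.mk_X, AdjoinRoot.mk_C, AdjoinRoot.mk_C, sub_eq_zero] at this
  have hπ : ∀ z, AdjoinRoot.lift _ _ hq0 (AdjoinRoot.mk q z) = z.map ρ := by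
    intro z
    rw [AdjoinRoot.lift_mk, ← eval₂_map, eval₂_C_X]
  refine ⟨AdjoinRoot q, inferInstance, AdjoinRoot.of q, AdjoinRoot.root q,
    AdjoinRoot.lift _ _ hq0, hroot, adjoinRoot_nzd ht fun w hw => ?_, ?_, ?_, ?_,
    AdjoinRoot.lift_root _⟩
  · rw [C_dvd_iff_dvd_coeff]
    intro j
    apply hu
    have h1 : Polynomial.C t ∣ Polynomial.C u * w := by
      have h2 : Polynomial.C t ∣ Polynomial.C s := map_dvd Polynomial.C hs
      have h3 : Polynomial.C u * w = Polynomial.C s * (X * w) - q * w := by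
        rw [hq]; ring
      rw [h3]
      exact dvd_sub (h2.mul_right _) hw
    rw [C_dvd_iff_dvd_coeff] at h1
    simpa using h1 j
  · intro z
    obtain ⟨z, rfl⟩ := map_surjective ρ hρ z
    exact ⟨AdjoinRoot.mk q z, hπ z⟩
  · intro z
    constructor
    · intro hz
      obtain ⟨z, rfl⟩ := AdjoinRoot.mk_surjective z
      rw [hπ] at hz
      have h1 : ∀ j, AdjoinRoot.of q t ∣ AdjoinRoot.of q (z.coeff j) := by
        intro j
        obtain ⟨c, d, h2⟩ := (hker (z.coeff j)).1 (by
          simpa using congrArg (fun k => k.coeff j) hz)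
        rw [h2, map_add, map_mul, map_mul, ← hroot]
        exact dvd_add (dvd_mul_right _ _)
          (((map_dvd (AdjoinRoot.of q) hs).mul_right _).mul_right _)
      rw [← AdjoinRoot.aeval_eq, aeval_eq_sum_range]
      refine Finset.dvd_sum fun j _ => ?_
      rw [Algebra.smul_def]
      exact (h1 j).mul_right _
    · rintro ⟨w, rfl⟩
      rw [map_mul, AdjoinRoot.lift_of, RingHom.comp_apply, hρt]
      simp
  · intro c
    rw [AdjoinRoot.lift_of, RingHom.comp_apply]

variable [CharP P p] {C E : Type} [CommRing C] [CommRing E] [Algebra (P ⧸ Ideal.span {t}) E]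

theorem IsRootStage.step [Nontrivial E] [Module.Free (P ⧸ Ideal.span {t}) E]
    {F : (WittVector p P)[X]} {i : ℕ}
    {f : P →+* C} {a : C} {b : WittVector p C} {π : C →+* E[X]} {m : E[X]}
    (h : IsRootStage F t i f a b π m) :
    ∃ (C' E' : Type) (_ : CommRing C') (_ : CommRing E') (_ : Algebra (P ⧸ Ideal.span {t}) E')
      (_ : Nontrivial E') (_ : Module.Free (P ⧸ Ideal.span {t}) E')
      (f' : P →+* C') (a' : C') (b' : WittVector p C') (π' : C' →+* E'[X]) (m' : E'[X]),
      IsRootStage F t (i + 1) f' a' b' π' m' := by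
  set u := rootDefect F f t a b i with hu
  set s := f (t ^ p ^ i) with hs
  have hne : p ^ i ≠ 0 := pow_ne_zero _ hp.out.ne_zero
  have hπt : π (f t) = 0 := (h.ker _).2 dvd_rfl
  have hsdvd : f t ∣ s := by rw [hs, map_pow]; exact dvd_pow_self _ hne
  let E' := AdjoinRoot m
  have hfreeE' : Module.Free E E' := h.monic.free_adjoinRoot
  have hnontriv : Nontrivial E' := by
    refine ⟨1, 0, fun h10 => ?_⟩
    rw [← map_one (AdjoinRoot.mk m), AdjoinRoot.mk_eq_zero] at h10
    exact h.monic.not_dvd_of_natDegree_lt one_ne_zero (by simpa using h.pos) h10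
  have hfree : Module.Free (P ⧸ Ideal.span {t}) E' := by
    have : IsScalarTower (P ⧸ Ideal.span {t}) E E' := inferInstance
    exact Module.Free.trans (S := E)
  have hassoc : Associated m (π u) := by
    rcases h.defect with h1 | h1 <;> rw [hu, h1]
    exact (Associated.refl m).neg_right
  let ρ : C →+* E' := (AdjoinRoot.mk m).comp π
  have hρker : ∀ z, ρ z = 0 ↔ ∃ c d, z = f t * c + u * d := by
    intro z
    rw [RingHom.comp_apply, AdjoinRoot.mk_eq_zero, hassoc.dvd_iff_dvd_left]
    constructor
    · rintro ⟨w, hw⟩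
      obtain ⟨d, rfl⟩ := h.surj w
      obtain ⟨c, hc⟩ := (h.ker (z - u * d)).1 (by rw [map_sub, map_mul, hw, sub_self])
      exact ⟨c, d, by linear_combination hc⟩
    · rintro ⟨c, d, rfl⟩
      rw [map_add, map_mul, map_mul, hπt, zero_mul, zero_add]
      exact dvd_mul_right _ _
  have hureg : ∀ z, f t ∣ u * z → f t ∣ z := by
    intro z hz
    rw [← h.ker, map_mul] at hz
    rw [← h.ker]
    obtain ⟨v, hv⟩ := hassoc
    rw [← hv, mul_assoc, h.monic.isRegular.left.mul_left_eq_zero_iff] at hz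
    exact v.mul_right_eq_zero.1 hz
  have hρ : Function.Surjective ρ := AdjoinRoot.mk_surjective.comp h.surj
  obtain ⟨C', _, g, r, π', hr, hnzd, hsurj, hker, hπ'g, hπ'r⟩ :=
    exists_adjoin_hom h.nzd hureg ρ hρ hsdvd hρker
  have hC'p : CharP C' p := by
    have : Nontrivial C' := π'.domain_nontrivial
    exact PerfectClosure.charP_of_nontrivial p (g.comp f)
  obtain ⟨b', hb'lt, hb'ge, hb'i⟩ := exists_rootDefect_eq_zero f g t a b i h.coeff_lt h.coeff_ge
    r hr
  have hρt : ρ (f t) = 0 := (hρker _).2 ⟨1, 0, by ring⟩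
  refine ⟨C', E', inferInstance, inferInstance, inferInstance, hnontriv, hfree, g.comp f, g a, b',
    π', X ^ p - Polynomial.C (ρ ((F.eval₂ (WittVector.map f)
      (WittVector.teichmuller p a)).coeff (i + 1))), hnzd, hsurj, hker, ?_, hb'lt, hb'ge,
      monic_X_pow_sub_C _ hp.out.ne_zero, ?_, ?_⟩
  · intro c
    rw [RingHom.comp_apply, hπ'g, RingHom.comp_apply, h.const, AdjoinRoot.mk_C]
    rfl
  · rw [natDegree_X_pow_sub_C]; exact hp.out.pos
  · left
    have hmap : WittVector.map (p := p) (g.comp f) =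
        (WittVector.map g).comp (WittVector.map f) := by
      ext; simp
    rw [rootDefect, WittVector.mul_charP_coeff_succ, hb'i, map_sub, map_pow, hπ'r,
      ← WittVector.map_coeff, map_add, map_mul, WittVector.map_teichmuller,
      RingHom.comp_apply, hπ'g, hρt, map_zero, WittVector.teichmuller_zero, zero_mul, add_zero,
      hmap, ← WittVector.map_teichmuller, ← hom_eval₂, WittVector.map_coeff, WittVector.map_coeff,
      hπ'g]

end TeichmullerRoot

section TeichmullerRootExists

open Polynomial Filter

variable {p : ℕ} [hp : Fact p.Prime] {P : Type} [CommRing P] {t : P} [CharP P p]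

theorem exists_isRootStage [Nontrivial (P ⧸ Ideal.span {t})] (ht : ∀ z, t * z = 0 → z = 0)
    {F : (WittVector p P)[X]} (hF : F.Monic) (hd : 0 < F.natDegree) (i : ℕ) :
    ∃ (C E : Type) (_ : CommRing C) (_ : CommRing E) (_ : Algebra (P ⧸ Ideal.span {t}) E)
      (_ : Nontrivial E) (_ : Module.Free (P ⧸ Ideal.span {t}) E)
      (f : P →+* C) (a : C) (b : WittVector p C) (π : C →+* E[X]) (m : E[X]),
      IsRootStage F t i f a b π m := by
  induction i with
  | zero =>
    obtain ⟨m, hm⟩ := isRootStage_zero ht hF hd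
    exact ⟨_, _, _, _, _, inferInstance, inferInstance, _, _, _, _, m, hm⟩
  | succ i ih =>
    obtain ⟨C, E, _, _, _, _, _, f, a, b, π, m, h⟩ := ih
    exact h.step

theorem exists_isFreeModulo_rootDefect [Nontrivial (P ⧸ Ideal.span {t})]
    (ht : ∀ z, t * z = 0 → z = 0)
    {F : (WittVector p P)[X]} (hF : F.Monic) (hd : 0 < F.natDegree) (i : ℕ) :
    ∃ (C : Type) (_ : CommRing C) (_ : CharP C p) (f : P →+* C) (a : C) (b : WittVector p C),
      IsFreeModulo f t ∧ ∀ j < i, rootDefect F f t a b j = 0 := by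
  obtain ⟨C, E, _, _, _, _, _, f, a, b, π, m, h⟩ := exists_isRootStage ht hF hd i
  have : Nontrivial C := π.domain_nontrivial
  have : Module.Free (P ⧸ Ideal.span {t}) E[X] := Module.Free.trans (S := E)
  exact ⟨C, _, PerfectClosure.charP_of_nontrivial p f, f, a, b,
    isFreeModulo_of_surjective h.nzd π h.surj h.ker h.const, h.coeff_lt⟩

variable [PerfectRing P p] {D : Type} [CommRing D] {n : ℕ} {x : Fin n → D} {φ : D →+* P}
  {y : Fin (n + 1) → P}

/-- Over a perfect ring with a test sequence, any monic polynomial with Witt vector coefficients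
acquires a Teichmüller root modulo `p - [t]` in some extension with the same property. -/
theorem IsTestSeq.exists_teichmuller_root (h : IsTestSeq 1 x φ y)
    (hx : Ideal.span (Set.range x) ≠ ⊤) {F : (WittVector p P)[X]} (hF : F.Monic)
    (hd : 0 < F.natDegree) :
    ∃ (P' : Type) (_ : CommRing P') (_ : CharP P' p) (_ : PerfectRing P' p) (f : P →+* P')
      (a : P') (b : WittVector p P'), IsTestSeq 1 x (f.comp φ) (fun j => f (y j)) ∧
      F.eval₂ (WittVector.map f) (WittVector.teichmuller p a) =
        (p - WittVector.teichmuller p (f (y 0))) * b := by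
  have hnt : Nontrivial (P ⧸ Ideal.span {y 0}) := by
    refine Ideal.Quotient.nontrivial_iff.2 fun htop => ?_
    have h1 := h.ntriv 1 1 (by simpa [Ideal.ne_top_iff_one] using hx)
    obtain ⟨c, hc⟩ := Ideal.mem_span_singleton'.1 (htop ▸ Submodule.mem_top : (1 : P) ∈ _)
    refine h1 ?_
    have h2 : (y 0 * φ 1) ^ 1 = c * (y 0 ^ twoThen (n := n) 1 0) ^ 1 := by
      simp only [twoThen, Fin.cons_zero, map_one, pow_one]
      linear_combination (-y 0) * hc
    rw [h2]
    exact Ideal.mul_mem_left _ _ (Ideal.subset_span ⟨0, trivial, rfl⟩)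
  choose C _ _ f a b hfree hdef using
    exists_isFreeModulo_rootDefect (fun z => h.mul_left_injective one_ne_zero) hF hd
  let B : ℕ → Type := fun i => PerfectClosure (C i) p
  have hB : ∀ i, CharP (B i) p := fun i => inferInstance
  let g : ∀ i, P →+* B i := fun i => (PerfectClosure.of (C i) p).comp (f i)
  have hCh : CharP (ReducedProduct atTop B) p := ReducedProduct.charP p
  have hPe : PerfectRing (ReducedProduct atTop B) p := ReducedProduct.perfectRing p
  let a' : ∀ i, B i := fun i => PerfectClosure.of (C i) p (a i)
  let b' : WittVector p (∀ i, B i) :=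
    WittVector.mk p fun j i => PerfectClosure.of (C i) p ((b i).coeff j)
  have hdef' : ∀ j, rootDefect F ((ReducedProduct.mk atTop B).comp (RingHom.pi g)) (y 0)
      (ReducedProduct.mk atTop B a') (WittVector.map (ReducedProduct.mk atTop B) b') j = 0 := by
    intro j
    rw [rootDefect_map, ReducedProduct.mk_eq_zero_iff]
    filter_upwards [eventually_gt_atTop j] with i hi
    have h1 := rootDefect_map F (RingHom.pi g) (Pi.evalRingHom B i) (y 0) a' b' j
    have h2 := rootDefect_map F (f i) (PerfectClosure.of (C i) p) (y 0) (a i) (b i) j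
    rw [hdef i j hi, map_zero] at h2
    have h3 : WittVector.map (Pi.evalRingHom B i) b' =
        WittVector.map (PerfectClosure.of (C i) p) (b i) := by
      ext k; simp [b']
    rw [h3] at h1
    exact h1.symm.trans h2
  refine ⟨ReducedProduct atTop B, inferInstance, hCh, hPe,
    (ReducedProduct.mk atTop B).comp (RingHom.pi g), ReducedProduct.mk atTop B a',
    WittVector.map (ReducedProduct.mk atTop B) b', ?_, ?_⟩
  · have := ReducedProduct.isTestSeq (F := atTop) (B := B) (x := x)
      (φ := fun i => (g i).comp φ) (y := fun j i => g i (y j))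
      (fun i => IsTestSeq.perfectClosure p fun e => (h.pow p e).of_isFreeModulo (hfree i))
    exact this
  · rw [sub_mul, eq_sub_iff_add_eq]
    refine Eq.trans ?_ (mul_comm _ _)
    ext j
    exact (sub_eq_zero.1 (hdef' j)).symm

end TeichmullerRootExists

/-! ### Making an element divide a power of `t` -/

section DividePower

open Polynomial

variable {P : Type} [CommRing P] {t G : P}

theorem adjoinRoot_mul_X_sub_pow_nzd (ht : ∀ z, t * z = 0 → z = 0) (hG : ∀ z, t ∣ G * z → t ∣ z)
    {q : ℕ} (hq : q ≠ 0) (z : AdjoinRoot (C G * X - C (t ^ q)))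
    (hz : AdjoinRoot.of (C G * X - C (t ^ q)) t * z = 0) : z = 0 := by
  refine adjoinRoot_nzd ht (fun w hw => ?_) z hz
  have h1 : C t ∣ C G * (X * w) := by
    have h2 : C t ∣ C (t ^ q) := map_dvd C (dvd_pow_self t hq)
    have h3 : C G * (X * w) = (C G * X - C (t ^ q)) * w + C (t ^ q) * w := by ring
    rw [h3]
    exact dvd_add hw (h2.mul_right _)
  rw [C_dvd_iff_dvd_coeff] at h1 ⊢
  intro j
  apply hG
  simpa using h1 (j + 1)

theorem pow_dvd_of_adjoinRoot_of_dvd (ht : ∀ z, t * z = 0 → z = 0) (hG : ∀ z, t ∣ G * z → t ∣ z)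
    {q N : ℕ} {z : P}
    (hz : AdjoinRoot.of (C G * X - C (t ^ q)) (t ^ N) ∣ AdjoinRoot.of _ z) : t ^ N ∣ z := by
  obtain ⟨v, hv⟩ := hz
  obtain ⟨v, rfl⟩ := AdjoinRoot.mk_surjective v
  rw [← AdjoinRoot.mk_C, ← AdjoinRoot.mk_C, ← map_mul, AdjoinRoot.mk_eq_mk] at hv
  obtain ⟨w, hw⟩ := hv
  have hcoeff : ∀ j, t ^ N ∣ G * w.coeff j - t ^ q * w.coeff (j + 1) := by
    intro j
    have := congrArg (fun r => r.coeff (j + 1)) hw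
    simp only [coeff_sub, coeff_C_succ, coeff_C_mul, sub_mul, mul_assoc, coeff_X_mul] at this
    exact ⟨-v.coeff (j + 1), by linear_combination -this⟩
  have hw0 : ∀ i j, w.natDegree + 1 ≤ j + i → t ^ N ∣ w.coeff j := by
    intro i
    induction i with
    | zero =>
      intro j hj
      rw [coeff_eq_zero_of_natDegree_lt (by lia)]
      exact dvd_zero _
    | succ i ih =>
      intro j hj
      refine pow_dvd_of_pow_dvd_mul ht hG 1 N _ ?_
      rw [pow_one, ← sub_add_cancel (G * w.coeff j) (t ^ q * w.coeff (j + 1))]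
      exact dvd_add (hcoeff j) ((ih (j + 1) (by lia)).mul_left _)
  have h0 := congrArg (fun r => r.coeff 0) hw
  simp only [coeff_sub, coeff_C_zero, coeff_C_mul, sub_mul, mul_assoc, coeff_X_mul_zero] at h0
  rw [show z = t ^ N * v.coeff 0 - t ^ q * w.coeff 0 by linear_combination h0]
  exact dvd_sub (dvd_mul_right _ _) ((hw0 (w.natDegree + 1) 0 (by simp)).mul_left _)

theorem exists_adjoin_mul_eq_pow (ht : ∀ z, t * z = 0 → z = 0) (hG : ∀ z, t ∣ G * z → t ∣ z)
    {q : ℕ} (hq : q ≠ 0) : ∃ (Q : Type) (_ : CommRing Q) (o : P →+* Q) (r : Q),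
      o G * r = o (t ^ q) ∧ (∀ z, o t * z = 0 → z = 0) ∧
      (∀ N z, o (t ^ N) ∣ o z → t ^ N ∣ z) ∧
      ∀ z, ∃ (N : ℕ) (w : ℕ → P), z = ∑ j ∈ Finset.range N, o (w j) * r ^ j := by
  refine ⟨AdjoinRoot (C G * X - C (t ^ q)), inferInstance, AdjoinRoot.of _, AdjoinRoot.root _, ?_,
    adjoinRoot_mul_X_sub_pow_nzd ht hG hq, fun N z => pow_dvd_of_adjoinRoot_of_dvd ht hG, ?_⟩
  · have : AdjoinRoot.mk (C G * X - C (t ^ q)) (C G * X - C (t ^ q)) = 0 :=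
      AdjoinRoot.mk_self
    rwa [map_sub, map_mul, AdjoinRoot.mk_X, AdjoinRoot.mk_C, AdjoinRoot.mk_C, sub_eq_zero] at this
  · intro z
    obtain ⟨w, rfl⟩ := AdjoinRoot.mk_surjective z
    refine ⟨w.natDegree + 1, w.coeff, ?_⟩
    rw [← AdjoinRoot.aeval_eq, aeval_eq_sum_range]
    exact Finset.sum_congr rfl fun j _ => Algebra.smul_def _ _

variable (p : ℕ) [hp : Fact p.Prime] [CharP P p] [PerfectRing P p]

/-- The perfection of `P[T] / (G T - t ^ q)`, with `q = p ^ e`. -/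
theorem exists_perfect_mul_eq_pow (ht : ∀ z, t * z = 0 → z = 0) (hG : ∀ z, t ∣ G * z → t ∣ z)
    (htu : ¬ IsUnit t) (e : ℕ) :
    ∃ (P' : Type) (_ : CommRing P') (_ : CharP P' p) (_ : PerfectRing P' p) (f : P →+* P')
      (T : P') (γ : P), f G * T = f t ^ p ^ e ∧ (∀ z, f t * z = 0 → z = 0) ∧
      (∀ z, f t ∣ f z → t ∣ z) ∧ γ ^ p ^ e = G ∧ ∀ z, ∃ w, f t ∣ f γ * z - f w := by
  obtain ⟨Q, _, o, r, hroot, hQ1, hQ2, hgen⟩ :=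
    exists_adjoin_mul_eq_pow ht hG (pow_ne_zero e hp.out.ne_zero)
  have hQnt : Nontrivial Q := by
    refine ⟨0, 1, fun h01 => htu ?_⟩
    have : o (t ^ 1) ∣ o 1 := by
      rw [map_one, ← h01]; exact dvd_zero _
    simpa using isUnit_of_dvd_one (hQ2 1 1 this)
  have hQp : CharP Q p := PerfectClosure.charP_of_nontrivial p o
  let ι : Q →+* PerfectClosure Q p := PerfectClosure.of Q p
  obtain ⟨γ, hγ⟩ := (iterateFrobeniusEquiv P p e).surjective G
  rw [iterateFrobeniusEquiv_apply, iterateFrobenius_def] at hγ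
  refine ⟨PerfectClosure Q p, inferInstance, inferInstance, inferInstance, ι.comp o,
    ι r, γ, ?_, ?_, ?_, hγ, ?_⟩
  · rw [RingHom.comp_apply, ← map_mul, hroot]
    simp
  · intro z hz
    obtain ⟨e', w, hw⟩ := PerfectClosure.exists_pow_eq_of p z
    have h1 : ι (o t ^ p ^ e' * w) = ι 0 := by
      rw [map_mul, ← hw, map_pow, map_zero, ← mul_pow]
      rw [RingHom.comp_apply] at hz
      rw [hz, zero_pow (pow_ne_zero _ hp.out.ne_zero)]
    obtain ⟨e'', he''⟩ := PerfectClosure.exists_pow_eq_of_of_eq p h1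
    rw [zero_pow (pow_ne_zero _ hp.out.ne_zero), mul_pow, ← pow_mul] at he''
    have h2 : ∀ N w, o t ^ N * w = 0 → w = 0 := by
      intro N
      induction N with
      | zero => simp
      | succ N ih => exact fun w hw => ih w (hQ1 _ (by rw [← hw]; ring))
    have h3 : z ^ (p ^ e' * p ^ e'') = 0 := by
      rw [pow_mul, hw, ← map_pow]
      exact (congrArg ι (h2 _ _ he'')).trans (map_zero _)
    exact eq_zero_of_pow_eq_zero h3
  · intro z hz
    obtain ⟨e', he'⟩ := (PerfectClosure.mem_span_image_iff p (fun _ : Unit => o t) Set.univ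
      (o z)).1 (by simpa [Ideal.mem_span_singleton] using hz)
    simp only [Set.image_univ, Set.range_const, Ideal.mem_span_singleton, ← map_pow] at he'
    exact dvd_of_pow_dvd_pow p e' (hQ2 _ _ he')
  · intro z
    obtain ⟨e', hle, w, hw⟩ := PerfectClosure.exists_pow_eq_of_le p (fun _ : Unit => z) e
    replace hw := hw ()
    generalize w () = w at hw
    obtain ⟨d, rfl⟩ := Nat.exists_eq_add_of_le hle
    obtain ⟨N, w, rfl⟩ := hgen w
    have hrootP : ∀ {B : Type} [CommRing B] [CharP B p] [PerfectRing B p] (e : ℕ) (z : B),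
        ∃ z', z' ^ p ^ e = z := fun e z => (iterateFrobeniusEquiv _ p e).surjective z
    have hinj : ∀ {B : Type} [CommRing B] [CharP B p] [PerfectRing B p] (e : ℕ) {z z' : B},
        z ^ p ^ e = z' ^ p ^ e → z = z' := fun e _ _ h => (iterateFrobeniusEquiv _ p e).injective h
    obtain ⟨σ, hσ⟩ := hrootP (e + d) (ι r)
    choose v hv using fun j => hrootP (e + d) (w j)
    obtain ⟨γ', hγ'⟩ := hrootP d γ
    obtain ⟨s, hs⟩ := hrootP d t
    let f : P →+* PerfectClosure Q p := ι.comp o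
    have hγσ : f γ' * σ = f s := by
      apply hinj (e + d)
      rw [mul_pow, hσ, ← map_pow, ← map_pow, add_comm e d, pow_add, pow_mul, hγ', hγ, pow_mul, hs]
      rw [RingHom.comp_apply, ← map_mul, hroot]
      rfl
    have hz : z = ∑ j ∈ Finset.range N, f (v j) * σ ^ j := by
      apply hinj (e + d)
      rw [hw, sum_pow_char_pow, map_sum]
      refine Finset.sum_congr rfl fun j _ => ?_
      rw [mul_pow, ← pow_mul, mul_comm j, pow_mul, hσ, ← map_pow, hv, map_mul, map_pow]
      rfl
    have hj : ∀ j, ∃ w, f t ∣ f γ * σ ^ j - f w := by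
      intro j
      rcases le_or_gt (p ^ d) j with h | h
      · obtain ⟨i, rfl⟩ := Nat.exists_eq_add_of_le h
        refine ⟨0, σ ^ i, ?_⟩
        rw [map_zero, sub_zero, pow_add, ← mul_assoc, ← hγ', map_pow, ← mul_pow, hγσ, ← map_pow, hs]
      · obtain ⟨i, hi⟩ := Nat.exists_eq_add_of_le h.le
        refine ⟨γ' ^ i * s ^ j, 0, ?_⟩
        rw [← hγ', hi, map_mul, map_pow, map_pow, map_pow, ← hγσ]
        ring
    choose c hc using hj
    refine ⟨∑ j ∈ Finset.range N, v j * c j, ?_⟩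
    change f t ∣ f γ * z - f _
    rw [hz, map_sum, Finset.mul_sum, ← Finset.sum_sub_distrib]
    refine Finset.dvd_sum fun j _ => ?_
    rw [map_mul, mul_left_comm, ← mul_sub]
    exact (hc j).mul_left _

end DividePower

section AlmostRegular

variable {P P' : Type} [CommRing P'] [CommRing P]

/-- Ideals containing `t` contract well along an extension `f : P → P'` with `P / t ⊆ P' / t` and
`γ P' ⊆ P + t P'`. -/
theorem mem_span_image_of_almost_lift {J : Type} [Fintype J] {f : P →+* P'} {y : J → P} {j₀ : J}
    {γ : P} (hf : ∀ z, f (y j₀) ∣ f z → y j₀ ∣ z)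
    (hγ : ∀ z, ∃ w, f (y j₀) ∣ f γ * z - f w) {s : Set J} (hs : j₀ ∈ s) {z : P'}
    (hz : z ∈ Ideal.span ((fun j => f (y j)) '' s)) {w : P} (hw : f (y j₀) ∣ f γ * z - f w) :
    w ∈ Ideal.span (y '' s) := by
  classical
  obtain ⟨c, hc, rfl⟩ := (mem_span_image_iff_exists_sum _ _ _).1 hz
  choose l hl using hγ
  let v : J → P := fun j => if j ∈ s then l (c j) else 0
  have h1 : f (y j₀) ∣ f (w - ∑ j, v j * y j) := by
    have h2 : f (y j₀) ∣ f γ * ∑ j, c j * f (y j) - f (∑ j, v j * y j) := by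
      rw [map_sum, Finset.mul_sum, ← Finset.sum_sub_distrib]
      refine Finset.dvd_sum fun j _ => ?_
      by_cases hj : j ∈ s
      · have : v j = l (c j) := if_pos hj
        rw [this, map_mul, ← mul_assoc, ← sub_mul]
        exact (hl _).mul_right _
      · simp [v, hj, hc j hj]
    have h3 := dvd_sub h2 hw
    rw [map_sub]
    convert h3 using 1
    ring
  have h4 : w = (w - ∑ j, v j * y j) + ∑ j, v j * y j := by ring
  rw [h4]
  refine Ideal.add_mem _ (Ideal.mem_of_dvd _ (hf _ h1) (Ideal.subset_span ⟨j₀, hs, rfl⟩)) ?_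
  refine (mem_span_image_iff_exists_sum _ _ _).2 ⟨v, fun j hj => if_neg hj, rfl⟩

variable (p : ℕ) [hp : Fact p.Prime] [CharP P p] [PerfectRing P p]
  {D : Type} [CommRing D] {n : ℕ} {x : Fin n → D} {φ : D →+* P} {y : Fin (n + 1) → P}

theorem IsTestSeq.exists_almost_regular (h : IsTestSeq 1 x φ y)
    {G : P} {g : D} (hGg : y 0 ∣ G - φ g) (hg : g ≠ 0)
    (hsep : ∃ M₀, ∀ M ≥ M₀, g ∉ Ideal.span (Set.range fun i => x i ^ M)) (K : ℕ) :
    ∃ (P' : Type) (_ : CommRing P') (_ : CharP P' p) (_ : PerfectRing P' p) (f : P →+* P')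
      (T γ δ : P') (e : ℕ), f G * T = f (y 0) ^ p ^ e ∧ δ ^ p ^ e = f (y 0) ∧
      (∀ z, f (y 0) * z = 0 → z = 0) ∧
      (∀ (i : Fin n) (z : P'), f (y i.succ) * z ∈
          Ideal.span ((fun j => f (y j)) '' {j | j < i.succ}) →
        γ * z ∈ Ideal.span ((fun j => f (y j)) '' {j | j < i.succ})) ∧
      (δ * γ) ^ (K + 1) ∉ Ideal.span ((fun j => f (y j)) '' Set.univ) := by
  obtain ⟨M₀, hM₀⟩ := hsep
  have ht : ∀ z, y 0 * z = 0 → z = 0 := fun z => h.mul_left_injective one_ne_zero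
  have hG : ∀ z, y 0 ∣ G * z → y 0 ∣ z := by
    intro z hz
    refine h.reg g hg z ?_
    rw [show φ g * z = G * z - (G - φ g) * z by ring]
    exact dvd_sub hz (hGg.mul_right _)
  have htu : ¬ IsUnit (y 0) := by
    intro hu
    refine h.ntriv g M₀ (hM₀ _ le_rfl) ?_
    have h0 : (y 0 ^ twoThen M₀ (0 : Fin (n + 1))) ^ 1 ∈
        Ideal.span ((fun j => (y j ^ twoThen M₀ j) ^ 1) '' Set.univ) :=
      Ideal.subset_span ⟨0, trivial, rfl⟩
    rw [Ideal.eq_top_of_isUnit_mem _ h0 ((hu.pow _).pow _)]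
    trivial
  set s := M₀ + 1 with hs
  have hsM : M₀ ≤ p ^ s := (Nat.le_succ _).trans (Nat.lt_pow_self hp.out.one_lt).le
  have hs2 : 2 ≤ p ^ s := hp.out.two_le.trans (Nat.le_self_pow (by lia) _)
  set e := s + (K + 2) with he
  obtain ⟨P', _, _, _, f, T, γ, h1, h2, h3, h4, h5⟩ := exists_perfect_mul_eq_pow p ht hG htu e
  obtain ⟨δ, hδ⟩ := (iterateFrobeniusEquiv P p e).surjective (y 0)
  rw [iterateFrobeniusEquiv_apply, iterateFrobenius_def] at hδ
  refine ⟨P', _, ‹_›, ‹_›, f, T, f γ, f δ, e, h1, by rw [← map_pow, hδ], h2, ?_, ?_⟩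
  · intro i z hz
    obtain ⟨w, hw⟩ := h5 z
    have h6 := mem_span_image_of_almost_lift h3 h5 (Fin.succ_pos i) hz (w := y i.succ * w) (by
      rw [map_mul, mul_left_comm, ← mul_sub]
      exact hw.mul_left _)
    have h7 := h.colon i.succ w (by simpa using h6)
    rw [show f γ * z = (f γ * z - f w) + f w by ring]
    refine Ideal.add_mem _ (Ideal.mem_of_dvd _ hw (Ideal.subset_span ⟨0, Fin.succ_pos i, rfl⟩)) ?_
    exact map_mem_span_image f (by simpa using h7)
  · intro hmem
    rw [← map_mul, ← map_pow] at hmem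
    have h6 := mem_span_image_of_almost_lift h3 h5 (Set.mem_univ _) hmem
      (w := γ * (δ * γ) ^ (K + 1)) (by rw [map_mul, sub_self]; exact dvd_zero _)
    have h7 : (δ * γ) ^ (K + 2) ∈ Ideal.span (y '' Set.univ) := by
      rw [show (δ * γ) ^ (K + 2) = δ * (γ * (δ * γ) ^ (K + 1)) by ring]
      exact Ideal.mul_mem_left _ _ h6
    have h8 : (δ * γ) ^ p ^ (K + 2) ∈ Ideal.span (y '' Set.univ) :=
      Ideal.pow_mem_of_pow_mem _ h7 (Nat.lt_pow_self hp.out.one_lt).le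
    have h9 := pow_mem_span_pow p s h8
    rw [← pow_mul, ← pow_add, show K + 2 + s = e by lia, mul_pow, hδ, h4] at h9
    refine h.ntriv g (p ^ s) (hM₀ _ hsM) ?_
    obtain ⟨v, hv⟩ := hGg
    rw [pow_one, show y 0 * φ g = y 0 * G - v * y 0 ^ 2 by linear_combination (- y 0) * hv]
    refine Ideal.sub_mem _ ?_ (Ideal.mul_mem_left _ _
      (Ideal.subset_span ⟨0, trivial, by simp [twoThen]⟩))
    refine Ideal.span_le.2 ?_ h9
    rintro _ ⟨j, -, rfl⟩
    rcases Fin.eq_zero_or_eq_succ j with rfl | ⟨j, rfl⟩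
    · refine Ideal.mem_of_dvd _ (pow_dvd_pow (y 0) hs2) (Ideal.subset_span ⟨0, trivial, ?_⟩)
      simp [twoThen]
    · refine Ideal.subset_span ⟨j.succ, trivial, ?_⟩
      simp [twoThen]

end AlmostRegular

section AlmostIntegers

variable {S : Type} [CommRing S] {p : ℕ} {ϖ : S} {τ : ℕ → S}
  {T : Type} [CommRing T] [Algebra S T]

theorem pow_dvd_of_pow_dvd_pow_of_root (hϖ : ∀ z, ϖ * z = 0 → z = 0) {ρ : S} (hρ : ρ ^ p = ϖ)
    (hroot : ∀ z : S, ϖ ∣ z ^ p → ρ ∣ z) (m : ℕ) : ∀ z : S, ϖ ^ m ∣ z ^ p → ρ ^ m ∣ z := by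
  induction m with
  | zero => intro z _; simp
  | succ m ih =>
    intro z hz
    obtain ⟨w, rfl⟩ := hroot z ((dvd_pow_self ϖ m.succ_ne_zero).trans hz)
    obtain ⟨v, hv⟩ := hz
    rw [pow_succ']
    refine mul_dvd_mul_left _ (ih w ⟨v, ?_⟩)
    refine sub_eq_zero.1 (hϖ _ ?_)
    rw [mul_pow, hρ] at hv
    rw [mul_sub, hv]
    ring

theorem mem_range_of_pow_mem_range [IsLocalization.Away ϖ T] (hϖ : ∀ z, ϖ * z = 0 → z = 0) {ρ : S}
    (hρ : ρ ^ p = ϖ) (hroot : ∀ z : S, ϖ ∣ z ^ p → ρ ∣ z)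
    (hinj : Function.Injective (algebraMap S T)) {y : T} (hy : y ^ p ∈ (algebraMap S T).range) :
    y ∈ (algebraMap S T).range := by
  obtain ⟨s, hs⟩ := hy
  obtain ⟨l, z, hz⟩ := IsLocalization.Away.surj ϖ y
  have h1 : z ^ p = ϖ ^ (p * l) * s := by
    apply hinj
    rw [map_pow, ← hz, map_mul, hs, mul_pow, map_pow]
    ring
  obtain ⟨w, hw⟩ := pow_dvd_of_pow_dvd_pow_of_root hϖ hρ hroot (p * l) z ⟨s, h1⟩
  rw [pow_mul, hρ] at hw
  refine ⟨w, ?_⟩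
  have hu : IsUnit (algebraMap S T ϖ ^ l) := (IsLocalization.Away.algebraMap_isUnit ϖ).pow l
  rw [hw, map_mul, map_pow, mul_comm] at hz
  exact (hu.mul_left_cancel hz).symm

theorem pow_root_pow (hτ0 : τ 0 = ϖ) (hτ : ∀ e, τ (e + 1) ^ p = τ e) (e : ℕ) :
    τ e ^ p ^ e = ϖ := by
  induction e with
  | zero => simpa using hτ0
  | succ e ih => rw [pow_succ', pow_mul, hτ, ih]

/-- The elements of `T` which are almost in `S`. -/
def almostIntegers (hp : 2 ≤ p) (hτ : ∀ e, τ (e + 1) ^ p = τ e) (T : Type) [CommRing T]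
    [Algebra S T] : Subring T where
  carrier := {y | ∀ e, algebraMap S T (τ e) * y ∈ (algebraMap S T).range}
  mul_mem' {a b} ha hb e := by
    have h : algebraMap S T (τ e) * (a * b) = algebraMap S T (τ (e + 1) ^ (p - 2)) *
        ((algebraMap S T (τ (e + 1)) * a) * (algebraMap S T (τ (e + 1)) * b)) := by
      rw [← hτ e, ← Nat.sub_add_cancel hp, pow_add, map_mul]
      simp only [map_pow]
      rw [Nat.sub_add_cancel hp]
      ring
    rw [h]
    exact mul_mem ⟨_, rfl⟩ (mul_mem (ha _) (hb _))
  one_mem' e := by rw [mul_one]; exact ⟨_, rfl⟩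
  add_mem' ha hb e := by rw [mul_add]; exact add_mem (ha e) (hb e)
  zero_mem' e := by rw [mul_zero]; exact zero_mem _
  neg_mem' ha e := by rw [mul_neg]; exact neg_mem (ha e)

variable (hp : 2 ≤ p) (hτ : ∀ e, τ (e + 1) ^ p = τ e)

theorem algebraMap_mem_almostIntegers (s : S) : algebraMap S T s ∈ almostIntegers hp hτ T :=
  fun _ => mul_mem ⟨_, rfl⟩ ⟨_, rfl⟩

theorem mem_almostIntegers_of_isIntegral [IsLocalization.Away ϖ T] (hτ0 : τ 0 = ϖ)
    (hϖ : ∀ z, ϖ * z = 0 → z = 0) (hroot : ∀ z : S, ϖ ∣ z ^ p → τ 1 ∣ z)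
    (hinj : Function.Injective (algebraMap S T)) {y : T} (hy : IsIntegral S y) :
    y ∈ almostIntegers hp hτ T := by
  classical
  obtain ⟨s, hs⟩ := hy.fg_adjoin_singleton
  obtain ⟨⟨_, l, rfl⟩, hb⟩ := IsLocalization.exist_integer_multiples_of_finset
    (Submonoid.powers ϖ) s
  have key : ∀ z ∈ Subalgebra.toSubmodule (Algebra.adjoin S {y}),
      algebraMap S T (ϖ ^ l) * z ∈ (algebraMap S T).range := by
    rw [← hs]
    intro z hz
    induction hz using Submodule.span_induction with
    | mem z hz =>
      have := hb z hz
      simpa [IsLocalization.IsInteger, Algebra.smul_def] using this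
    | zero => rw [mul_zero]; exact zero_mem _
    | add a b _ _ ha hb => rw [mul_add]; exact add_mem ha hb
    | smul c a _ ha =>
      rw [Algebra.smul_def, mul_left_comm]
      exact mul_mem ⟨_, rfl⟩ ha
  have hroots : ∀ m (w : T), w ^ p ^ m ∈ (algebraMap S T).range → w ∈ (algebraMap S T).range := by
    intro m
    induction m with
    | zero => intro w hw; simpa using hw
    | succ m ih =>
      intro w hw
      refine mem_range_of_pow_mem_range hϖ ((hτ 0).trans hτ0) hroot hinj (ih _ ?_)
      rwa [← pow_mul, ← pow_succ']
  intro e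
  refine hroots (e + l) _ ?_
  have h1 : τ e ^ p ^ (e + l) = ϖ ^ (p ^ l - l) * ϖ ^ l := by
    rw [pow_add, pow_mul, pow_root_pow hτ0 hτ, ← pow_add,
      Nat.sub_add_cancel (Nat.lt_pow_self (by lia)).le]
  rw [mul_pow, ← map_pow, h1, map_mul, mul_assoc]
  refine mul_mem ⟨_, rfl⟩ (key _ ?_)
  exact pow_mem (Algebra.self_mem_adjoin_singleton S y) _

theorem mul_mem_span_of_mem_span_almostIntegers (hinj : Function.Injective (algebraMap S T))
    {J : Type} [Fintype J] (y : J → S) (s : Set J) {ι : S →+* almostIntegers hp hτ T}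
    (hι : ∀ a, (ι a : T) = algebraMap S T a) {b : almostIntegers hp hτ T} {a : S} {e : ℕ}
    (ha : algebraMap S T a = algebraMap S T (τ e) * b)
    (hb : b ∈ Ideal.span ((fun j => ι (y j)) '' s)) : a ∈ Ideal.span (y '' s) := by
  obtain ⟨c, hc, rfl⟩ := (mem_span_image_iff_exists_sum _ _ _).1 hb
  choose v hv using fun j => (c j).2 e
  refine (mem_span_image_iff_exists_sum _ _ _).2 ⟨v, fun j hj => hinj ?_, hinj ?_⟩
  · rw [hv, hc j hj]; simp
  · rw [ha, map_sum, AddSubmonoidClass.coe_finsetSum, Finset.mul_sum]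
    refine Finset.sum_congr rfl fun j _ => ?_
    rw [map_mul, hv, Subring.coe_mul, hι, mul_assoc]

theorem almostIntegers_almost_regular [IsLocalization.Away ϖ T]
    (hinj : Function.Injective (algebraMap S T))
    {n : ℕ} (y : Fin (n + 1) → S) (hy0 : y 0 = ϖ) {ι : S →+* almostIntegers hp hτ T}
    (hι : ∀ a, (ι a : T) = algebraMap S T a) (γ : S) (e K : ℕ)
    (hcolon : ∀ (i : Fin n) z, y i.succ * z ∈ Ideal.span (y '' {j | j < i.succ}) →
      γ * z ∈ Ideal.span (y '' {j | j < i.succ}))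
    (hnt : (τ e * γ) ^ (K + 1) ∉ Ideal.span (y '' Set.univ)) :
    (∀ (i : Fin (n + 1)) z, ι (y i) * z ∈ Ideal.span ((fun j => ι (y j)) '' {j | j < i}) →
      ι (τ e * γ) * z ∈ Ideal.span ((fun j => ι (y j)) '' {j | j < i})) ∧
    ι (τ e * γ) ^ K ∉ Ideal.span ((fun j => ι (y j)) '' Set.univ) := by
  constructor
  · intro i z hz
    rcases Fin.eq_zero_or_eq_succ i with rfl | ⟨i, rfl⟩
    · have : z = 0 := by
        simp only [Fin.not_lt_zero, Set.ofPred_false, Set.image_empty, Ideal.span_empty,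
          Ideal.mem_bot] at hz
        have h1 := congr_arg Subtype.val hz
        push_cast at h1
        rw [hι, hy0] at h1
        exact Subtype.ext ((IsLocalization.Away.algebraMap_isUnit ϖ).mul_right_eq_zero.1 h1)
      rw [this, mul_zero]
      exact zero_mem _
    · obtain ⟨v, hv⟩ := z.2 e
      have h1 := mul_mem_span_of_mem_span_almostIntegers hp hτ hinj y _ hι (a := y i.succ * v)
        (e := e) (by rw [map_mul, hv]; push_cast; rw [hι]; ring) hz
      have h2 := map_mem_span_image ι (hcolon i v h1)
      have h3 : ι (τ e * γ) * z = ι (γ * v) := by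
        apply Subtype.ext
        push_cast
        rw [hι, hι, map_mul, map_mul, hv]
        ring
      rw [h3]
      exact h2
  · intro hz
    refine hnt (Ideal.mem_of_dvd _ ?_ (mul_mem_span_of_mem_span_almostIntegers hp hτ hinj y _ hι
      (a := τ e * (τ e * γ) ^ K) (e := e) (by rw [Subring.coe_pow, hι, map_mul, map_pow]) hz))
    exact ⟨γ, by ring⟩

end AlmostIntegers

section Untilt

open WittVector

variable {p : ℕ} [hp : Fact p.Prime] {P S : Type} [CommRing P] [CommRing S] {t : P}
  {q : WittVector p P →+* S}

theorem untilt_map_teichmuller (hq : ∀ w, q w = 0 ↔ (p : WittVector p P) - teichmuller p t ∣ w) :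
    q (teichmuller p t) = p := by
  have := (hq _).2 dvd_rfl
  rw [map_sub, map_natCast, sub_eq_zero] at this
  exact this.symm

variable [CharP P p]

theorem coeff_zero_sub_mul (v : WittVector p P) :
    (((p : WittVector p P) - teichmuller p t) * v).coeff 0 = - (t * v.coeff 0) := by
  rw [← WittVector.constantCoeff_apply, map_mul, map_sub, map_natCast, CharP.cast_eq_zero]
  simp [WittVector.constantCoeff_apply]

variable [PerfectRing P p]

theorem WittVector.natCast_dvd_of_coeff_zero {w : WittVector p P} (h : w.coeff 0 = 0) :
    (p : WittVector p P) ∣ w := by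
  have := (WittVector.mem_span_p_pow_iff_le_coeff_eq_zero w 1).2 (by
    intro m hm
    obtain rfl : m = 0 := by lia
    exact h)
  rwa [pow_one, Ideal.mem_span_singleton] at this

theorem WittVector.eq_zero_of_natCast_mul_eq_zero {w : WittVector p P}
    (h : (p : WittVector p P) * w = 0) : w = 0 := by
  ext i
  have := WittVector.mul_charP_coeff_succ w i
  rw [mul_comm, h, WittVector.zero_coeff] at this
  rw [WittVector.zero_coeff]
  exact (bijective_frobenius P p).1 ((frobenius_def p _).trans (this.symm.trans (map_zero _).symm))

theorem untilt_natCast_regular (ht : ∀ z, t * z = 0 → z = 0) (hqs : Function.Surjective q)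
    (hq : ∀ w, q w = 0 ↔ (p : WittVector p P) - teichmuller p t ∣ w) (z : S)
    (hz : (p : S) * z = 0) : z = 0 := by
  obtain ⟨w, rfl⟩ := hqs z
  rw [← map_natCast q, ← map_mul, hq] at hz
  obtain ⟨v, hv⟩ := hz
  have h0 := coeff_zero_sub_mul (t := t) v
  rw [← hv, mul_comm, WittVector.mul_charP_coeff_zero] at h0
  obtain ⟨v', rfl⟩ := WittVector.natCast_dvd_of_coeff_zero (ht _ (neg_eq_zero.1 h0.symm))
  rw [hq]
  refine ⟨v', sub_eq_zero.1 (WittVector.eq_zero_of_natCast_mul_eq_zero ?_)⟩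
  rw [mul_sub, hv]
  ring

theorem untilt_mem_span_iff (hqs : Function.Surjective q)
    (hq : ∀ w, q w = 0 ↔ (p : WittVector p P) - teichmuller p t ∣ w) {J : Type} [Fintype J]
    (y : J → P) {s : Set J} {j₀ : J} (hj : j₀ ∈ s) (hy : y j₀ = t) (w : WittVector p P) :
    q w ∈ Ideal.span ((fun j => q (teichmuller p (y j))) '' s) ↔
      w.coeff 0 ∈ Ideal.span (y '' s) := by
  have hker : ∀ w : WittVector p P, w.coeff 0 = 0 → q w ∈
      Ideal.span ((fun j => q (teichmuller p (y j))) '' s) := by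
    intro w hw
    obtain ⟨w', rfl⟩ := WittVector.natCast_dvd_of_coeff_zero hw
    rw [map_mul, map_natCast, ← untilt_map_teichmuller hq, ← hy]
    exact Ideal.mul_mem_right _ _ (Ideal.subset_span ⟨j₀, hj, rfl⟩)
  constructor
  · intro h
    obtain ⟨c, hc, hw⟩ := (mem_span_image_iff_exists_sum _ _ _).1 h
    choose v hv using fun j => show ∃ v, q v = c j ∧ (j ∉ s → v = 0) by
      by_cases hjs : j ∈ s
      · obtain ⟨v, hv⟩ := hqs (c j)
        exact ⟨v, hv, fun h => absurd hjs h⟩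
      · exact ⟨0, by rw [hc j hjs, map_zero], fun _ => rfl⟩
    have h1 : q (w - ∑ j, v j * teichmuller p (y j)) = 0 := by
      rw [map_sub, hw, map_sum, sub_eq_zero]
      simp [hv]
    obtain ⟨u, hu⟩ := (hq _).1 h1
    have h2 := congr_arg WittVector.constantCoeff hu
    rw [WittVector.constantCoeff_apply (_ * _), coeff_zero_sub_mul, map_sub, sub_eq_iff_eq_add] at h2
    rw [← WittVector.constantCoeff_apply, h2]
    refine Ideal.add_mem _ (Ideal.neg_mem_iff _ |>.2 (Ideal.mul_mem_right _ _
      (Ideal.subset_span ⟨j₀, hj, hy⟩))) ?_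
    refine (mem_span_image_iff_exists_sum _ _ _).2 ⟨fun j => (v j).coeff 0, fun j hjs => ?_, ?_⟩
    · simp [(hv j).2 hjs]
    · rw [map_sum]
      simp [WittVector.constantCoeff_apply, WittVector.mul_coeff_zero]
  · intro h
    obtain ⟨c, hc, hw⟩ := (mem_span_image_iff_exists_sum _ _ _).1 h
    have h1 := hker (w - ∑ j, teichmuller p (c j) * teichmuller p (y j)) (by
      rw [← WittVector.constantCoeff_apply, map_sub, map_sum]
      simp [WittVector.constantCoeff_apply, WittVector.mul_coeff_zero, hw])
    have h2 : w = (w - ∑ j, teichmuller p (c j) * teichmuller p (y j)) +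
      ∑ j, teichmuller p (c j) * teichmuller p (y j) := by ring
    rw [h2, map_add]
    refine Ideal.add_mem _ h1 ((mem_span_image_iff_exists_sum _ _ _).2
      ⟨fun j => q (teichmuller p (c j)), fun j hjs => ?_, ?_⟩)
    · simp [hc j hjs]
    · simp

theorem untilt_root_dvd (hqs : Function.Surjective q)
    (hq : ∀ w, q w = 0 ↔ (p : WittVector p P) - teichmuller p t ∣ w) {ρ : P} (hρ : ρ ^ p = t)
    (z : S) (hz : (p : S) ∣ z ^ p) : q (teichmuller p ρ) ∣ z := by
  obtain ⟨w, rfl⟩ := hqs z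
  have h1 := (untilt_mem_span_iff hqs hq (fun _ : Unit => t) (Set.mem_univ ()) rfl (w ^ p)).1 (by
    simpa [Ideal.mem_span_singleton, untilt_map_teichmuller hq] using hz)
  have h2 : t ∣ w.coeff 0 ^ p := by
    rw [← WittVector.constantCoeff_apply, ← map_pow, WittVector.constantCoeff_apply]
    simpa [Ideal.mem_span_singleton] using h1
  rw [← hρ] at h2
  have h3 : ρ ∣ w.coeff 0 := dvd_of_pow_dvd_pow p 1 (by simpa using h2)
  obtain ⟨v, hv⟩ := h3
  obtain ⟨u, hu⟩ := WittVector.natCast_dvd_of_coeff_zero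
    (w := w - teichmuller p (ρ * v)) (by
      rw [← WittVector.constantCoeff_apply, map_sub]
      simp [WittVector.constantCoeff_apply, WittVector.mul_coeff_zero, hv])
  rw [sub_eq_iff_eq_add.1 hu, map_add, map_mul q, map_natCast, ← untilt_map_teichmuller hq, ← hρ,
    map_pow, map_pow, map_mul, map_mul]
  exact dvd_add (((dvd_pow_self _ hp.out.ne_zero)).mul_right _) (dvd_mul_right _ _)

end Untilt

section Extension

open Polynomial nonZeroDivisors

/-- A ring homomorphism from a subring extends to an overring after inverting a conductor. -/
theorem exists_ringHom_of_conductor {A₀ R' T : Type*} [CommRing A₀] [CommRing R'] [CommRing T]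
    (J : A₀ →+* R') (Φ : A₀ →+* T) (hker : ∀ a, J a = 0 → Φ a = 0) {s : A₀}
    (hs : ∀ z, ∃ a, J a = J s * z) (hu : IsUnit (Φ s)) : ∃ ψ : R' →+* T, ψ.comp J = Φ := by
  choose a ha using hs
  obtain ⟨u, hu⟩ := hu
  have hΦ : ∀ {b c : A₀}, J b = J c → Φ b = Φ c := by
    intro b c h
    rw [← sub_eq_zero, ← map_sub]
    exact hker _ (by rw [map_sub, h, sub_self])
  have hJ : ∀ b, (↑u⁻¹ : T) * Φ (a (J b)) = Φ b := by
    intro b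
    rw [Units.inv_mul_eq_iff_eq_mul, hu, ← map_mul]
    exact hΦ (by rw [ha, map_mul])
  refine ⟨{ toFun := fun z => ↑u⁻¹ * Φ (a z), map_one' := ?_, map_mul' := ?_, map_zero' := ?_,
            map_add' := ?_ }, RingHom.ext hJ⟩
  · simpa using hJ 1
  · intro z w
    have : Φ s * Φ (a (z * w)) = Φ (a z) * Φ (a w) := by
      rw [← map_mul, ← map_mul]
      exact hΦ (by simp only [map_mul, ha]; ring)
    rw [Units.inv_mul_eq_iff_eq_mul]
    have h2 : (u : T) * (↑u⁻¹ * Φ (a z) * (↑u⁻¹ * Φ (a w))) = ↑u⁻¹ * (Φ (a z) * Φ (a w)) := by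
      linear_combination (↑u⁻¹ * Φ (a z) * Φ (a w)) * u.mul_inv
    rw [h2, ← this, ← hu, ← mul_assoc, Units.inv_mul, one_mul]
  · simpa using hJ 0
  · intro z w
    rw [← mul_add, ← map_add]
    exact congr_arg _ (hΦ (by simp only [map_add, ha]; ring))

variable {A R' : Type} [CommRing A] [CommRing R'] [Algebra A R'] [IsDomain A]

theorem exists_primitive_presentation_aux [CharZero A] [Module.Finite A R'] (K L : Type) [Field K]
    [Field L] [Algebra A K] [IsFractionRing A K] [Algebra R' L] [Algebra A L]
    [IsScalarTower A R' L] [Algebra K L] [IsScalarTower A K L] [FiniteDimensional K L]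
    (hL : ∀ z : L, ∃ a : A, a ≠ 0 ∧ ∃ r : R', algebraMap R' L r = algebraMap A L a * z)
    (hinj : Function.Injective (algebraMap R' L)) :
    ∃ (r : R') (f : A[X]), f.Monic ∧ 0 < f.natDegree ∧
      (∀ Q : A[X], aeval r Q = 0 → f ∣ Q) ∧
      ∃ s : A, s ≠ 0 ∧ ∀ z : R', ∃ Q : A[X], aeval r Q = algebraMap A R' s * z := by
  classical
  have : CharZero K := IsFractionRing.charZero_of_isFractionRing A
  have hAK : Function.Injective (algebraMap A K) := IsFractionRing.injective A K
  obtain ⟨α, hα⟩ := Field.exists_primitive_element K L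
  obtain ⟨a, ha, r₀, hr₀⟩ := hL α
  obtain ⟨⟨h, hh⟩, hb⟩ := IsLocalization.exist_integer_multiples_of_finset A⁰
    ((minpoly K (algebraMap R' L r₀)).coeffs)
  have hh0 : h ≠ 0 := nonZeroDivisors.ne_zero hh
  obtain ⟨r, hrdef⟩ : ∃ r, r = algebraMap A R' h * r₀ := ⟨_, rfl⟩
  have hr : algebraMap R' L r = algebraMap K L (algebraMap A K h) * algebraMap R' L r₀ := by
    simp only [hrdef, map_mul, ← IsScalarTower.algebraMap_apply]
  have hprim : ∀ (c : A) (_ : c ≠ 0) (β : L), IntermediateField.adjoin K {β} = ⊤ →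
      IntermediateField.adjoin K {algebraMap K L (algebraMap A K c) * β} = ⊤ := by
    intro c hc β hβ
    rw [eq_top_iff, ← hβ, IntermediateField.adjoin_simple_le_iff]
    have h1 : algebraMap K L (algebraMap A K c) ≠ 0 := by
      simpa using (map_ne_zero_iff _ hAK).2 hc
    have h2 := mul_mem (IntermediateField.algebraMap_mem
      (IntermediateField.adjoin K {algebraMap K L (algebraMap A K c) * β}) (algebraMap A K c)⁻¹)
      (IntermediateField.mem_adjoin_simple_self K (algebraMap K L (algebraMap A K c) * β))
    rwa [map_inv₀, inv_mul_cancel_left₀ h1] at h2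
  have hp0 : IntermediateField.adjoin K {algebraMap R' L r₀} = ⊤ := by
    rw [hr₀, IsScalarTower.algebraMap_apply A K L]
    exact hprim a ha α hα
  have hp1 : IntermediateField.adjoin K {algebraMap R' L r} = ⊤ := by
    rw [hr]
    exact hprim h hh0 _ hp0
  have hint : ∀ β : L, IsIntegral K β := fun β => Algebra.IsIntegral.isIntegral β
  have hd0 := (Field.primitive_element_iff_minpoly_natDegree_eq K _).1 hp0
  have hd1 := (Field.primitive_element_iff_minpoly_natDegree_eq K _).1 hp1
  set m := minpoly K (algebraMap R' L r₀) with hm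
  have hmm : m.Monic := minpoly.monic (hint _)
  have hm1 : minpoly K (algebraMap R' L r) = m.scaleRoots (algebraMap A K h) := by
    refine (Polynomial.eq_of_monic_of_dvd_of_natDegree_le (minpoly.monic (hint _))
      ((monic_scaleRoots_iff _).2 hmm) ?_ ?_).symm
    · refine minpoly.dvd _ _ ?_
      rw [hr]
      exact scaleRoots_aeval_eq_zero (minpoly.aeval _ _)
    · rw [natDegree_scaleRoots, hd0, hd1]
  have hlift : m.scaleRoots (algebraMap A K h) ∈ Polynomial.lifts (algebraMap A K) := by
    rw [lifts_iff_coeff_lifts]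
    intro i
    rw [coeff_scaleRoots]
    rcases lt_trichotomy i m.natDegree with hi | hi | hi
    · by_cases hc : m.coeff i = 0
      · exact ⟨0, by simp [hc]⟩
      · obtain ⟨b, hb⟩ := hb _ (coeff_mem_coeffs hc)
        refine ⟨b * h ^ (m.natDegree - i - 1), ?_⟩
        obtain ⟨k, hk⟩ : ∃ k, m.natDegree - i = k + 1 := ⟨m.natDegree - i - 1, by lia⟩
        rw [map_mul, hb, hk, Nat.add_sub_cancel, map_pow, pow_succ]
        simp only [Algebra.smul_def]
        ring
    · rw [hi, Nat.sub_self, pow_zero, mul_one, hmm.coeff_natDegree]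
      exact ⟨1, map_one _⟩
    · rw [coeff_eq_zero_of_natDegree_lt hi, zero_mul]
      exact ⟨0, map_zero _⟩
  obtain ⟨f, hf, hfd, hfm⟩ := lifts_and_natDegree_eq_and_monic hlift
    ((monic_scaleRoots_iff _).2 hmm)
  have haev : ∀ Q : A[X], algebraMap R' L (aeval r Q) =
      aeval (algebraMap R' L r) (Q.map (algebraMap A K)) := by
    intro Q
    rw [aeval_map_algebraMap, aeval_algebraMap_apply]
  refine ⟨r, f, hfm, ?_, ?_, ?_⟩
  · rw [hfd, ← hm1]
    exact minpoly.natDegree_pos (hint _)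
  · intro Q hQ
    have h1 : f.map (algebraMap A K) ∣ Q.map (algebraMap A K) := by
      rw [hf, ← hm1]
      refine minpoly.dvd _ _ ?_
      rw [← haev, hQ, map_zero]
    exact (Polynomial.map_dvd_map _ hAK hfm).1 h1
  · have key : ∀ z : R', ∃ s : A, s ≠ 0 ∧ ∃ Q : A[X], aeval r Q = algebraMap A R' s * z := by
      intro z
      have hz : algebraMap R' L z ∈ Algebra.adjoin K {algebraMap R' L r} := by
        rw [← IntermediateField.adjoin_simple_toSubalgebra_of_isAlgebraic (hint _).isAlgebraic, hp1]
        trivial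
      rw [Algebra.adjoin_singleton_eq_range_aeval] at hz
      obtain ⟨Q, hQ⟩ := hz
      obtain ⟨b, hb, hQb⟩ := IsLocalization.integerNormalization_spec A⁰ Q
      refine ⟨b, nonZeroDivisors.ne_zero hb, IsLocalization.integerNormalization A⁰ Q, hinj ?_⟩
      have hQ' : aeval (algebraMap R' L r) Q = algebraMap R' L z := hQ
      rw [haev, hQb, ← algebraMap_smul K b Q, map_smul, hQ', map_mul (algebraMap R' L),
        ← IsScalarTower.algebraMap_apply, Algebra.smul_def, ← IsScalarTower.algebraMap_apply]
    obtain ⟨G, hG⟩ := Module.Finite.fg_top (R := A) (M := R')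
    choose s hs Q hQ using key
    refine ⟨∏ g ∈ G, s g, Finset.prod_ne_zero_iff.2 fun g _ => hs g, ?_⟩
    intro z
    have hz : z ∈ Submodule.span A (G : Set R') := by rw [hG]; trivial
    induction hz using Submodule.span_induction with
    | mem z hz =>
      refine ⟨C (∏ g ∈ G.erase z, s g) * Q z, ?_⟩
      rw [map_mul, aeval_C, hQ, ← mul_assoc, ← map_mul, Finset.prod_erase_mul _ _ hz]
    | zero => exact ⟨0, by simp⟩
    | add x y _ _ hx hy =>
      obtain ⟨Q₁, h₁⟩ := hx
      obtain ⟨Q₂, h₂⟩ := hy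
      exact ⟨Q₁ + Q₂, by rw [map_add, h₁, h₂, mul_add]⟩
    | smul c x _ hx =>
      obtain ⟨Q₁, h₁⟩ := hx
      exact ⟨C c * Q₁, by rw [map_mul, h₁, aeval_C, Algebra.smul_def]; ring⟩

theorem exists_primitive_presentation [IsDomain R'] [CharZero A] [Module.Finite A R']
    (hinj : Function.Injective (algebraMap A R')) :
    ∃ (r : R') (f : A[X]), f.Monic ∧ 0 < f.natDegree ∧
      (∀ Q : A[X], aeval r Q = 0 → f ∣ Q) ∧
      ∃ s : A, s ≠ 0 ∧ ∀ z : R', ∃ Q : A[X], aeval r Q = algebraMap A R' s * z := by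
  have : FaithfulSMul A R' := (faithfulSMul_iff_algebraMap_injective A R').2 hinj
  let _ : Algebra (FractionRing A) (FractionRing R') := FractionRing.liftAlgebra A _
  have : IsScalarTower A (FractionRing A) (FractionRing R') :=
    FractionRing.isScalarTower_liftAlgebra A _
  have hi : Function.Injective (algebraMap R' (FractionRing R')) := IsFractionRing.injective _ _
  have hL : ∀ z : FractionRing R', ∃ a : A, a ≠ 0 ∧ ∃ r : R',
      algebraMap R' (FractionRing R') r = algebraMap A (FractionRing R') a * z := by
    intro z
    obtain ⟨u, v, hv, rfl⟩ := IsFractionRing.div_surjective (A := R') z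
    have hv0 := nonZeroDivisors.ne_zero hv
    obtain ⟨a, ha, w, hw⟩ := IsAlgebraic.exists_nonzero_dvd (R := A)
      (Algebra.IsIntegral.isIntegral v).isAlgebraic hv
    refine ⟨a, ha, w * u, ?_⟩
    have h2 : algebraMap R' (FractionRing R') v ≠ 0 := by simpa using hv0
    rw [IsScalarTower.algebraMap_apply A R' (FractionRing R'), hw, map_mul, map_mul]
    field_simp
  have : IsLocalization (Algebra.algebraMapSubmonoid R' A⁰) (FractionRing R') :=
    { map_units := by
        rintro ⟨_, a, ha, rfl⟩
        refine IsUnit.mk0 _ ?_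
        simpa using nonZeroDivisors.ne_zero ha
      surj := by
        intro z
        obtain ⟨a, ha, r, hr⟩ := hL z
        refine ⟨⟨r, _, a, mem_nonZeroDivisors_of_ne_zero ha, rfl⟩, ?_⟩
        rw [hr, mul_comm, IsScalarTower.algebraMap_apply A R' (FractionRing R')]
      exists_of_eq := fun h => ⟨1, by rw [hi h]⟩ }
  have : FiniteDimensional (FractionRing A) (FractionRing R') := .of_isLocalization A R' A⁰
  exact exists_primitive_presentation_aux (FractionRing A) (FractionRing R') hL hi

end Extension

section AlmostCM

open WittVector

variable {p : ℕ} [hp : Fact p.Prime]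

theorem exists_subring_almost_regular {P : Type} [CommRing P] [CharP P p] [PerfectRing P p] {n : ℕ}
    {y : Fin (n + 1) → P} {γ δ : P} {e K : ℕ} (ht : ∀ z, y 0 * z = 0 → z = 0)
    (hδ : δ ^ p ^ e = y 0)
    (hcolon : ∀ (i : Fin n) z, y i.succ * z ∈ Ideal.span (y '' {j | j < i.succ}) →
      γ * z ∈ Ideal.span (y '' {j | j < i.succ}))
    (hnt : (δ * γ) ^ (K + 1) ∉ Ideal.span (y '' Set.univ)) :
    ∃ (T : Type) (_ : CommRing T) (Q : WittVector p P →+* T) (B : Subring T)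
      (ι : WittVector p P →+* B) (c : B), (∀ w, (ι w : T) = Q w) ∧
      Q (p - teichmuller p (y 0)) = 0 ∧ IsUnit (p : T) ∧ (∀ z, Q.IsIntegralElem z → z ∈ B) ∧
      (∀ i z, ι (teichmuller p (y i)) * z ∈
          Ideal.span ((fun j => ι (teichmuller p (y j))) '' {j | j < i}) →
        c * z ∈ Ideal.span ((fun j => ι (teichmuller p (y j))) '' {j | j < i})) ∧
      c ^ K ∉ Ideal.span ((fun j => ι (teichmuller p (y j))) '' Set.univ) := by
  obtain ⟨S, _, q, hqs, hq⟩ : ∃ (S : Type) (_ : CommRing S) (q : WittVector p P →+* S),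
      Function.Surjective q ∧ ∀ w, q w = 0 ↔ (p : WittVector p P) - teichmuller p (y 0) ∣ w :=
    ⟨WittVector p P ⧸ Ideal.span {(p : WittVector p P) - teichmuller p (y 0)}, inferInstance,
      Ideal.Quotient.mk _, Ideal.Quotient.mk_surjective, fun w => by
        rw [Ideal.Quotient.eq_zero_iff_mem, Ideal.mem_span_singleton]⟩
  have hpS := untilt_natCast_regular ht hqs hq
  let ρ : ℕ → P := fun e => (iterateFrobeniusEquiv P p e).symm (y 0)
  have hρ : ∀ e, ρ e ^ p ^ e = y 0 := by
    intro e
    have := (iterateFrobeniusEquiv P p e).apply_symm_apply (y 0)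
    rwa [iterateFrobeniusEquiv_apply, iterateFrobenius_def] at this
  have hinjF : ∀ e (a b : P), a ^ p ^ e = b ^ p ^ e → a = b := by
    intro e a b hab
    apply (iterateFrobeniusEquiv P p e).injective
    rwa [iterateFrobeniusEquiv_apply, iterateFrobeniusEquiv_apply, iterateFrobenius_def,
      iterateFrobenius_def]
  have hρδ : ρ e = δ := hinjF e _ _ ((hρ e).trans hδ.symm)
  have hρs : ∀ e, ρ (e + 1) ^ p = ρ e := by
    intro e
    refine hinjF e _ _ ?_
    rw [← pow_mul, ← pow_succ', hρ, hρ]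
  have hρ0 : ρ 0 = y 0 := by simpa using hρ 0
  let τ : ℕ → S := fun e => q (teichmuller p (ρ e))
  have hτ : ∀ e, τ (e + 1) ^ p = τ e := fun e => by
    simp only [τ, ← map_pow, hρs]
  have hτ0 : τ 0 = p := by
    simp only [τ, hρ0]
    exact untilt_map_teichmuller hq
  have hroot : ∀ z : S, (p : S) ∣ z ^ p → τ 1 ∣ z :=
    fun z => untilt_root_dvd hqs hq ((hρs 0).trans hρ0) z
  have hinj : Function.Injective (algebraMap S (Localization.Away (p : S))) := by
    refine IsLocalization.injective _ (M := Submonoid.powers (p : S)) ?_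
    refine Submonoid.powers_le.2 ?_
    refine mem_nonZeroDivisors_iff_right.2 fun z hz => hpS z ?_
    rwa [mul_comm]
  let B := almostIntegers hp.out.two_le hτ (Localization.Away (p : S))
  let ι : S →+* B := (algebraMap S (Localization.Away (p : S))).codRestrict B
    (algebraMap_mem_almostIntegers _ hτ)
  obtain ⟨h1, h2⟩ := almostIntegers_almost_regular hp.out.two_le hτ (ϖ := (p : S)) hinj
    (fun j => q (teichmuller p (y j))) (untilt_map_teichmuller hq) (ι := ι) (fun _ => rfl)
    (q (teichmuller p γ)) e K (by
      intro i z hz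
      obtain ⟨w, rfl⟩ := hqs z
      have h0 : (0 : Fin (n + 1)) ∈ {j | j < i.succ} := Fin.succ_pos i
      rw [← map_mul] at hz ⊢
      rw [untilt_mem_span_iff hqs hq y h0 rfl, WittVector.mul_coeff_zero,
        teichmuller_coeff_zero] at hz ⊢
      exact hcolon i _ hz) (by
      have h3 : (τ e * q (teichmuller p γ)) ^ (K + 1) =
          q (teichmuller p ((δ * γ) ^ (K + 1))) := by
        simp only [τ, hρδ, map_mul, map_pow]
      rw [h3, untilt_mem_span_iff hqs hq y (Set.mem_univ _) rfl, teichmuller_coeff_zero]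
      exact hnt)
  refine ⟨_, _, (algebraMap S (Localization.Away (p : S))).comp q, B, ι.comp q, _, fun _ => rfl,
    ?_, ?_, ?_, h1, h2⟩
  · rw [RingHom.comp_apply, (hq _).2 dvd_rfl, map_zero]
  · have := IsLocalization.Away.algebraMap_isUnit (S := Localization.Away (p : S)) (p : S)
    rwa [map_natCast] at this
  · rintro z ⟨F, hF, hz⟩
    refine mem_almostIntegers_of_isIntegral _ hτ hτ0 hpS hroot hinj ⟨F.map q, hF.map q, ?_⟩
    rw [Polynomial.eval₂_map, hz]

end AlmostCM

section AlmostCM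

open WittVector MvPowerSeries

variable {p : ℕ} [hp : Fact p.Prime]

theorem MvPowerSeries.exists_forall_notMem_span_X_pow {k : Type} [Field k] {n : ℕ}
    {g : MvPowerSeries (Fin n) k} (hg : g ≠ 0) :
    ∃ M₀, ∀ M ≥ M₀, g ∉ Ideal.span (Set.range fun i => (X i : MvPowerSeries (Fin n) k) ^ M) := by
  obtain ⟨ν, hν⟩ : ∃ ν, coeff ν g ≠ 0 := by
    by_contra! h
    exact hg (MvPowerSeries.ext fun ν => by rw [h, map_zero])
  refine ⟨∑ i, ν i + 1, fun M hM h => hν ?_⟩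
  have h1 := (MvPowerSeries.mem_span_X_pow_iff (fun _ => M) Finset.univ g).1
    (by simpa using h) ν
  refine h1 fun i _ => ?_
  have := Finset.single_le_sum (f := fun i => ν i) (fun _ _ => Nat.zero_le _) (Finset.mem_univ i)
  lia

theorem MvPowerSeries.span_range_X_ne_top (k : Type) [Field k] (n : ℕ) :
    Ideal.span (Set.range (X : Fin n → MvPowerSeries (Fin n) k)) ≠ ⊤ := by
  intro h
  have h1 := (MvPowerSeries.mem_span_X_pow_iff (fun _ => 1) Finset.univ
    (1 : MvPowerSeries (Fin n) k)).1 (by simp [h]) 0 (by simp)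
  simp at h1

theorem exists_almost_CM_extension {k : Type} [Field k] [CharP k p] {n : ℕ}
    {A R' : Type} [CommRing A] [IsDomain A] [CharZero A] [CommRing R'] [IsDomain R'] [Algebra A R']
    [Module.Finite A R'] (hinj : Function.Injective (algebraMap A R'))
    (θ : A →+* WittVector p (MvPowerSeries (Fin n) k))
    (hθ : ∀ a, (θ a).coeff 0 = 0 → (p : A) ∣ a)
    (hsep : ∀ a : A, (∀ l, (p : A) ^ l ∣ a) → a = 0) {x : Fin n → A}
    (hx : ∀ i, θ (x i) = teichmuller p (MvPowerSeries.X i)) (K : ℕ) :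
    ∃ (B : Type) (_ : CommRing B) (ψ : R' →+* B) (c : B),
      let y : Fin (n + 1) → B := Fin.cons (p : B) fun i => ψ (algebraMap A R' (x i))
      (∀ i z, y i * z ∈ Ideal.span (y '' {j | j < i}) →
        c * z ∈ Ideal.span (y '' {j | j < i})) ∧
      c ^ K ∉ Ideal.span (y '' Set.univ) := by
  obtain ⟨r, f, hfm, hfd, hfr, s, hs0, hs⟩ := exists_primitive_presentation hinj
  obtain ⟨l, g, rfl, hpg⟩ : ∃ l g, s = (p : A) ^ l * g ∧ ¬ (p : A) ∣ g := by
    have hfin : FiniteMultiplicity (p : A) s := by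
      by_contra h
      exact hs0 (hsep s (FiniteMultiplicity.not_iff_forall.1 h))
    obtain ⟨g, hg, hg'⟩ := hfin.exists_eq_pow_mul_and_not_dvd
    exact ⟨_, g, hg, hg'⟩
  have hg0 : (θ g).coeff 0 ≠ 0 := fun h => hpg (hθ g h)
  have hX := MvPowerSeries.span_range_X_ne_top k n
  obtain ⟨P₀, _, _, _, φ₀, y₀, h₀⟩ : ∃ (P₀ : Type) (_ : CommRing P₀) (_ : CharP P₀ p)
      (_ : PerfectRing P₀ p) (φ₀ : MvPowerSeries (Fin n) k →+* P₀) (y₀ : Fin (n + 1) → P₀),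
      IsTestSeq 1 MvPowerSeries.X φ₀ y₀ := by
    have : CharP (Polynomial (MvPowerSeries (Fin n) k)) p :=
      PerfectClosure.charP_of_nontrivial p (Polynomial.C.comp MvPowerSeries.C)
    exact ⟨_, _, inferInstance, inferInstance, _, _,
      IsTestSeq.perfectClosure p fun e => isTestSeq_baseSeq p k n e⟩
  have : Nontrivial P₀ := CharP.nontrivial_of_char_ne_one hp.out.ne_one
  obtain ⟨P₁, _, _, _, f₁, a, b₁, h₁, ha⟩ := h₀.exists_teichmuller_root hX
    (hfm.map ((WittVector.map φ₀).comp θ)) (by rwa [hfm.natDegree_map])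
  have : Nontrivial P₁ := CharP.nontrivial_of_char_ne_one hp.out.ne_one
  obtain ⟨P₂, _, _, _, f₂, G, b₂, h₂, hG⟩ := h₁.exists_teichmuller_root hX
    (Polynomial.monic_X_sub_C (WittVector.map (f₁.comp φ₀) (θ g)))
    (by rw [Polynomial.natDegree_X_sub_C]; exact one_pos)
  rw [Polynomial.eval₂_sub, Polynomial.eval₂_X, Polynomial.eval₂_C] at hG
  let φ₂ : MvPowerSeries (Fin n) k →+* P₂ := f₂.comp (f₁.comp φ₀)
  have hGg : f₂ (f₁ (y₀ 0)) ∣ G - φ₂ ((θ g).coeff 0) := by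
    have h3 := congr_arg WittVector.constantCoeff hG
    rw [map_sub, WittVector.constantCoeff_apply (_ * _), coeff_zero_sub_mul] at h3
    rw [WittVector.constantCoeff_apply, WittVector.constantCoeff_apply, teichmuller_coeff_zero,
      WittVector.map_coeff, WittVector.map_coeff] at h3
    exact ⟨- b₂.coeff 0, by rw [mul_neg]; exact h3⟩
  obtain ⟨P, _, _, _, f₃, G', γ, δ, e, h4, h5, h6, h7, h8⟩ := h₂.exists_almost_regular p hGg hg0
    (MvPowerSeries.exists_forall_notMem_span_X_pow hg0) K
  obtain ⟨T, _, Q, B, ι, c, hι, hQ, hpT, hB, hc, hcK⟩ := exists_subring_almost_regular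
    (y := fun j => f₃ (f₂ (f₁ (y₀ j)))) h6 h5 h7 h8
  let Θ : A →+* WittVector p P := (WittVector.map f₃).comp ((WittVector.map φ₂).comp θ)
  have hQt : Q (teichmuller p (f₃ (f₂ (f₁ (y₀ 0))))) = p := by
    rw [map_sub, map_natCast, sub_eq_zero] at hQ
    exact hQ.symm
  have hroot : f.eval₂ (Q.comp Θ) (Q (teichmuller p (f₃ (f₂ a)))) = 0 := by
    have h9 := congr_arg (Q.comp ((WittVector.map f₃).comp (WittVector.map f₂))) ha
    rw [Polynomial.hom_eval₂, Polynomial.eval₂_map] at h9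
    simp only [RingHom.comp_apply, map_mul, map_sub, map_natCast, map_teichmuller, hQt, sub_self,
      zero_mul] at h9
    exact h9
  have hgu : IsUnit (Q (Θ g)) := by
    have h9 := congr_arg (Q.comp (WittVector.map f₃)) hG
    simp only [RingHom.comp_apply, map_mul, map_sub, map_natCast, map_teichmuller, hQt, sub_self,
      zero_mul] at h9
    have h10 : Q (Θ g) = Q (teichmuller p (f₃ G)) := (sub_eq_zero.1 h9).symm
    rw [h10]
    refine isUnit_of_mul_isUnit_left (y := Q (teichmuller p G')) ?_
    rw [← map_mul, ← map_mul, h4, map_pow, map_pow, hQt]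
    exact hpT.pow _
  obtain ⟨ψ, hψ⟩ := exists_ringHom_of_conductor (Polynomial.aeval r : Polynomial A →ₐ[A] R').toRingHom
    (Polynomial.eval₂RingHom (Q.comp Θ) (Q (teichmuller p (f₃ (f₂ a)))))
    (fun F hF => by
      obtain ⟨F', rfl⟩ := hfr F hF
      rw [map_mul, Polynomial.coe_eval₂RingHom, hroot, zero_mul])
    (s := Polynomial.C ((p : A) ^ l * g))
    (fun z => by
      obtain ⟨F, hF⟩ := hs z
      refine ⟨F, hF.trans ?_⟩
      congr 1
      exact (Polynomial.aeval_C _ _).symm)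
    (by
      rw [Polynomial.coe_eval₂RingHom, Polynomial.eval₂_C, map_mul, map_pow, map_natCast]
      exact (hpT.pow l).mul hgu)
  have hψA : ∀ a, ψ (algebraMap A R' a) = Q (Θ a) := by
    intro a
    have h9 := RingHom.congr_fun hψ (Polynomial.C a)
    rw [Polynomial.coe_eval₂RingHom, Polynomial.eval₂_C] at h9
    refine Eq.trans (congr_arg ψ ?_) h9
    exact (Polynomial.aeval_C _ _).symm
  have hψB : ∀ z, ψ z ∈ B := by
    intro z
    obtain ⟨F, hF, hz⟩ := Algebra.IsIntegral.isIntegral (R := A) z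
    refine hB _ ⟨F.map Θ, hF.map _, ?_⟩
    have h9 : (Q.comp Θ) = ψ.comp (algebraMap A R') := RingHom.ext fun a => (hψA a).symm
    rw [Polynomial.eval₂_map, h9, ← Polynomial.hom_eval₂, hz, map_zero]
  have hy : (fun j => ι (teichmuller p (f₃ (f₂ (f₁ (y₀ j)))))) =
      (Fin.cons (p : B) fun i => ψ.codRestrict B hψB (algebraMap A R' (x i)) :
        Fin (n + 1) → B) := by
    ext j
    rw [hι]
    refine Fin.cases ?_ (fun i => ?_) j
    · simp [hQt]
    · rw [Fin.cons_succ]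
      refine Eq.trans ?_ (hψA (x i)).symm
      simp only [Θ, RingHom.comp_apply, hx, map_teichmuller, h₀.map_x, φ₂]
  rw [hy] at hcK
  refine ⟨B, inferInstance, ψ.codRestrict B hψB, c, ?_, hcK⟩
  intro i z hz
  have h9 := hc i z
  rw [hy] at h9
  have h11 := congr_fun hy i
  rw [h11] at h9
  exact h9 hz

end AlmostCM

section Limit

open Filter WittVector MvPowerSeries

/-- Inverting an element that kills all obstructions to regularity of a sequence makes the
sequence regular. -/
theorem isRegSeq_localization {U : Type} [CommRing U] {m : ℕ} (y : Fin m → U) (c : U)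
    (h1 : ∀ i z, y i * z ∈ Ideal.span (y '' {j | j < i}) → c * z ∈ Ideal.span (y '' {j | j < i}))
    (h2 : ∀ K : ℕ, c ^ K ∉ Ideal.span (Set.range y)) :
    IsRegSeq fun i => algebraMap U (Localization.Away c) (y i) := by
  have hmap : ∀ s : Set (Fin m), Ideal.span ((fun i => algebraMap U (Localization.Away c) (y i)) '' s)
      = Ideal.map (algebraMap U (Localization.Away c)) (Ideal.span (y '' s)) := by
    intro s
    rw [Ideal.map_span, Set.image_image]
  refine ⟨fun i b hb => ?_, fun h => ?_⟩
  · obtain ⟨z, s, rfl⟩ := IsLocalization.exists_mk'_eq (Submonoid.powers c) b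
    rw [hmap] at hb ⊢
    beta_reduce at hb
    rw [IsLocalization.mk'_mem_map_algebraMap_iff]
    rw [← IsLocalization.mk'_one (M := Submonoid.powers c) _ (y i), ← IsLocalization.mk'_mul,
      IsLocalization.mk'_mem_map_algebraMap_iff] at hb
    obtain ⟨_, ⟨K, rfl⟩, hK⟩ := hb
    refine ⟨c ^ (K + 1), ⟨K + 1, rfl⟩, ?_⟩
    rw [pow_succ', mul_assoc]
    exact h1 i _ (by rwa [mul_left_comm] at hK)
  · rw [← Set.image_univ, hmap, Ideal.eq_top_iff_one, ← map_one (algebraMap U _),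
      IsLocalization.algebraMap_mem_map_algebraMap_iff (Submonoid.powers c)] at h
    obtain ⟨_, ⟨K, rfl⟩, hK⟩ := h
    exact h2 K (by simpa using hK)

/-- Gluing almost Cohen-Macaulay extensions of all finitely generated subalgebras. -/
theorem exists_regular_of_almost {A T : Type} [CommRing A] [CommRing T] [Algebra A T] {m : ℕ}
    (x : Fin m → A)
    (h : ∀ (s : Finset T) (K : ℕ), ∃ (B : Type) (_ : CommRing B)
      (ψ : Algebra.adjoin A (s : Set T) →+* B) (c : B),
      (∀ i z, ψ (algebraMap A _ (x i)) * z ∈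
          Ideal.span ((fun j => ψ (algebraMap A _ (x j))) '' {j | j < i}) →
        c * z ∈ Ideal.span ((fun j => ψ (algebraMap A _ (x j))) '' {j | j < i})) ∧
      c ^ K ∉ Ideal.span (Set.range fun j => ψ (algebraMap A _ (x j)))) :
    ∃ (B : Type) (_ : CommRing B) (ψ : T →+* B),
      IsRegSeq fun i => ψ (algebraMap A T (x i)) := by
  classical
  choose B instB ψ c h1 h2 using h
  let I := Finset T × ℕ
  let BB : I → Type := fun i => B i.1 i.2
  let _ : ∀ i, CommRing (BB i) := fun i => instB i.1 i.2
  let F : Filter I := atTop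
  let Ψ0 : T → ∀ i : I, BB i := fun z i =>
    if hz : z ∈ Algebra.adjoin A (i.1 : Set T) then ψ i.1 i.2 ⟨z, hz⟩ else 0
  have hΨ0 : ∀ z (i : I) (hz : z ∈ Algebra.adjoin A (i.1 : Set T)),
      Ψ0 z i = ψ i.1 i.2 ⟨z, hz⟩ := fun z i hz => dif_pos hz
  have hev : ∀ z, ∀ᶠ i in F, z ∈ Algebra.adjoin A ((i : I).1 : Set T) := by
    intro z
    filter_upwards [eventually_ge_atTop (({z}, 0) : I)] with i hi
    exact Algebra.subset_adjoin (hi.1 (Finset.mem_singleton_self z))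
  let Ψ : T →+* ReducedProduct F BB :=
    { toFun := fun z => ReducedProduct.mk F BB (Ψ0 z)
      map_one' := by
        rw [← map_one (ReducedProduct.mk F BB), ReducedProduct.mk_eq_iff]
        refine Eventually.of_forall fun i => ?_
        rw [hΨ0 _ _ (one_mem _)]
        exact map_one _
      map_zero' := by
        rw [← map_zero (ReducedProduct.mk F BB), ReducedProduct.mk_eq_iff]
        refine Eventually.of_forall fun i => ?_
        rw [hΨ0 _ _ (zero_mem _)]
        exact map_zero _
      map_mul' := fun a b => by
        rw [← map_mul (ReducedProduct.mk F BB), ReducedProduct.mk_eq_iff]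
        filter_upwards [hev a, hev b] with i ha hb
        rw [Pi.mul_apply, hΨ0 _ _ (mul_mem ha hb), hΨ0 _ _ ha, hΨ0 _ _ hb, ← map_mul]
        rfl
      map_add' := fun a b => by
        rw [← map_add (ReducedProduct.mk F BB), ReducedProduct.mk_eq_iff]
        filter_upwards [hev a, hev b] with i ha hb
        rw [Pi.add_apply, hΨ0 _ _ (add_mem ha hb), hΨ0 _ _ ha, hΨ0 _ _ hb, ← map_add]
        rfl }
  have hΨ : ∀ a, Ψ (algebraMap A T a) =
      ReducedProduct.mk F BB fun i => ψ i.1 i.2 (algebraMap A _ a) := by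
    intro a
    refine ReducedProduct.mk_eq_iff.2 (Eventually.of_forall fun i => ?_)
    exact hΨ0 _ _ (Subalgebra.algebraMap_mem _ a)
  let cc : ReducedProduct F BB := ReducedProduct.mk F BB fun i => c i.1 i.2
  refine ⟨Localization.Away cc, inferInstance, (algebraMap _ _).comp Ψ, ?_⟩
  refine isRegSeq_localization (fun i => Ψ (algebraMap A T (x i))) cc ?_ ?_
  · intro i z hz
    obtain ⟨z, rfl⟩ := Ideal.Quotient.mk_surjective z
    simp only [hΨ] at hz ⊢
    rw [← map_mul, ReducedProduct.mk_mem_span_image_iff] at hz ⊢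
    filter_upwards [hz] with k hk
    exact h1 k.1 k.2 i _ hk
  · intro K hK
    simp only [hΨ] at hK
    rw [← Set.image_univ, ← map_pow, ReducedProduct.mk_mem_span_image_iff] at hK
    obtain ⟨k, hk, hk'⟩ := (hK.and (eventually_ge_atTop ((∅, K) : I))).exists
    rw [Set.image_univ] at hk
    refine h2 k.1 k.2 ?_
    obtain ⟨e, he⟩ := Nat.exists_eq_add_of_le hk'.2
    have he' : c k.1 k.2 ^ k.2 = c k.1 k.2 ^ e * c k.1 k.2 ^ K := by
      rw [← pow_add, add_comm e]
      exact congrArg _ he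
    rw [he']
    exact Ideal.mul_mem_left _ _ hk

theorem exists_regular_algebra {p : ℕ} [hp : Fact p.Prime] {k : Type} [Field k] [CharP k p] {n : ℕ}
    {A T : Type} [CommRing A] [IsDomain A] [CharZero A] [CommRing T] [IsDomain T] [Algebra A T]
    [Algebra.IsIntegral A T] (hinj : Function.Injective (algebraMap A T))
    (θ : A →+* WittVector p (MvPowerSeries (Fin n) k))
    (hθ : ∀ a, (θ a).coeff 0 = 0 → (p : A) ∣ a)
    (hsep : ∀ a : A, (∀ l, (p : A) ^ l ∣ a) → a = 0) {x : Fin n → A}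
    (hx : ∀ i, θ (x i) = teichmuller p (MvPowerSeries.X i)) :
    ∃ (B : Type) (_ : CommRing B) (ψ : T →+* B),
      IsRegSeq fun i => ψ (algebraMap A T ((Fin.cons (p : A) x : Fin (n + 1) → A) i)) := by
  refine exists_regular_of_almost _ fun s K => ?_
  have := Algebra.finite_adjoin_of_finite_of_isIntegral (R := A) s.finite_toSet
    fun x _ => Algebra.IsIntegral.isIntegral x
  obtain ⟨B, instB, ψ, c, h1, h2⟩ := exists_almost_CM_extension (p := p) (k := k)
    (R' := Algebra.adjoin A (s : Set T)) (fun a b h => hinj (congrArg Subtype.val h)) θ hθ hsep hx K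
  have hy : (fun j => ψ (algebraMap A _ ((Fin.cons (p : A) x : Fin (n + 1) → A) j))) =
      (Fin.cons (p : B) fun i => ψ (algebraMap A _ (x i)) : Fin (n + 1) → B) := by
    funext j
    refine Fin.cases ?_ (fun i => ?_) j
    · simp
    · simp
  refine ⟨B, instB, ψ, c, fun i => ?_, ?_⟩
  · have := h1 i
    rw [← hy] at this
    exact this
  · rw [hy, ← Set.image_univ]
    exact h2

end Limit

/-! ### Regular sequences modulo an ideal -/

section RegularMod

variable {B : Type*} [CommRing B]

/-- The list `L` is a weakly regular sequence on `B ⧸ I`. -/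
def RegularMod : Ideal B → List B → Prop
  | _, [] => True
  | I, a :: L => (∀ z, a * z ∈ I → z ∈ I) ∧ RegularMod (I ⊔ Ideal.span {a}) L

/-- The ideal generated by the elements of a list. -/
def listSpan (L : List B) : Ideal B := Ideal.span {x | x ∈ L}

theorem mem_listSpan {a : B} {L : List B} (h : a ∈ L) : a ∈ listSpan L :=
  Ideal.subset_span h

theorem listSpan_nil : listSpan ([] : List B) = ⊥ := by
  simp [listSpan]

theorem listSpan_cons (a : B) (L : List B) :
    listSpan (a :: L) = Ideal.span {a} ⊔ listSpan L := by
  rw [listSpan, listSpan, ← Ideal.span_union]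
  congr 1
  ext x
  simp

theorem listSpan_fg (L : List B) : (listSpan L).FG :=
  Submodule.fg_span (List.finite_toSet L)

theorem sup_listSpan_cons (I : Ideal B) (a : B) (L : List B) :
    I ⊔ listSpan (a :: L) = (I ⊔ Ideal.span {a}) ⊔ listSpan L := by
  rw [listSpan_cons, sup_assoc]

theorem map_listSpan {B' : Type*} [CommRing B'] (f : B →+* B') (L : List B) :
    (listSpan L).map f = listSpan (L.map f) := by
  rw [listSpan, Ideal.map_span, listSpan]
  congr 1
  ext x
  simp

theorem mem_sup_span_singleton {I : Ideal B} {a z : B} :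
    z ∈ I ⊔ Ideal.span {a} ↔ ∃ c, z - a * c ∈ I := by
  constructor
  · intro h
    obtain ⟨i, hi, w, hw, rfl⟩ := Submodule.mem_sup.1 h
    obtain ⟨c, rfl⟩ := Ideal.mem_span_singleton.1 hw
    exact ⟨c, by simpa using hi⟩
  · rintro ⟨c, hc⟩
    have := Ideal.add_mem _ (Ideal.mem_sup_left (T := Ideal.span {a}) hc)
      (Ideal.mem_sup_right (S := I) (Ideal.mem_span_singleton.2 (Dvd.intro c rfl)))
    simpa using this

namespace RegularMod

theorem top (L : List B) : RegularMod ⊤ L := by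
  induction L with
  | nil => trivial
  | cons a L ih => exact ⟨fun _ _ => trivial, by rwa [top_sup_eq]⟩

theorem append {I : Ideal B} {L L' : List B} :
    RegularMod I (L ++ L') ↔ RegularMod I L ∧ RegularMod (I ⊔ listSpan L) L' := by
  induction L generalizing I with
  | nil => simp [RegularMod, listSpan_nil]
  | cons a L ih => rw [List.cons_append, RegularMod, RegularMod, ih, sup_listSpan_cons, and_assoc]

/-- Dropping the second element of a regular sequence to the ideal. -/
theorem of_cons_cons {I : Ideal B} {a b : B} {L : List B} (h : RegularMod I (a :: b :: L)) :
    RegularMod (I ⊔ Ideal.span {b}) (a :: L) := by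
  obtain ⟨h1, h2, h3⟩ := h
  refine ⟨fun z hz => ?_, by rwa [sup_right_comm]⟩
  obtain ⟨c, hc⟩ := mem_sup_span_singleton.1 hz
  have h4 : b * c ∈ I ⊔ Ideal.span {a} :=
    mem_sup_span_singleton.2 ⟨z, by rw [← neg_mem_iff]; simpa using hc⟩
  obtain ⟨u, hu⟩ := mem_sup_span_singleton.1 (h2 c h4)
  refine mem_sup_span_singleton.2 ⟨u, h1 _ ?_⟩
  have := I.add_mem hc (I.mul_mem_left b hu)
  convert this using 1
  ring

theorem mem_of_mul_mem {I : Ideal B} {a : B} {L : List B} (h : RegularMod I (a :: L)) {z : B}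
    (hz : a * z ∈ I ⊔ listSpan L) : z ∈ I ⊔ listSpan L := by
  induction L generalizing I with
  | nil =>
    rw [listSpan_nil, sup_bot_eq] at *
    exact h.1 z hz
  | cons b L ih =>
    rw [sup_listSpan_cons] at *
    exact ih h.of_cons_cons hz

theorem mul {I : Ideal B} {x y : B} {L : List B} (hx : RegularMod I (x :: L))
    (hy : RegularMod I (y :: L)) : RegularMod I (x * y :: L) := by
  induction L generalizing I with
  | nil => exact ⟨fun z hz => hy.1 z (hx.1 _ (by rwa [← mul_assoc])), trivial⟩
  | cons b L ih =>
    refine ⟨fun z hz => hy.1 z (hx.1 _ (by rwa [← mul_assoc])), fun z hz => ?_, ?_⟩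
    · have hle : I ⊔ Ideal.span {x * y} ≤ I ⊔ Ideal.span {x} :=
        sup_le_sup_left (Ideal.span_singleton_le_span_singleton.2 (Dvd.intro y rfl)) I
      obtain ⟨w, hw⟩ := mem_sup_span_singleton.1 (hx.2.1 z (hle hz))
      obtain ⟨t, ht⟩ := mem_sup_span_singleton.1 hz
      have h1 : b * w ∈ I ⊔ Ideal.span {y} := by
        refine mem_sup_span_singleton.2 ⟨t, hx.1 _ ?_⟩
        have := I.sub_mem ht (I.mul_mem_left b hw)
        convert this using 1
        ring
      obtain ⟨v, hv⟩ := mem_sup_span_singleton.1 (hy.2.1 w h1)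
      refine mem_sup_span_singleton.2 ⟨v, ?_⟩
      have := I.add_mem hw (I.mul_mem_left x hv)
      convert this using 1
      ring
    · have := (ih hx.of_cons_cons hy.of_cons_cons).2
      rwa [sup_right_comm]

theorem pow_cons {I : Ideal B} {a : B} {L : List B} (h : RegularMod I (a :: L)) (n : ℕ) :
    RegularMod I (a ^ n :: L) := by
  induction n with
  | zero => exact ⟨fun z hz => by simpa using hz, by simpa using top L⟩
  | succ n ih => rw [pow_succ]; exact ih.mul h

theorem map_pow {I : Ideal B} {L : List B} (h : RegularMod I L) (n : ℕ) :
    RegularMod I (L.map (· ^ n)) := by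
  induction L generalizing I with
  | nil => trivial
  | cons a L ih => exact ⟨(h.pow_cons n).1, ih (h.pow_cons n).2⟩

theorem mem_of_mul_mem_pow {I : Ideal B} {a : B} {L : List B} (h : RegularMod I (a :: L)) {n : ℕ}
    {z : B} (hz : a * z ∈ I ⊔ listSpan ((a :: L).map (· ^ (n + 1)))) :
    z ∈ I ⊔ listSpan ((a :: L).map (· ^ n)) := by
  rw [List.map_cons, sup_listSpan_cons, sup_right_comm, mem_sup_span_singleton] at hz
  obtain ⟨c, hc⟩ := hz
  have h1 : RegularMod I (a :: L.map (· ^ (n + 1))) := ⟨h.1, h.2.map_pow _⟩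
  have h2 := h1.mem_of_mul_mem (z := z - a ^ n * c) (by convert hc using 1; ring)
  rw [List.map_cons, sup_listSpan_cons, sup_right_comm, mem_sup_span_singleton]
  have hle : listSpan (L.map (· ^ (n + 1))) ≤ listSpan (L.map (· ^ n)) := by
    rw [listSpan, Ideal.span_le]
    intro x hx
    obtain ⟨y, hy, rfl⟩ := List.mem_map.1 hx
    rw [pow_succ']
    exact Ideal.mul_mem_left _ _ (Ideal.subset_span (List.mem_map.2 ⟨y, hy, rfl⟩))
  exact ⟨c, sup_le_sup_left hle I h2⟩

theorem map_of_surjective {B' : Type*} [CommRing B'] {f : B →+* B'}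
    (hf : Function.Surjective f) {I : Ideal B} (hI : RingHom.ker f ≤ I) {L : List B}
    (h : RegularMod I L) : RegularMod (I.map f) (L.map f) := by
  induction L generalizing I with
  | nil => trivial
  | cons a L ih =>
    refine ⟨fun z hz => ?_, ?_⟩
    · obtain ⟨z, rfl⟩ := hf z
      have hc : Ideal.comap f (I.map f) = I := by
        rw [Ideal.comap_map_of_surjective' f hf, sup_eq_left]
        exact hI
      rw [← map_mul, ← Ideal.mem_comap, hc] at hz
      exact Ideal.mem_map_of_mem f (h.1 z hz)
    · have := ih (hI.trans le_sup_left) h.2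
      rwa [Ideal.map_sup, Ideal.map_span, Set.image_singleton] at this

theorem ofFn_iff {m : ℕ} (y : Fin m → B) (I : Ideal B) :
    RegularMod I (List.ofFn y) ↔
      ∀ i z, y i * z ∈ I ⊔ Ideal.span (y '' {j | j < i}) → z ∈ I ⊔ Ideal.span (y '' {j | j < i}) := by
  induction m generalizing I with
  | zero => simp [RegularMod]
  | succ m ih =>
    rw [List.ofFn_succ, RegularMod, ih, Fin.forall_fin_succ]
    have h0 : y '' {j | j < 0} = ∅ := by simp
    have hs : ∀ i : Fin m, I ⊔ Ideal.span {y 0} ⊔ Ideal.span ((fun i => y i.succ) '' {j | j < i}) =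
        I ⊔ Ideal.span (y '' {j | j < i.succ}) := by
      intro i
      rw [sup_assoc, ← Ideal.span_union]
      congr 2
      ext x
      simp only [Set.mem_union, Set.mem_singleton_iff, Set.mem_image, Set.mem_ofPred_eq,
        Fin.exists_fin_succ, Fin.succ_lt_succ_iff, Fin.succ_pos, true_and]
      rw [eq_comm]
    simp only [h0, hs, Ideal.span_empty, sup_bot_eq]

end RegularMod

theorem listSpan_ofFn {m : ℕ} (y : Fin m → B) : listSpan (List.ofFn y) = Ideal.span (Set.range y) := by
  rw [listSpan]
  congr 1
  ext x
  simp

theorem isRegSeq_iff {B : Type*} [CommRing B] {m : ℕ} {y : Fin m → B} :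
    IsRegSeq y ↔ RegularMod ⊥ (List.ofFn y) ∧ listSpan (List.ofFn y) ≠ ⊤ := by
  rw [RegularMod.ofFn_iff, listSpan_ofFn, IsRegSeq]
  simp only [bot_sup_eq]

end RegularMod

/-! ### Complete algebras from sequential reduced powers -/

section Completion

open Filter

theorem exists_tendsto_diagonal {P : ℕ → ℕ → Prop} (h0 : ∀ i, P 0 i)
    (h : ∀ n, ∀ᶠ i in atTop, P n i) :
    ∃ g : ℕ → ℕ, (∀ i, P (g i) i) ∧ ∀ N, ∀ᶠ i in atTop, N ≤ g i := by
  classical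
  refine ⟨fun i => Nat.findGreatest (P · i) i,
    fun i => Nat.findGreatest_spec (P := (P · i)) (Nat.zero_le i) (h0 i), fun N => ?_⟩
  filter_upwards [h N, eventually_ge_atTop N] with i h1 h2
  exact Nat.le_findGreatest h2 h1

variable (B : Type) [CommRing B]

/-- The power of a ring indexed by the natural numbers, modulo eventual equality. -/
abbrev SeqPower : Type := ReducedProduct (atTop : Filter ℕ) fun _ => B

/-- The diagonal embedding. -/
abbrev SeqPower.diag : B →+* SeqPower B :=
  (ReducedProduct.mk (atTop : Filter ℕ) fun _ => B).comp (Pi.constRingHom ℕ B)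

/-- The class of a sequence. -/
abbrev SeqPower.mk : (ℕ → B) →+* SeqPower B :=
  ReducedProduct.mk (atTop : Filter ℕ) fun _ => B

variable {B}

namespace SeqPower

theorem mk_mem_sup_map_iff {τ : Type*} [Fintype τ] (y : τ → ℕ → B) {K : Ideal B} (hK : K.FG)
    (f : ℕ → B) :
    mk B f ∈ Ideal.span (Set.range fun j => mk B (y j)) ⊔ K.map (diag B) ↔
      ∀ᶠ i in atTop, f i ∈ Ideal.span (Set.range fun j => y j i) ⊔ K := by
  obtain ⟨s, rfl⟩ := hK
  let Y : τ ⊕ s → ℕ → B := Sum.elim y fun a _ => a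
  have h1 : Ideal.span (Set.range fun j => mk B (y j)) ⊔ (Ideal.span (s : Set B)).map (diag B) =
      Ideal.span ((fun j => mk B (Y j)) '' Set.univ) := by
    rw [Ideal.map_span, ← Ideal.span_union]
    congr 1
    ext x
    simp [Y]
    rfl
  have h2 : ∀ i, Ideal.span (Set.range fun j => y j i) ⊔ Ideal.span (s : Set B) =
      Ideal.span ((fun j => Y j i) '' Set.univ) := by
    intro i
    rw [← Ideal.span_union]
    congr 1
    ext x
    simp [Y]
  have h3 := ReducedProduct.mk_mem_span_image_iff (F := atTop) (B := fun _ : ℕ => B) Y Set.univ f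
  rw [h1, h3]
  exact eventually_congr (Eventually.of_forall fun i => by rw [h2])

theorem mk_mem_map_iff {K : Ideal B} (hK : K.FG) (f : ℕ → B) :
    mk B f ∈ K.map (diag B) ↔ ∀ᶠ i in atTop, f i ∈ K := by
  have := mk_mem_sup_map_iff (τ := Fin 0) (fun _ _ => 0) hK f
  simpa using this

theorem mem_sup_iInf_pow {J : Ideal B} (hJ : J.FG) {I : Ideal (SeqPower B)} (hI : I.FG)
    {z : SeqPower B} (hz : ∀ n, z ∈ I ⊔ (J ^ n).map (diag B)) :
    z ∈ I ⊔ ⨅ n, (J ^ n).map (diag B) := by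
  obtain ⟨t, rfl⟩ := hI
  obtain ⟨f, rfl⟩ := Ideal.Quotient.mk_surjective z
  choose y hy using fun j : t => Ideal.Quotient.mk_surjective (j : SeqPower B)
  have ht : Ideal.span (t : Set (SeqPower B)) = Ideal.span (Set.range fun j => mk B (y j)) := by
    congr 1
    ext x
    simp only [mk, hy, Subtype.range_coe_subtype]
    rfl
  rw [ht] at hz ⊢
  have h1 : ∀ n, ∀ᶠ i in atTop, f i ∈ Ideal.span (Set.range fun j => y j i) ⊔ J ^ n :=
    fun n => (mk_mem_sup_map_iff y hJ.pow f).1 (hz n)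
  obtain ⟨g, hg, hg'⟩ := exists_tendsto_diagonal
    (P := fun n i => f i ∈ Ideal.span (Set.range fun j => y j i) ⊔ J ^ n) (by simp) h1
  choose a ha b hb hab using fun i => Submodule.mem_sup.1 (hg i)
  have hf : f = a + b := funext fun i => (hab i).symm
  rw [hf, map_add]
  refine Ideal.add_mem _ (Ideal.mem_sup_left ?_) (Ideal.mem_sup_right ?_)
  · have := (mk_mem_sup_map_iff y (Submodule.fg_bot (R := B) (M := B)) a).2
      (Eventually.of_forall fun i => by rw [sup_bot_eq]; exact ha i)
    rwa [Ideal.map_bot, sup_bot_eq] at this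
  · rw [Ideal.mem_iInf]
    intro n
    refine (mk_mem_map_iff hJ.pow b).2 ?_
    filter_upwards [hg' n] with i hi
    exact Ideal.pow_le_pow_right hi (hb i)

/-- Diagonal completeness of sequential powers. -/
theorem exists_forall_sub_mem {J : Ideal B} (hJ : J.FG) (f : ℕ → SeqPower B)
    (hf : ∀ n, f n - f (n + 1) ∈ (J ^ n).map (diag B)) :
    ∃ L, ∀ n, f n - L ∈ (J ^ n).map (diag B) := by
  choose g hg using fun n => Ideal.Quotient.mk_surjective (f n)
  have h1 : ∀ n, ∀ᶠ i in atTop, g n i - g (n + 1) i ∈ J ^ n := by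
    intro n
    refine (mk_mem_map_iff hJ.pow (g n - g (n + 1))).1 ?_
    rw [map_sub]
    simp only [mk, hg]
    exact hf n
  obtain ⟨ν, hν, hν'⟩ := exists_tendsto_diagonal
    (P := fun n i => ∀ m < n, g m i - g (m + 1) i ∈ J ^ m) (by simp)
    (fun n => by
      have := (Set.finite_Iio n).eventually_all (l := atTop)
        (p := fun m i => g m i - g (m + 1) i ∈ J ^ m)
      exact this.2 fun m _ => h1 m)
  refine ⟨mk B fun i => g (ν i) i, fun n => ?_⟩
  rw [← hg, ← map_sub, mk_mem_map_iff hJ.pow]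
  filter_upwards [hν' n] with i hi
  have key : ∀ e, n + e ≤ ν i → g n i - g (n + e) i ∈ J ^ n := by
    intro e
    induction e with
    | zero => simp
    | succ e ih =>
      intro he
      have h2 := Ideal.pow_le_pow_right (Nat.le_add_right n e) (hν i (n + e) (by omega))
      have := Ideal.add_mem _ (ih (by omega)) h2
      rwa [sub_add_sub_cancel] at this
  have := key (ν i - n) (by omega)
  rwa [Nat.add_sub_cancel' hi] at this

end SeqPower

end Completion

section Completion

open Filter

variable {B : Type} [CommRing B]

theorem Ideal.exists_surjective_ker_eq {U : Type} [CommRing U] (N : Ideal U) :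
    ∃ (C : Type) (_ : CommRing C) (q : U →+* C), Function.Surjective q ∧ RingHom.ker q = N :=
  ⟨_, _, Ideal.Quotient.mk N, Ideal.Quotient.mk_surjective, Ideal.mk_ker⟩

namespace SeqPower

theorem regularMod_map {I : Ideal B} (hI : I.FG) {L : List B} (h : RegularMod I L) :
    RegularMod (I.map (diag B)) (L.map (diag B)) := by
  induction L generalizing I with
  | nil => trivial
  | cons a L ih =>
    refine ⟨fun z hz => ?_, ?_⟩
    · obtain ⟨f, rfl⟩ := Ideal.Quotient.mk_surjective z
      rw [mk_mem_map_iff hI]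
      have h1 : mk B ((fun _ => a) * f) ∈ I.map (diag B) := by
        rw [map_mul]
        exact hz
      rw [mk_mem_map_iff hI] at h1
      filter_upwards [h1] with i hi
      exact h.1 _ hi
    · have := ih (Submodule.FG.sup hI (Submodule.fg_span_singleton a)) h.2
      rwa [Ideal.map_sup, Ideal.map_span, Set.image_singleton] at this

theorem regularMod_sup_iInf {J : Ideal B} (hJ : J.FG) {I : Ideal (SeqPower B)} (hI : I.FG)
    {L : List (SeqPower B)} (h : RegularMod I L) (hL : I ⊔ listSpan L = J.map (diag B)) :
    RegularMod (I ⊔ ⨅ n, (J ^ n).map (diag B)) L := by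
  induction L generalizing I with
  | nil => trivial
  | cons a L ih =>
    refine ⟨fun z hz => mem_sup_iInf_pow hJ hI fun n => ?_, ?_⟩
    · have h1 : ∃ k, (J.map (diag B)) ^ k ≤ I ⊔ listSpan ((a :: L).map (· ^ (n + 1))) := by
        refine Ideal.exists_pow_le_of_le_radical_of_fg ?_ (hJ.map _)
        rw [← hL]
        refine sup_le (le_sup_left.trans Ideal.le_radical) (Ideal.span_le.2 fun x hx => ?_)
        exact ⟨n + 1, Ideal.mem_sup_right (Ideal.subset_span (List.mem_map.2 ⟨x, hx, rfl⟩))⟩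
      obtain ⟨k, hk⟩ := h1
      have h2 : I ⊔ ⨅ n, (J ^ n).map (diag B) ≤ I ⊔ listSpan ((a :: L).map (· ^ (n + 1))) := by
        refine sup_le le_sup_left ((iInf_le _ k).trans ?_)
        rwa [Ideal.map_pow]
      have h3 := h.mem_of_mul_mem_pow (h2 hz)
      have h4 : listSpan ((a :: L).map (· ^ n)) ≤ (J ^ n).map (diag B) := by
        refine Ideal.span_le.2 fun x hx => ?_
        obtain ⟨y, hy, rfl⟩ := List.mem_map.1 hx
        rw [Ideal.map_pow, ← hL]
        exact Ideal.pow_mem_pow (Ideal.mem_sup_right (mem_listSpan hy)) n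
      exact sup_le_sup_left h4 I h3
    · have := ih (Submodule.FG.sup hI (Submodule.fg_span_singleton a)) h.2 (by rw [← hL, sup_listSpan_cons])
      rwa [sup_right_comm]

end SeqPower

open SeqPower in
/-- A regular sequence stays regular in a suitable complete algebra. -/
theorem RegularMod.exists_isAdicComplete {L : List B} (h : RegularMod ⊥ L) (hL : listSpan L ≠ ⊤) :
    ∃ (C : Type) (_ : CommRing C) (f : B →+* C), RegularMod ⊥ (L.map f) ∧
      IsAdicComplete (listSpan (L.map f)) C ∧ listSpan (L.map f) ≠ ⊤ := by
  obtain ⟨J, hJL⟩ : ∃ J, J = listSpan L := ⟨_, rfl⟩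
  have hJ : J.FG := hJL ▸ listSpan_fg L
  obtain ⟨N, hN⟩ : ∃ N : Ideal (SeqPower B), N = ⨅ n, (J ^ n).map (diag B) := ⟨_, rfl⟩
  obtain ⟨C, _, q, hq, hker⟩ : ∃ (C : Type) (_ : CommRing C) (q : SeqPower B →+* C),
      Function.Surjective q ∧ RingHom.ker q = N :=
    N.exists_surjective_ker_eq
  let f : B →+* C := q.comp (diag B)
  have hmem : ∀ n u, q u ∈ (listSpan (L.map f)) ^ n ↔ u ∈ (J ^ n).map (diag B) := by
    intro n u
    rw [← map_listSpan, ← hJL, ← Ideal.map_pow, ← Ideal.map_map, ← Ideal.mem_comap,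
      Ideal.comap_map_of_surjective' q hq, hker, sup_eq_left.2]
    exact hN ▸ iInf_le _ n
  refine ⟨C, inferInstance, f, ?_, ?_, ?_⟩
  · have h1 := regularMod_map Submodule.fg_bot h
    rw [Ideal.map_bot] at h1
    have h2 := regularMod_sup_iInf hJ Submodule.fg_bot h1
      (by rw [bot_sup_eq, ← map_listSpan, hJL])
    rw [← hN, bot_sup_eq] at h2
    have h3 := h2.map_of_surjective hq hker.le
    rwa [(Ideal.map_eq_bot_iff_le_ker q).2 hker.ge, List.map_map] at h3
  · have hH : IsHausdorff (listSpan (L.map f)) (C) := by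
      refine ⟨fun z hz => ?_⟩
      obtain ⟨u, rfl⟩ := hq z
      refine (RingHom.mem_ker (f := q)).1 ?_
      rw [hker, hN, Ideal.mem_iInf]
      intro n
      have := hz n
      rwa [SModEq.zero, smul_eq_mul, Ideal.mul_top, hmem] at this
    have hP : IsPrecomplete (listSpan (L.map f)) (C) := by
      refine ⟨fun z hz => ?_⟩
      choose u hu using fun n => hq (z n)
      obtain ⟨l, hl⟩ := exists_forall_sub_mem hJ u fun n => by
        have := hz (Nat.le_succ n)
        rw [SModEq.sub_mem, smul_eq_mul, Ideal.mul_top, ← hu, ← hu, ← map_sub, hmem] at this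
        exact this
      refine ⟨q l, fun n => ?_⟩
      rw [SModEq.sub_mem, smul_eq_mul, Ideal.mul_top, ← hu, ← map_sub, hmem]
      exact hl n
    exact { hH, hP with }
  · rw [Ne, Ideal.eq_top_iff_one, ← pow_one (listSpan (L.map f)), ← map_one q, hmem,
      ← map_one (mk B), mk_mem_map_iff hJ.pow, pow_one, hJL]
    intro h1
    obtain ⟨i, hi⟩ := h1.exists
    exact hL ((Ideal.eq_top_iff_one _).2 hi)

end Completion

/-! ### Independence of the system of parameters over complete algebras -/

section CompleteExchange

variable {C : Type*} [CommRing C]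

theorem IsAdicComplete.of_le_of_pow_le {J K : Ideal C} [hJ : IsAdicComplete J C] (h : J ≤ K) {k : ℕ}
    (hk : K ^ k ≤ J) : IsAdicComplete K C := by
  have hkn : ∀ n, K ^ (k * n) ≤ J ^ n := fun n => by
    rw [pow_mul]
    exact Ideal.pow_right_mono hk n
  have hH : IsHausdorff K C := by
    refine ⟨fun z hz => hJ.toIsHausdorff.haus z fun n => ?_⟩
    have := hz (k * n)
    rw [SModEq.zero, smul_eq_mul, Ideal.mul_top] at this ⊢
    exact hkn n this
  have hP : IsPrecomplete K C := by
    refine ⟨fun z hz => ?_⟩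
    have hz' : ∀ {m n}, m ≤ n → z m - z n ∈ K ^ m := fun hmn => by
      have := hz hmn
      rwa [SModEq.sub_mem, smul_eq_mul, Ideal.mul_top] at this
    obtain ⟨L, hL⟩ := hJ.toIsPrecomplete.prec (f := fun n => z (k * n)) fun {m n} hmn => by
      rw [SModEq.sub_mem, smul_eq_mul, Ideal.mul_top]
      exact hkn m (hz' (Nat.mul_le_mul_left k hmn))
    refine ⟨L, fun n => ?_⟩
    have h1 := hL n
    rw [SModEq.sub_mem, smul_eq_mul, Ideal.mul_top] at h1 ⊢
    rcases Nat.eq_zero_or_pos k with rfl | hkpos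
    · have : K = ⊤ := top_le_iff.1 ((by simpa using hk : ⊤ ≤ J).trans h)
      simp [this, Ideal.top_pow]
    · have h2 := Ideal.add_mem _ (hz' (Nat.le_mul_of_pos_left n hkpos)) (Ideal.pow_right_mono h n h1)
      rwa [sub_add_sub_cancel] at h2
  exact { hH, hP with }

/-- Telescoping in a complete ring. -/
theorem mem_of_forall_exists_sub_mul_mem {J : Ideal C} [hJ : IsAdicComplete J C] {I : Ideal C}
    (hI : I.FG) {a : C} (ha : a ∈ J) {S : Set C} (hS : ∀ z ∈ S, ∃ w ∈ S, z - a * w ∈ I) {z : C}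
    (hz : z ∈ S) : z ∈ I := by
  obtain ⟨t, rfl⟩ := hI
  choose w hwS hw using hS
  let zs : ℕ → S := fun n => Nat.rec ⟨z, hz⟩ (fun _ u => ⟨w u u.2, hwS u u.2⟩) n
  have hzs : ∀ n, (zs n).1 - a * (zs (n + 1)).1 ∈ Ideal.span (t : Set C) := fun n => by
    have h1 : (zs (n + 1)).1 = w (zs n).1 (zs n).2 := rfl
    rw [h1]
    exact hw _ _
  have hc : ∀ n, ∃ c : t → C, ∑ g : t, c g * g = (zs n).1 - a * (zs (n + 1)).1 := fun n => by
    have := hzs n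
    rw [Submodule.mem_span_finset'] at this
    simpa using this
  choose c hc using hc
  have hs : ∀ g : t, ∃ s, ∀ n, ∑ k ∈ Finset.range n, a ^ k * c k g - s ∈ J ^ n := by
    intro g
    obtain ⟨s, hs⟩ := hJ.toIsPrecomplete.prec
      (f := fun n => ∑ k ∈ Finset.range n, a ^ k * c k g) fun {m n} hmn => by
        rw [SModEq.sub_mem, smul_eq_mul, Ideal.mul_top, ← neg_mem_iff, neg_sub,
          ← Finset.sum_range_add_sum_Ico _ hmn, add_sub_cancel_left]
        exact Ideal.sum_mem _ fun k hk => Ideal.mul_mem_right _ _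
          (Ideal.pow_le_pow_right (Finset.mem_Ico.1 hk).1 (Ideal.pow_mem_pow ha k))
    refine ⟨s, fun n => ?_⟩
    have := hs n
    rwa [SModEq.sub_mem, smul_eq_mul, Ideal.mul_top] at this
  choose s hs using hs
  have htel : ∀ n, z = ∑ k ∈ Finset.range n, a ^ k * ∑ g : t, c k g * g + a ^ n * (zs n).1 := by
    intro n
    induction n with
    | zero => simp [zs]
    | succ n ih =>
      rw [Finset.sum_range_succ, hc n]
      refine ih.trans ?_
      ring
  have hz0 : z - ∑ g : t, s g * g = 0 := by
    refine hJ.toIsHausdorff.haus _ fun n => ?_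
    rw [SModEq.zero, smul_eq_mul, Ideal.mul_top]
    have h1 : z - ∑ g : t, s g * g =
        ∑ g : t, (∑ k ∈ Finset.range n, a ^ k * c k g - s g) * g + a ^ n * (zs n).1 := by
      conv_lhs => rw [htel n]
      simp only [sub_mul, Finset.sum_sub_distrib, Finset.mul_sum, Finset.sum_mul]
      rw [Finset.sum_comm]
      simp only [mul_assoc]
      ring
    rw [h1]
    exact Ideal.add_mem _ (Ideal.sum_mem _ fun g _ => Ideal.mul_mem_right _ _ (hs g n))
      (Ideal.mul_mem_right _ _ (Ideal.pow_mem_pow ha n))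
  rw [sub_eq_zero.1 hz0]
  exact Ideal.sum_mem _ fun g _ => Ideal.mul_mem_left _ _ (Ideal.subset_span g.2)

namespace RegularMod

theorem swap {J : Ideal C} [IsAdicComplete J C] {I : Ideal C} (hI : I.FG) {a b : C} {L : List C}
    (ha : a ∈ J) (h : RegularMod I (a :: b :: L)) : RegularMod I (b :: a :: L) := by
  refine ⟨fun z hz => ?_, h.of_cons_cons⟩
  refine mem_of_forall_exists_sub_mul_mem (S := {z | b * z ∈ I}) hI ha (fun z hz => ?_) hz
  obtain ⟨w, hw⟩ := mem_sup_span_singleton.1 (h.2.1 z (Ideal.mem_sup_left hz))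
  refine ⟨w, h.1 _ ?_, hw⟩
  have := I.sub_mem hz (I.mul_mem_left b hw)
  convert this using 1
  ring

theorem perm {J : Ideal C} [IsAdicComplete J C] {L L' : List C} (hp : L.Perm L')
    (hL : ∀ a ∈ L, a ∈ J) {I : Ideal C} (hI : I.FG) (h : RegularMod I L) : RegularMod I L' := by
  induction hp generalizing I with
  | nil => exact h
  | cons a _ ih =>
    exact ⟨h.1, ih (fun b hb => hL b (List.mem_cons_of_mem _ hb))
      (Submodule.FG.sup hI (Submodule.fg_span_singleton a)) h.2⟩
  | swap a b L => exact h.swap hI (hL b List.mem_cons_self)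
  | trans h1 _ ih1 ih2 => exact ih2 (fun a ha => hL a (h1.mem_iff.2 ha)) hI (ih1 hL hI h)

theorem perm_append_singleton {J : Ideal C} [IsAdicComplete J C] {L : List C} {a : C}
    (ha : a ∈ J) (hL : ∀ b ∈ L, b ∈ J) {I : Ideal C} (hI : I.FG) :
    RegularMod I (a :: L) ↔
      RegularMod I L ∧ ∀ z, a * z ∈ I ⊔ listSpan L → z ∈ I ⊔ listSpan L := by
  have h1 : RegularMod I (a :: L) ↔ RegularMod I (L ++ [a]) := by
    have hp : (a :: L).Perm (L ++ [a]) := (List.perm_append_singleton a L).symm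
    have hm : ∀ b ∈ a :: L, b ∈ J := by simpa using ⟨ha, hL⟩
    exact ⟨perm hp hm hI, perm hp.symm (fun b hb => hm b (hp.mem_iff.2 hb)) hI⟩
  rw [h1, append]
  simp [RegularMod]

end RegularMod

end CompleteExchange

section Parameters

open IsLocalRing

variable {R : Type*} [CommRing R] [IsLocalRing R] [IsNoetherianRing R]

theorem IsLocalRing.maximalIdeal_le_radical_of_notMem {I : Ideal R} {x z : R}
    (hx : x ∈ maximalIdeal R)
    (h : maximalIdeal R ≤ (I ⊔ Ideal.span {x}).radical)
    (hz : ∀ q ∈ I.minimalPrimes, q ≠ maximalIdeal R → z ∉ q) :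
    maximalIdeal R ≤ (I ⊔ Ideal.span {z}).radical := by
  rw [Ideal.radical_eq_sInf]
  refine le_sInf fun P ⟨hP, hPp⟩ => ?_
  obtain ⟨q, hq, hqP⟩ := Ideal.exists_minimalPrimes_le (le_sup_left.trans hP)
  have hqp : q.IsPrime := hq.1.1
  by_cases hqm : q = maximalIdeal R
  · rwa [← hqm]
  have hzP : z ∈ P := hP (Ideal.mem_sup_right (Ideal.mem_span_singleton_self z))
  have hlt : q < P := lt_of_le_of_ne hqP fun e => hz q hq hqm (e ▸ hzP)
  by_contra hPm
  have hlt' : P < maximalIdeal R := lt_of_le_not_ge (le_maximalIdeal_of_isPrime P) hPm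
  have hmin : maximalIdeal R ∈ (q ⊔ Ideal.span {x}).minimalPrimes := by
    refine ⟨⟨inferInstance, sup_le (le_maximalIdeal_of_isPrime q)
      ((Ideal.span_singleton_le_iff_mem _).2 hx)⟩, fun Q ⟨hQp, hQ⟩ _ => ?_⟩
    refine h.trans ((Ideal.radical_mono ?_).trans hQp.radical.le)
    exact (sup_le_sup_right hq.1.2 _).trans hQ
  have hht := Ideal.map_height_le_one_of_mem_minimalPrimes hmin
  have hsurj : Function.Surjective (Ideal.Quotient.mk q) := Ideal.Quotient.mk_surjective
  have hprime : ∀ Q : Ideal R, Q.IsPrime → q ≤ Q → (Q.map (Ideal.Quotient.mk q)).IsPrime :=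
    fun Q hQ hqQ => Ideal.map_isPrime_of_surjective hsurj (Ideal.mk_ker.trans_le hqQ)
  have hstrict : ∀ Q Q' : Ideal R, q ≤ Q → Q < Q' →
      Q.map (Ideal.Quotient.mk q) < Q'.map (Ideal.Quotient.mk q) := by
    intro Q Q' hqQ hQQ'
    refine lt_of_le_not_ge (Ideal.map_mono hQQ'.le) fun hle => hQQ'.not_ge ?_
    have := Ideal.comap_mono (f := Ideal.Quotient.mk q) hle
    rwa [Ideal.comap_map_of_surjective' _ hsurj, Ideal.comap_map_of_surjective' _ hsurj,
      Ideal.mk_ker, sup_eq_left.2 hqQ, sup_eq_left.2 (hqQ.trans hQQ'.le)] at this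
  have i1 := hprime q hqp le_rfl
  have i2 := hprime P hPp hqP
  have i3 := hprime (maximalIdeal R) inferInstance (hqP.trans hlt'.le)
  have h1 : (P.map (Ideal.Quotient.mk q)).height ≤ 0 :=
    Order.lt_one_iff_nonpos.mp (Ideal.height_le_iff.mp hht _ i2 (hstrict _ _ hqP hlt'))
  exact not_lt_zero (Ideal.height_le_iff.mp h1 _ i1 (hstrict _ _ le_rfl hlt))

theorem IsLocalRing.exists_common_parameter {I J : Ideal R} {x y : R}
    (hx : x ∈ maximalIdeal R) (hy : y ∈ maximalIdeal R)
    (hIx : maximalIdeal R ≤ (I ⊔ Ideal.span {x}).radical)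
    (hJy : maximalIdeal R ≤ (J ⊔ Ideal.span {y}).radical) :
    ∃ z ∈ maximalIdeal R, maximalIdeal R ≤ (I ⊔ Ideal.span {z}).radical ∧
      maximalIdeal R ≤ (J ⊔ Ideal.span {z}).radical := by
  classical
  have hfin : ((I.minimalPrimes ∪ J.minimalPrimes) \ {maximalIdeal R}).Finite :=
    ((I.finite_minimalPrimes_of_isNoetherianRing R).union
      (J.finite_minimalPrimes_of_isNoetherianRing R)).sdiff
  have hprime : ∀ q ∈ hfin.toFinset, q.IsPrime := fun q hq => by
    have := hfin.mem_toFinset.1 hq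
    rcases this.1 with h | h
    · exact h.1.1
    · exact h.1.1
  have hnot : ¬ ((maximalIdeal R : Set R) ⊆ ⋃ q ∈ (hfin.toFinset : Set (Ideal R)), (q : Set R)) := by
    rw [Ideal.subset_union_prime (f := fun q => q) ⊥ ⊥ fun q hq _ _ => hprime q hq]
    rintro ⟨q, hq, hle⟩
    have := hprime q hq
    exact (hfin.mem_toFinset.1 hq).2 (le_antisymm (le_maximalIdeal_of_isPrime q) hle)
  obtain ⟨z, hz, hz'⟩ := Set.not_subset.1 hnot
  have hz2 : ∀ q ∈ I.minimalPrimes ∪ J.minimalPrimes, q ≠ maximalIdeal R → z ∉ q := by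
    intro q hq hqm hzq
    exact hz' (Set.mem_biUnion (Finset.mem_coe.2 (hfin.mem_toFinset.2 ⟨hq, hqm⟩)) hzq)
  exact ⟨z, hz, maximalIdeal_le_radical_of_notMem hx hIx fun q hq => hz2 q (Or.inl hq),
    maximalIdeal_le_radical_of_notMem hy hJy fun q hq => hz2 q (Or.inr hq)⟩

theorem mem_of_mul_mem_of_mem_radical {A C : Type*} [CommRing A] [CommRing C] {φ : A →+* C}
    {I : Ideal A} {x z : A}
    (hx : x ∈ (I ⊔ Ideal.span {z}).radical)
    (h : ∀ w, φ x * w ∈ I.map φ → w ∈ I.map φ) {w : C} (hw : φ z * w ∈ I.map φ) :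
    w ∈ I.map φ := by
  obtain ⟨N, hN⟩ := hx
  obtain ⟨u, hu⟩ := mem_sup_span_singleton.1 hN
  have h1 : ∀ N w, φ x ^ N * w ∈ I.map φ → w ∈ I.map φ := by
    intro N
    induction N with
    | zero => intro w hw; simpa using hw
    | succ N ih => intro w hw; exact h w (ih _ (by rwa [← mul_assoc, ← pow_succ]))
  refine h1 N w ?_
  have h2 := Ideal.mul_mem_right w _ (Ideal.mem_map_of_mem φ hu)
  have := Ideal.add_mem _ h2 (Ideal.mul_mem_left _ (φ u) hw)
  convert this using 1
  rw [map_sub, map_mul, map_pow]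
  ring

variable {C : Type*} [CommRing C] {φ : R →+* C}

theorem RegularMod.exchange [hC : IsAdicComplete ((maximalIdeal R).map φ) C] {I : Ideal R}
    {L L' : List R} (hlen : L.length = L'.length)
    (hL : ∀ a ∈ L, a ∈ maximalIdeal R) (hL' : ∀ a ∈ L', a ∈ maximalIdeal R)
    (hr : maximalIdeal R ≤ (I ⊔ listSpan L).radical)
    (hr' : maximalIdeal R ≤ (I ⊔ listSpan L').radical)
    (h : RegularMod (I.map φ) (L.map φ)) : RegularMod (I.map φ) (L'.map φ) := by
  induction L generalizing I L' with
  | nil =>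
    rw [List.length_nil, eq_comm, List.length_eq_zero_iff] at hlen
    subst hlen
    trivial
  | cons x L ih =>
    obtain ⟨y, L', rfl⟩ : ∃ y L'', L' = y :: L'' := by
      cases L' with
      | nil => simp at hlen
      | cons y L' => exact ⟨y, L', rfl⟩
    simp only [List.mem_cons, forall_eq_or_imp] at hL hL'
    have hfg : ∀ K : Ideal R, (K.map φ).FG := fun K => Ideal.FG.map (IsNoetherian.noetherian K) φ
    have hsup : ∀ M : List R, I.map φ ⊔ listSpan (M.map φ) = (I ⊔ listSpan M).map φ := by
      intro M
      rw [Ideal.map_sup, map_listSpan]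
    have hmem : ∀ a ∈ maximalIdeal R, φ a ∈ (maximalIdeal R).map φ :=
      fun a ha => Ideal.mem_map_of_mem φ ha
    have hmem' : ∀ M : List R, (∀ a ∈ M, a ∈ maximalIdeal R) →
        ∀ b ∈ M.map φ, b ∈ (maximalIdeal R).map φ := by
      intro M hM b hb
      obtain ⟨a, ha, rfl⟩ := List.mem_map.1 hb
      exact hmem a (hM a ha)
    rw [sup_listSpan_cons, sup_right_comm] at hr hr'
    obtain ⟨z, hz, hz1, hz2⟩ := exists_common_parameter hL.1 hL'.1 hr hr'
    have hiff : ∀ (M : List R) (a : R), a ∈ maximalIdeal R → (∀ b ∈ M, b ∈ maximalIdeal R) →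
        (RegularMod (I.map φ) (φ a :: M.map φ) ↔ RegularMod (I.map φ) (M.map φ) ∧
          ∀ w, φ a * w ∈ (I ⊔ listSpan M).map φ → w ∈ (I ⊔ listSpan M).map φ) := by
      intro M a ha hM
      rw [RegularMod.perm_append_singleton (hmem a ha) (hmem' M hM) (hfg I), hsup]
    rw [List.map_cons, hiff L x hL.1 hL.2] at h
    have hz3 : RegularMod (I.map φ) (φ z :: L.map φ) := (hiff L z hz hL.2).2
      ⟨h.1, fun w hw => mem_of_mul_mem_of_mem_radical (hz1 hL.1) h.2 hw⟩
    have hspan : I.map φ ⊔ Ideal.span {φ z} = (I ⊔ Ideal.span {z}).map φ := by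
      rw [Ideal.map_sup, Ideal.map_span, Set.image_singleton]
    have hz4 : RegularMod (I.map φ) (φ z :: L'.map φ) := by
      refine ⟨hz3.1, ?_⟩
      have h5 := hz3.2
      rw [hspan] at h5 ⊢
      refine ih (by simpa using hlen) hL.2 hL'.2 ?_ ?_ h5
      · rwa [sup_right_comm]
      · rwa [sup_right_comm]
    rw [hiff L' z hz hL'.2] at hz4
    rw [List.map_cons, hiff L' y hL'.1 hL'.2]
    exact ⟨hz4.1, fun w hw => mem_of_mul_mem_of_mem_radical (hr' hz) hz4.2 hw⟩

end Parameters

section BigCohenMacaulay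

open IsLocalRing

variable {R : Type} [CommRing R] [IsLocalRing R] [IsNoetherianRing R]

theorem IsSOP.isBigCM_of_regularMod {C : Type*} [CommRing C] {φ : R →+* C} {d : ℕ} {x : Fin d → R}
    (hx : IsSOP R x) [hC : IsAdicComplete ((maximalIdeal R).map φ) C]
    (hne : (maximalIdeal R).map φ ≠ ⊤) (h : RegularMod ⊥ ((List.ofFn x).map φ)) : IsBigCM φ := by
  intro d' y hy
  obtain rfl : d = d' := by
    have := hx.1.trans hy.1.symm
    exact_mod_cast this
  have hmem : ∀ {u : Fin d → R}, IsSOP R u → ∀ a ∈ List.ofFn u, a ∈ maximalIdeal R := by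
    intro u hu a ha
    obtain ⟨i, rfl⟩ := List.mem_ofFn.1 ha
    exact hu.2.1 i
  have hrad : ∀ {u : Fin d → R}, IsSOP R u →
      maximalIdeal R ≤ ((⊥ : Ideal R) ⊔ listSpan (List.ofFn u)).radical := by
    intro u hu
    rw [bot_sup_eq, listSpan_ofFn, hu.2.2]
  have h1 := RegularMod.exchange (φ := φ) (I := ⊥) (by simp) (hmem hx) (hmem hy) (hrad hx) (hrad hy)
    (by rwa [Ideal.map_bot])
  have hy' : (List.ofFn y).map φ = List.ofFn fun i => φ (y i) := by
    rw [List.map_ofFn]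
    rfl
  rw [Ideal.map_bot, hy'] at h1
  refine isRegSeq_iff.2 ⟨h1, fun htop => hne ?_⟩
  rw [← hy', ← map_listSpan] at htop
  exact top_le_iff.1 (htop.ge.trans (Ideal.map_mono (Ideal.span_le.2 (hmem hy))))

theorem IsSOP.exists_complete_bigCM {T B : Type} [CommRing T] [CommRing B] (α : R →+* T)
    (ψ : T →+* B) {d : ℕ} {x : Fin d → R} (hx : IsSOP R x)
    (h : IsRegSeq fun i => ψ (α (x i))) :
    ∃ (C : Type) (_ : CommRing C) (ι : T →+* C), IsBigCM (ι.comp α) ∧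
      IsAdicComplete ((maximalIdeal R).map (ι.comp α)) C := by
  obtain ⟨h1, h2⟩ := isRegSeq_iff.1 h
  obtain ⟨C, _, f, hreg, hcomp, hne⟩ := h1.exists_isAdicComplete h2
  have hL : (List.ofFn fun i => ψ (α (x i))).map f =
      (List.ofFn x).map ((f.comp ψ).comp α) := by
    rw [List.map_ofFn, List.map_ofFn]
    rfl
  rw [hL] at hreg hcomp hne
  rw [← map_listSpan] at hcomp hne
  have hle : listSpan (List.ofFn x) ≤ maximalIdeal R := by
    rw [listSpan_ofFn, Ideal.span_le]
    rintro _ ⟨i, rfl⟩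
    exact hx.2.1 i
  obtain ⟨k, hk⟩ : ∃ k, maximalIdeal R ^ k ≤ listSpan (List.ofFn x) := by
    refine Ideal.exists_pow_le_of_le_radical_of_fg ?_ (IsNoetherian.noetherian _)
    rw [listSpan_ofFn, hx.2.2]
  have hk' : ((maximalIdeal R).map ((f.comp ψ).comp α)) ^ k ≤
      (listSpan (List.ofFn x)).map ((f.comp ψ).comp α) := by
    rw [← Ideal.map_pow]
    exact Ideal.map_mono hk
  have hC : IsAdicComplete ((maximalIdeal R).map ((f.comp ψ).comp α)) C :=
    IsAdicComplete.of_le_of_pow_le (Ideal.map_mono hle) hk'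
  refine ⟨C, inferInstance, f.comp ψ, hx.isBigCM_of_regularMod (fun htop => hne ?_) hreg, hC⟩
  rw [htop, Ideal.top_pow] at hk'
  exact top_le_iff.1 hk'

end BigCohenMacaulay

/-- Power series with coefficients in `W` can be evaluated at elements of an ideal `I` of an
`I`-adically complete ring. -/
theorem MvPowerSeries.exists_evalHom {σ W S : Type*} [Finite σ] [CommRing W] [CommRing S]
    (I : Ideal S) [hI : IsAdicComplete I S] (g : W →+* S) {a : σ → S} (ha : ∀ i, a i ∈ I) :
    ∃ e : MvPowerSeries σ W →+* S, (∀ w, e (C w) = g w) ∧ ∀ i, e (X i) = a i := by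
  let : WithIdeal S := ⟨I⟩
  have hadic : IsAdic I := rfl
  obtain ⟨hc, ht⟩ := hadic.isAdicComplete_iff.mp hI
  have hlin : IsLinearTopology S S := I.isLinearTopology
  let : UniformSpace W := ⊥
  have hW : DiscreteTopology W := ⟨rfl⟩
  have hev : HasEval a :=
    { hpow := fun i => by
        refine (hadic.hasBasis_nhds_zero.tendsto_right_iff).mpr fun N _ => ?_
        filter_upwards [Filter.eventually_ge_atTop N] with m hm
        exact Ideal.pow_le_pow_right hm (Ideal.pow_mem_pow (ha i) m)
      tendsto_zero := by simp }
  have hcont : Continuous g := continuous_of_discreteTopology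
  refine ⟨eval₂Hom hcont hev, fun w => ?_, fun i => ?_⟩
  · rw [coe_eval₂Hom, eval₂_C]
  · rw [coe_eval₂Hom, eval₂_X]

theorem Ideal.isAdicComplete_of_pow_eq_bot {S : Type*} [CommRing S] {I : Ideal S} {N : ℕ}
    (h : I ^ N = ⊥) : IsAdicComplete I S := by
  have hH : IsHausdorff I S := ⟨fun x hx => by
    have := hx N
    rwa [SModEq.zero, smul_eq_mul, Ideal.mul_top, h, Ideal.mem_bot] at this⟩
  have hP : IsPrecomplete I S := ⟨fun f hf => ⟨f N, fun m => by
    rcases le_total m N with hm | hm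
    · exact hf hm
    · have := hf hm
      rw [SModEq.sub_mem, smul_eq_mul, Ideal.mul_top, h, Ideal.mem_bot, sub_eq_zero] at this
      rw [this]⟩⟩
  exact { hH, hP with }

/-- Power series can be evaluated at nilpotent elements. -/
theorem MvPowerSeries.exists_evalHom_of_pow_eq_zero {σ W S : Type*} [Finite σ] [CommRing W]
    [CommRing S] (g : W →+* S) {a : σ → S} {N : ℕ} (ha : ∀ i, a i ^ N = 0) :
    ∃ e : MvPowerSeries σ W →+* S, (∀ w, e (C w) = g w) ∧ ∀ i, e (X i) = a i := by
  have hfg : (Ideal.span (Set.range a)).FG := Submodule.fg_span (Set.finite_range a)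
  have hle : Ideal.span (Set.range a) ≤ (⊥ : Ideal S).radical := by
    rw [Ideal.span_le]
    rintro _ ⟨i, rfl⟩
    exact ⟨N, by simp [ha i]⟩
  obtain ⟨M, hM⟩ := Ideal.exists_pow_le_of_le_radical_of_fg hle hfg
  have := Ideal.isAdicComplete_of_pow_eq_bot (le_bot_iff.mp hM)
  exact exists_evalHom (Ideal.span (Set.range a)) g fun i => Ideal.subset_span ⟨i, rfl⟩

/-- A ring homomorphism from a ring of power series that makes the variables nilpotent is
determined by its values on constants and variables. -/
theorem MvPowerSeries.ringHom_ext_of_pow_eq_zero {σ W S : Type*} [Finite σ] [CommRing W]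
    [CommRing S] {e₁ e₂ : MvPowerSeries σ W →+* S} (hC : ∀ w, e₁ (C w) = e₂ (C w))
    (hX : ∀ i, e₁ (X i) = e₂ (X i)) {N : ℕ} (hN : ∀ i, e₁ (X i) ^ N = 0) : e₁ = e₂ := by
  classical
  have := Fintype.ofFinite σ
  have hpoly : e₁.comp MvPolynomial.coeToMvPowerSeries.ringHom =
      e₂.comp MvPolynomial.coeToMvPowerSeries.ringHom := by
    apply MvPolynomial.ringHom_ext
    · intro w; simpa using hC w
    · intro i; simpa using hX i
  ext f
  set s : Finset (σ →₀ ℕ) := Finset.Iic (Finsupp.equivFunOnFinite.symm fun _ => N) with hs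
  set P : MvPolynomial σ W := truncFinset W s f with hP
  have hmem : f - (P : MvPowerSeries σ W) ∈
      Ideal.span ((fun i => (X i : MvPowerSeries σ W) ^ N) '' (Finset.univ : Finset σ)) := by
    rw [mem_span_X_pow_iff]
    intro ν hν
    have hνs : ν ∈ s := by
      rw [hs, Finset.mem_Iic]
      exact fun i => (hν i (Finset.mem_univ i)).le
    rw [map_sub, MvPolynomial.coeff_coe, hP, coeff_truncFinset_of_mem f hνs, sub_self]
  have hker : ∀ e : MvPowerSeries σ W →+* S, (∀ i, e (X i) ^ N = 0) →
      e f = e (P : MvPowerSeries σ W) := by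
    intro e he
    have : Ideal.span ((fun i => (X i : MvPowerSeries σ W) ^ N) '' (Finset.univ : Finset σ)) ≤
        RingHom.ker e := by
      rw [Ideal.span_le]
      rintro _ ⟨i, -, rfl⟩
      simpa [RingHom.mem_ker] using he i
    have := this hmem
    rwa [RingHom.mem_ker, map_sub, sub_eq_zero] at this
  rw [hker e₁ hN, hker e₂ fun i => by rw [← hX, hN]]
  exact RingHom.congr_fun hpoly P

open WittVector in
theorem WittVector.exists_ringHom_quotient_pow {p : ℕ} [hp : Fact p.Prime] {S k : Type*}
    [CommRing S] [CommRing k] [CharP k p] [PerfectRing k p] {ρ : S →+* k}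
    (hρ : Function.Surjective ρ) (N : ℕ) :
    ∃ h : WittVector p k →+* S ⧸ RingHom.ker ρ ^ (N + 1),
      ∀ s : S, h (teichmuller p (ρ s ^ p ^ N)) = Ideal.Quotient.mk _ (s ^ p ^ N) := by
  have hpI : (p : S) ∈ RingHom.ker ρ := by simp [RingHom.mem_ker]
  have hker : RingHom.ker (WittVector.map (p := p) ρ) ≤ RingHom.ker
      ((Ideal.Quotient.mk (RingHom.ker ρ ^ (N + 1))).comp (ghostComponent (p := p) N)) := by
    intro x hx
    rw [RingHom.mem_ker] at hx
    have hx' : ∀ i, x.coeff i ∈ RingHom.ker ρ := fun i => by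
      rw [RingHom.mem_ker, ← map_coeff, hx, zero_coeff]
    rw [RingHom.mem_ker, RingHom.comp_apply, Ideal.Quotient.eq_zero_iff_mem,
      ghostComponent_apply, aeval_wittPolynomial]
    refine Ideal.sum_mem _ fun i hi => ?_
    have hi' : i ≤ N := Nat.lt_succ_iff.mp (Finset.mem_range.mp hi)
    have hle : N + 1 ≤ i + p ^ (N - i) := by
      have := Nat.lt_pow_self (n := N - i) hp.out.one_lt
      omega
    refine Ideal.pow_le_pow_right hle ?_
    rw [pow_add]
    exact Ideal.mul_mem_mul (Ideal.pow_mem_pow hpI _) (Ideal.pow_mem_pow (hx' i) _)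
  obtain ⟨g, hg⟩ : ∃ g : WittVector p k →+* S ⧸ RingHom.ker ρ ^ (N + 1),
      ∀ x, g (WittVector.map ρ x) = Ideal.Quotient.mk _ (ghostComponent N x) :=
    ⟨RingHom.liftOfSurjective (WittVector.map ρ) (map_surjective _ hρ) ⟨_, hker⟩,
      fun x => RingHom.liftOfSurjective_comp_apply ..⟩
  refine ⟨g.comp (WittVector.map ((iterateFrobeniusEquiv k p N).symm : k →+* k)), fun s => ?_⟩
  have h1 : ((iterateFrobeniusEquiv k p N).symm : k →+* k) (ρ s ^ p ^ N) = ρ s :=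
    (iterateFrobeniusEquiv k p N).symm_apply_apply (ρ s)
  rw [RingHom.comp_apply, map_teichmuller, h1, ← map_teichmuller, hg, ghostComponent_teichmuller]

open WittVector in
/-- Ring homomorphisms out of the Witt vectors of a perfect ring `k` of characteristic `p`,
into a ring that is complete along the kernel of a surjection onto `k`. -/
theorem WittVector.exists_ringHom_of_isAdicComplete {p : ℕ} [hp : Fact p.Prime] {S k : Type*}
    [CommRing S] [CommRing k] [CharP k p] [PerfectRing k p] {ρ : S →+* k}
    (hρ : Function.Surjective ρ) [IsAdicComplete (RingHom.ker ρ) S] :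
    ∃ g : WittVector p k →+* S, ∀ w, ρ (g w) = w.coeff 0 := by
  have hpI : (p : S) ∈ RingHom.ker ρ := by simp [RingHom.mem_ker]
  choose h hh using fun N => exists_ringHom_quotient_pow (p := p) hρ N
  have ha : StrictMono fun n : ℕ => n + 1 := fun _ _ h => Nat.succ_lt_succ h
  have hcomp : ∀ {m : ℕ}, (Ideal.Quotient.factorPow (RingHom.ker ρ)
      (ha.monotone m.le_succ)).comp (h (m + 1)) = h m := by
    intro m
    apply eq_of_apply_teichmuller_eq
    · refine ⟨m + 1, ?_⟩
      rw [← map_natCast (Ideal.Quotient.mk _), ← map_pow, Ideal.Quotient.eq_zero_iff_mem]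
      exact Ideal.pow_mem_pow hpI _
    · intro x
      obtain ⟨s, hs⟩ := hρ ((iterateFrobeniusEquiv k p (m + 1)).symm x)
      have hx : x = ρ s ^ p ^ (m + 1) := by
        rw [hs]; exact ((iterateFrobeniusEquiv k p (m + 1)).apply_symm_apply x).symm
      have hx' : x = ρ (s ^ p) ^ p ^ m := by
        rw [hx, map_pow, ← pow_mul, pow_succ']
      have h1 := hh (m + 1) s
      have h2 := hh m (s ^ p)
      rw [← hx] at h1
      rw [← hx', ← pow_mul, ← pow_succ'] at h2
      rw [h2]
      exact congrArg (Ideal.Quotient.factorPow _ (ha.monotone m.le_succ)) h1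
  refine ⟨IsAdicComplete.StrictMono.liftRingHom _ ha h hcomp, ?_⟩
  set g := IsAdicComplete.StrictMono.liftRingHom _ ha h hcomp with hg
  have key : ρ.comp g = constantCoeff := by
    apply eq_of_apply_teichmuller_eq
    · exact ⟨1, by simp⟩
    · intro x
      obtain ⟨s, rfl⟩ := hρ x
      have h0 := hh 0 s
      rw [pow_zero p, pow_one (ρ s), pow_one s] at h0
      have h1 := IsAdicComplete.StrictMono.mk_liftRingHom _ ha h hcomp (n := 0)
        (teichmuller p (ρ s))
      rw [← hg, h0] at h1
      have h2 := Ideal.Quotient.eq.mp h1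
      rw [zero_add, pow_one, RingHom.mem_ker, map_sub, sub_eq_zero] at h2
      rw [RingHom.comp_apply, h2, constantCoeff_apply, teichmuller_coeff_zero]
  intro w
  exact RingHom.congr_fun key w

theorem RingHom.exists_of_jointly_injective {A S : Type*} [CommRing A] [CommRing S]
    {Q : ℕ → Type*} [∀ N, CommRing (Q N)] (q : ∀ N, S →+* Q N)
    (hq : ∀ s t, (∀ N, q N s = q N t) → s = t) (f : ∀ N, A →+* Q N)
    (h : ∀ a, ∃ s, ∀ N, q N s = f N a) : ∃ F : A →+* S, ∀ N a, q N (F a) = f N a := by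
  choose F hF using h
  exact ⟨{  toFun := F
            map_one' := hq _ _ fun N => by simp [hF]
            map_mul' := fun a b => hq _ _ fun N => by simp [hF]
            map_zero' := hq _ _ fun N => by simp [hF]
            map_add' := fun a b => hq _ _ fun N => by simp [hF] }, fun N a => hF a N⟩

theorem IsPrecomplete.exists_of_compatible {D : Type*} [CommRing D] (I : Ideal D)
    [IsPrecomplete I D] (z : ∀ N, D ⧸ I ^ N)
    (hz : ∀ {m n : ℕ} (h : m ≤ n), Ideal.Quotient.factorPow I h (z n) = z m) :
    ∃ d : D, ∀ N, Ideal.Quotient.mk (I ^ N) d = z N := by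
  choose f hf using fun N => Ideal.Quotient.mk_surjective (z N)
  obtain ⟨d, hd⟩ := IsPrecomplete.prec (I := I) ‹_› (f := f) (by
    intro m n hmn
    rw [SModEq.sub_mem, smul_eq_mul, Ideal.mul_top, ← Ideal.Quotient.eq, hf, ← hz hmn, ← hf]
    rfl)
  refine ⟨d, fun N => ?_⟩
  have := hd N
  rw [SModEq.sub_mem, smul_eq_mul, Ideal.mul_top, ← Ideal.Quotient.eq, hf] at this
  exact this.symm

open MvPowerSeries WittVector in
theorem WittVector.exists_ringHom_mvPowerSeries (p : ℕ) [hp : Fact p.Prime] (k σ : Type*)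
    [CommRing k] [Finite σ] :
    ∃ θ : MvPowerSeries σ (WittVector p k) →+* WittVector p (MvPowerSeries σ k),
      (∀ i, θ (X i) = teichmuller p (X i)) ∧
      ∀ a, (θ a).coeff 0 = MvPowerSeries.map constantCoeff a := by
  obtain ⟨I, hI⟩ : ∃ I : Ideal (MvPowerSeries σ k), I = Ideal.span (Set.range X) := ⟨_, rfl⟩
  have hcpl : IsAdicComplete I (MvPowerSeries σ k) := hI ▸ inferInstance
  have hXI : ∀ i, (X i : MvPowerSeries σ k) ∈ I := fun i => hI ▸ Ideal.subset_span ⟨i, rfl⟩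
  have hXN : ∀ N i, Ideal.Quotient.mk (I ^ N) (X i) ^ N = 0 := fun N i => by
    rw [← map_pow, Ideal.Quotient.eq_zero_iff_mem]
    exact Ideal.pow_mem_pow (hXI i) N
  have hXN' : ∀ N i, teichmuller p (Ideal.Quotient.mk (I ^ N) (X i)) ^ N = 0 := fun N i => by
    rcases N.eq_zero_or_pos with rfl | hN
    · have : Subsingleton (WittVector p (MvPowerSeries σ k ⧸ I ^ 0)) := by
        have : Subsingleton (MvPowerSeries σ k ⧸ I ^ 0) := by
          rw [Ideal.Quotient.subsingleton_iff, pow_zero, Ideal.one_eq_top]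
        exact ⟨fun a b => WittVector.ext fun _ => Subsingleton.elim _ _⟩
      exact Subsingleton.elim _ _
    · rw [← map_pow, hXN, teichmuller_zero]
  choose f hfC hfX using fun N => exists_evalHom_of_pow_eq_zero
    (WittVector.map (p := p) ((Ideal.Quotient.mk (I ^ N)).comp MvPowerSeries.C)) (hXN' N)
  have hcomp : ∀ {m n : ℕ} (h : m ≤ n),
      (WittVector.map (Ideal.Quotient.factorPow I h)).comp (f n) = f m := by
    intro m n h
    symm
    refine ringHom_ext_of_pow_eq_zero (N := m) (fun w => ?_) (fun i => ?_) fun i => ?_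
    · rw [RingHom.comp_apply, hfC, hfC]
      ext j
      simp only [map_coeff]
      rfl
    · rw [RingHom.comp_apply, hfX, hfX, map_teichmuller]
      rfl
    · rw [hfX, hXN']
  have hsep : ∀ s t : MvPowerSeries σ k,
      (∀ N, Ideal.Quotient.mk (I ^ N) s = Ideal.Quotient.mk (I ^ N) t) → s = t := by
    intro s t h
    rw [IsHausdorff.eq_iff_smodEq (I := I)]
    intro N
    rw [SModEq.sub_mem, smul_eq_mul, Ideal.mul_top, ← Ideal.Quotient.eq, h]
  obtain ⟨θ, hθ⟩ := RingHom.exists_of_jointly_injective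
    (fun N => WittVector.map (p := p) (Ideal.Quotient.mk (I ^ N)))
    (fun s t h => WittVector.ext fun j => hsep _ _ fun N => by
      rw [← map_coeff, h, map_coeff]) f (fun a => by
      choose d hd using fun j => IsPrecomplete.exists_of_compatible I
        (fun N => (f N a).coeff j) (fun {m n} h => by
          rw [← hcomp h]; rfl)
      exact ⟨WittVector.mk p d, fun N => WittVector.ext fun j => by
        rw [map_coeff, coeff_mk, hd]⟩)
  refine ⟨θ, fun i => ?_, fun a => ?_⟩
  · refine WittVector.ext fun j => hsep _ _ fun N => ?_
    rw [← map_coeff, hθ, hfX, ← map_teichmuller, map_coeff]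
  · refine hsep _ _ fun N => ?_
    rw [← map_coeff, hθ]
    have key : (constantCoeff (p := p)).comp (f N) =
        (Ideal.Quotient.mk (I ^ N)).comp (MvPowerSeries.map constantCoeff) := by
      refine ringHom_ext_of_pow_eq_zero (N := N) (fun w => ?_) (fun i => ?_) fun i => ?_
      · rw [RingHom.comp_apply, hfC, RingHom.comp_apply, map_C]; rfl
      · rw [RingHom.comp_apply, hfX, RingHom.comp_apply, map_X, constantCoeff_apply,
          teichmuller_coeff_zero]
      · rw [RingHom.comp_apply, hfX, constantCoeff_apply, teichmuller_coeff_zero, hXN]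
    exact RingHom.congr_fun key a

open IsLocalRing in
/-- A nonzero element of the maximal ideal of a noetherian local domain is part of a system of
parameters. -/
theorem exists_isSOP_cons {R : Type*} [CommRing R] [IsDomain R] [IsNoetherianRing R]
    [IsLocalRing R] {r : R} (hr : r ≠ 0) (hrm : r ∈ maximalIdeal R) :
    ∃ (n : ℕ) (t : Fin n → R), IsSOP R (Fin.cons r t : Fin (n + 1) → R) := by
  classical
  have hdim := Module.ringKrullDim_quotient_add_one_of_mem_nonZeroDivisors
    (mem_nonZeroDivisors_of_ne_zero hr) maximalIdeal_height_eq_ringKrullDim hrm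
  obtain ⟨π, hπ⟩ : ∃ π : R →+* R ⧸ Ideal.span {r}, π = Ideal.Quotient.mk _ := ⟨_, rfl⟩
  have hπs : Function.Surjective π := hπ ▸ Ideal.Quotient.mk_surjective
  have hne : Ideal.span {r} ≠ ⊤ := fun h =>
    (maximalIdeal.isMaximal R).ne_top (top_le_iff.mp (h ▸ (Ideal.span_singleton_le_iff_mem _).2 hrm))
  have : Nontrivial (R ⧸ Ideal.span {r}) := Ideal.Quotient.nontrivial_iff.mpr hne
  have hloc : IsLocalRing (R ⧸ Ideal.span {r}) := IsLocalRing.of_surjective' π hπs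
  obtain ⟨s, hs, hcard⟩ := Ideal.exists_finset_card_eq_height_of_isNoetherianRing
    (maximalIdeal (R ⧸ Ideal.span {r}))
  obtain ⟨f, hf⟩ := hπs.hasRightInverse
  have hfm' : ∀ i, (Fin.cons r (fun i => f (s.equivFin.symm i)) : Fin (s.card + 1) → R) i ∈
      maximalIdeal R := by
    have hfm : ∀ b ∈ s, f b ∈ maximalIdeal R := by
      intro b hb
      have hb' : b ∈ maximalIdeal (R ⧸ Ideal.span {r}) := hs.1.2 (Ideal.subset_span hb)
      rw [mem_maximalIdeal, mem_nonunits_iff] at hb' ⊢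
      exact fun h => hb' (hf b ▸ h.map π)
    intro i
    refine Fin.cases hrm (fun i => ?_) i
    exact hfm _ (s.equivFin.symm i).2
  refine ⟨s.card, fun i => f (s.equivFin.symm i), ?_, hfm', le_antisymm ?_ ?_⟩
  · rw [← hdim, ← maximalIdeal_height_eq_ringKrullDim, ← hcard]
    push_cast
    rfl
  · rw [(maximalIdeal.isMaximal R).isPrime.radical_le_iff, Ideal.span_le]
    rintro _ ⟨i, rfl⟩
    exact hfm' i
  · rw [Ideal.radical_eq_sInf]
    refine le_sInf fun P hP => ?_
    obtain ⟨hle, hprime⟩ := hP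
    rw [Ideal.span_le] at hle
    have hrP : r ∈ P := hle ⟨0, rfl⟩
    have hkP : RingHom.ker π ≤ P := by
      rw [hπ, Ideal.mk_ker, Ideal.span_singleton_le_iff_mem]
      exact hrP
    have hP' : (P.map π).IsPrime := Ideal.map_isPrime_of_surjective hπs hkP
    have hsP : Ideal.span (s : Set (R ⧸ Ideal.span {r})) ≤ P.map π := by
      rw [Ideal.span_le]
      intro b hb
      have hb' : f b ∈ P := by
        have := hle ⟨Fin.succ (s.equivFin ⟨b, hb⟩), rfl⟩
        simpa using this
      exact hf b ▸ Ideal.mem_map_of_mem π hb'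
    have hmP := hs.2 ⟨hP', hsP⟩ (IsLocalRing.le_maximalIdeal hP'.ne_top)
    intro y hy
    have hy' : π y ∈ P.map π := by
      apply hmP
      rw [mem_maximalIdeal, mem_nonunits_iff] at hy ⊢
      intro hu
      obtain ⟨z, hz⟩ := hu.exists_right_inv
      obtain ⟨z, rfl⟩ := hπs z
      have h1 : y * z - 1 ∈ maximalIdeal R := by
        have : y * z - 1 ∈ RingHom.ker π := by
          rw [RingHom.mem_ker, map_sub, map_mul, hz, map_one, sub_self]
        exact IsLocalRing.le_maximalIdeal hprime.ne_top (hkP this)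
      have h2 : (1 : R) ∈ maximalIdeal R := by
        have := Ideal.sub_mem _ (Ideal.mul_mem_right z _ hy) h1
        rwa [sub_sub_cancel] at this
      exact (Ideal.ne_top_iff_one _).mp (maximalIdeal.isMaximal R).ne_top h2
    have := Ideal.comap_map_of_surjective' π hπs P
    rw [← Ideal.mem_comap, this] at hy'
    exact sup_le le_rfl hkP hy'

theorem Submodule.mem_ideal_smul_top_pi {A ι : Type*} [CommRing A] [Finite ι] {I : Ideal A}
    {x : ι → A} : x ∈ (I • ⊤ : Submodule A (ι → A)) ↔ ∀ i, x i ∈ I := by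
  classical
  have := Fintype.ofFinite ι
  constructor
  · intro hx i
    exact Submodule.smul_induction_on hx (fun r hr y _ => Ideal.mul_mem_right _ _ hr)
      fun y z hy hz => Ideal.add_mem _ hy hz
  · intro h
    rw [pi_eq_sum_univ' x]
    exact Submodule.sum_mem _ fun i _ => Submodule.smul_mem_smul (h i) trivial

theorem isPrecomplete_pi {A ι : Type*} [CommRing A] [Finite ι] (I : Ideal A)
    [IsPrecomplete I A] : IsPrecomplete I (ι → A) where
  prec' f hf := by
    have h (i : ι) : ∃ L : A, ∀ n, f n i ≡ L [SMOD (I ^ n • ⊤ : Submodule A A)] := by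
      refine IsPrecomplete.prec' (I := I) (fun n => f n i) fun {m n} hmn => ?_
      have := hf hmn
      rw [SModEq.sub_mem, Submodule.mem_ideal_smul_top_pi] at this
      rw [SModEq.sub_mem, smul_eq_mul, Ideal.mul_top]
      exact this i
    choose L hL using h
    refine ⟨L, fun n => ?_⟩
    rw [SModEq.sub_mem, Submodule.mem_ideal_smul_top_pi]
    intro i
    have := hL i n
    rwa [SModEq.sub_mem, smul_eq_mul, Ideal.mul_top] at this

/-- A separated module over an adically complete ring is finite if it is finite modulo the ideal of
definition. -/
theorem Module.Finite.of_isPrecomplete {A M : Type*} [CommRing A] [AddCommGroup M] [Module A M]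
    (I : Ideal A) [IsPrecomplete I A] [IsHausdorff I M]
    (h : Module.Finite A (M ⧸ (I • ⊤ : Submodule A M))) : Module.Finite A M := by
  obtain ⟨n, f, hf⟩ := Module.Finite.exists_fin' A (M ⧸ (I • ⊤ : Submodule A M))
  have := isPrecomplete_pi (ι := Fin n) I
  obtain ⟨g, rfl⟩ := Module.projective_lifting_property (Submodule.mkQ (I • ⊤)) f
    (Submodule.mkQ_surjective _)
  exact Module.Finite.of_surjective g (surjective_of_mkQ_comp_surjective (I := I) hf)

theorem Ideal.exists_fg_sup_pow_eq_top {W R : Type*} [CommRing W] [CommRing R] [Algebra W R]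
    [IsNoetherianRing R] {m : Ideal R} (h : ∀ r : R, ∃ w : W, r - algebraMap W R w ∈ m) (e : ℕ) :
    ∃ N : Submodule W R, N.FG ∧ N ⊔ (m ^ e).restrictScalars W = ⊤ := by
  induction e with
  | zero => exact ⟨⊥, Submodule.fg_bot, by simp⟩
  | succ e ih =>
    obtain ⟨N, hN, hsup⟩ := ih
    obtain ⟨s, hs⟩ := (isNoetherianRing_iff_ideal_fg R).mp inferInstance (m ^ e)
    refine ⟨N ⊔ Submodule.span W s, hN.sup (Submodule.fg_span s.finite_toSet), ?_⟩
    rw [eq_top_iff, ← hsup, sup_assoc]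
    refine sup_le_sup_left (fun y hy => ?_) N
    have hy' : y ∈ Ideal.span (s : Set R) := by rw [hs]; exact hy
    clear hy
    induction hy' using Submodule.span_induction with
    | mem y hy => exact Submodule.mem_sup_left (Submodule.subset_span hy)
    | zero => exact zero_mem _
    | add x y _ _ hx hy => exact add_mem hx hy
    | smul r y hy hP =>
      obtain ⟨w, hw⟩ := h r
      change y ∈ Ideal.span _ at hy
      rw [hs] at hy
      have : r • y = w • y + (r - algebraMap W R w) * y := by
        rw [smul_eq_mul, Algebra.smul_def]; ring
      rw [this]
      refine add_mem (Submodule.smul_mem _ w hP) (Submodule.mem_sup_right ?_)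
      rw [Submodule.restrictScalars_mem, pow_succ']
      exact Ideal.mul_mem_mul hw hy

open IsLocalRing in
/-- The finiteness part of Cohen's structure theorem. -/
theorem IsLocalRing.finite_of_isPrecomplete {W A R : Type*} [CommRing W] [CommRing A] [CommRing R]
    [Algebra W A] [Algebra A R] [Algebra W R] [IsScalarTower W A R] [IsLocalRing R]
    [IsNoetherianRing R] (P : Ideal W) (I : Ideal A) [IsPrecomplete P W] [IsPrecomplete I A]
    (hres : ∀ r : R, ∃ w : W, r - algebraMap W R w ∈ maximalIdeal R)
    (hP : P.map (algebraMap W R) ≠ ⊤) (hI : I.map (algebraMap A R) ≠ ⊤) {e : ℕ}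
    (he : maximalIdeal R ^ e ≤ P.map (algebraMap W R) ⊔ I.map (algebraMap A R)) :
    Module.Finite A R := by
  obtain ⟨J, hJ⟩ : ∃ J, J = I.map (algebraMap A R) := ⟨_, rfl⟩
  have h1 : Module.Finite W (R ⧸ J) := by
    have hH : IsHausdorff (P.map (algebraMap W R)) (R ⧸ J) := .of_isLocalRing _ _ hP
    have := IsHausdorff.map_algebraMap_iff.mp hH
    refine .of_isPrecomplete P ?_
    obtain ⟨N, hN, hsup⟩ := Ideal.exists_fg_sup_pow_eq_top hres e
    obtain ⟨q, hqs, hq, hker⟩ : ∃ q : R →ₗ[W] (R ⧸ J) ⧸ (P • ⊤ : Submodule W (R ⧸ J)),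
        Function.Surjective q ∧ (∀ y ∈ P.map (algebraMap W R), q y = 0) ∧ ∀ y ∈ J, q y = 0 := by
      refine ⟨(Submodule.mkQ _).comp (Ideal.Quotient.mkₐ W J).toLinearMap,
        (Submodule.mkQ_surjective _).comp Ideal.Quotient.mk_surjective, fun y hy => ?_,
        fun y hy => ?_⟩
      · rw [LinearMap.comp_apply, Submodule.mkQ_apply, Submodule.Quotient.mk_eq_zero,
          Ideal.smul_top_eq_map, Submodule.restrictScalars_mem, IsScalarTower.algebraMap_eq W R,
          ← Ideal.map_map]
        exact Ideal.mem_map_of_mem (algebraMap R (R ⧸ J)) hy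
      · rw [LinearMap.comp_apply, show (Ideal.Quotient.mkₐ W J).toLinearMap y = 0 from
          Ideal.Quotient.eq_zero_iff_mem.mpr hy, map_zero]
    have : N.map q = ⊤ := by
      have hm : Submodule.map q ((maximalIdeal R ^ e).restrictScalars W) ≤ ⊥ := by
        rw [Submodule.map_le_iff_le_comap]
        intro y hy
        obtain ⟨a, ha, b, hb, rfl⟩ := Submodule.mem_sup.mp (he hy)
        rw [Submodule.mem_comap, map_add, hq a ha, hker b (hJ ▸ hb), add_zero]
        exact zero_mem _
      rw [← LinearMap.range_eq_top.mpr hqs, ← Submodule.map_top, ← hsup, Submodule.map_sup,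
        le_bot_iff.mp hm, sup_bot_eq]
    exact ⟨this ▸ hN.map q⟩
  have hH : IsHausdorff (I.map (algebraMap A R)) R := .of_isLocalRing _ _ hI
  have := IsHausdorff.map_algebraMap_iff.mp hH
  refine .of_isPrecomplete I ?_
  have h2 : Module.Finite A (R ⧸ J) := .of_restrictScalars_finite W A _
  rw [Ideal.smul_top_eq_map, ← hJ]
  exact h2

theorem MvPowerSeries.sub_C_constantCoeff_mem {σ W : Type*} [Finite σ] [CommRing W]
    (a : MvPowerSeries σ W) :
    a - C (constantCoeff a) ∈ Ideal.span (Set.range (X : σ → MvPowerSeries σ W)) := by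
  classical
  have := Fintype.ofFinite σ
  have h := (MvPowerSeries.mem_span_X_pow_iff (k := W) (fun _ : σ => 1) Finset.univ
    (a - C (constantCoeff a))).mpr fun ν hν => by
      have : ν = 0 := by
        ext i
        exact Nat.lt_one_iff.mp (hν i (Finset.mem_univ i))
      subst this
      rw [map_sub, coeff_zero_C, coeff_zero_eq_constantCoeff_apply, sub_self]
  simpa using h

open IsLocalRing in
theorem MvPowerSeries.ringKrullDim_le_wittVector {p : ℕ} [Fact p.Prime] (k : Type) [Field k]
    [CharP k p] [PerfectRing k p] (n : ℕ) :
    ringKrullDim (MvPowerSeries (Fin n) (WittVector p k)) ≤ (n + 1 : ℕ) := by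
  have hno : IsNoetherianRing (MvPowerSeries (Fin n) (WittVector p k)) :=
    MvPowerSeries.isNoetherianRing _
  refine (ringKrullDim_le_spanFinrank_maximalIdeal _).trans ?_
  obtain ⟨y, hy⟩ : ∃ y : Fin (n + 1) → MvPowerSeries (Fin n) (WittVector p k),
    y = Fin.cons (C (p : WittVector p k)) X := ⟨_, rfl⟩
  have hym : maximalIdeal (MvPowerSeries (Fin n) (WittVector p k)) = Ideal.span (Set.range y) := by
    refine le_antisymm (fun a ha => ?_) ?_
    · rw [mem_maximalIdeal, mem_nonunits_iff, isUnit_iff_constantCoeff] at ha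
      have h0 : (constantCoeff a).coeff 0 = 0 := by
        by_contra h
        exact ha (WittVector.isUnit_of_coeff_zero_ne_zero _ h)
      obtain ⟨b, hb⟩ := WittVector.natCast_dvd_of_coeff_zero h0
      rw [← sub_add_cancel a (C (constantCoeff a))]
      refine add_mem (Ideal.span_mono ?_ (sub_C_constantCoeff_mem a)) ?_
      · rintro _ ⟨i, rfl⟩
        exact ⟨i.succ, by simp [hy]⟩
      · rw [hb, map_mul]
        exact Ideal.mul_mem_right _ _ (Ideal.subset_span ⟨0, by simp [hy]⟩)
    · rw [Ideal.span_le]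
      rintro _ ⟨i, rfl⟩
      rw [SetLike.mem_coe, mem_maximalIdeal, mem_nonunits_iff, isUnit_iff_constantCoeff, hy]
      refine Fin.cases ?_ (fun i => ?_) i
      · rw [Fin.cons_zero, constantCoeff_C]
        exact (WittVector.irreducible p).not_isUnit
      · rw [Fin.cons_succ, constantCoeff_X]
        exact not_isUnit_zero
  rw [hym]
  have h1 := Submodule.spanFinrank_span_le_ncard_of_finite
    (R := MvPowerSeries (Fin n) (WittVector p k)) (Set.finite_range y)
  have h2 : (Set.range y).ncard ≤ n + 1 := by
    rw [← Set.image_univ]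
    exact (Set.ncard_image_le Set.finite_univ).trans (by simp)
  exact_mod_cast h1.trans h2

theorem MvPowerSeries.natCast_dvd {p : ℕ} {σ W : Type*} [CommRing W] {a : MvPowerSeries σ W}
    (h : ∀ ν, (p : W) ∣ coeff ν a) : (p : MvPowerSeries σ W) ∣ a := by
  choose b hb using h
  obtain ⟨c, hc⟩ : ∃ c : MvPowerSeries σ W, ∀ ν, coeff ν c = b ν := ⟨b, fun _ => rfl⟩
  refine ⟨c, ?_⟩
  ext ν
  rw [hb, ← hc, ← map_natCast (C (σ := σ) (R := W)), coeff_C_mul]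

theorem MvPowerSeries.coeff_dvd_of_natCast_dvd {p : ℕ} {σ W : Type*} [CommRing W]
    {a : MvPowerSeries σ W} (h : (p : MvPowerSeries σ W) ∣ a) (ν) : (p : W) ∣ coeff ν a := by
  obtain ⟨b, rfl⟩ := h
  rw [← map_natCast (C (σ := σ) (R := W)), coeff_C_mul]
  exact dvd_mul_right _ _

theorem MvPowerSeries.natCast_dvd_of_map_eq_zero {p : ℕ} [Fact p.Prime] {k : Type} {σ : Type*} [CommRing k]
    [CharP k p] [PerfectRing k p] {a : MvPowerSeries σ (WittVector p k)}
    (h : map (WittVector.constantCoeff : WittVector p k →+* k) a = 0) :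
    (p : MvPowerSeries σ (WittVector p k)) ∣ a := by
  refine natCast_dvd fun ν => WittVector.natCast_dvd_of_coeff_zero ?_
  have := congrArg (coeff ν) h
  rwa [coeff_map, map_zero] at this

theorem MvPowerSeries.eq_zero_of_forall_natCast_pow_dvd {p : ℕ} [Fact p.Prime] {k : Type} {σ : Type*}
    [CommRing k] [CharP k p] [PerfectRing k p] {a : MvPowerSeries σ (WittVector p k)}
    (h : ∀ l, (p : MvPowerSeries σ (WittVector p k)) ^ l ∣ a) : a = 0 := by
  ext ν m
  rw [map_zero, WittVector.zero_coeff]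
  have h1 := h (m + 1)
  rw [← Nat.cast_pow] at h1
  have h2 := coeff_dvd_of_natCast_dvd h1 ν
  rw [Nat.cast_pow] at h2
  exact (WittVector.mem_span_p_pow_iff_le_coeff_eq_zero _ (m + 1)).mp
    (Ideal.mem_span_singleton.mpr h2) m m.lt_succ_self

/-- Integral injective extensions do not raise the dimension. -/
theorem ringKrullDim_le_of_isIntegral {R S : Type*} [CommRing R] [CommRing S] [Algebra R S]
    [Algebra.IsIntegral R S] : ringKrullDim S ≤ ringKrullDim R :=
  Order.krullDim_le_of_strictMono (PrimeSpectrum.comap (algebraMap R S)) fun P Q h =>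
    Ideal.IsIntegral.comap_lt_comap (R := R) (I := P.asIdeal) (J := Q.asIdeal) h

theorem injective_of_isIntegral_of_ringKrullDim_le {A R : Type*} [CommRing A] [IsDomain A]
    [CommRing R] [IsDomain R] {φ : A →+* R} (hφ : φ.IsIntegral) {n : ℕ}
    (hA : ringKrullDim A ≤ n) (hR : n ≤ ringKrullDim R) : Function.Injective φ := by
  rw [injective_iff_map_eq_zero]
  intro a ha
  by_contra h0
  have h1 := ringKrullDim_succ_le_of_surjective φ.rangeRestrict φ.rangeRestrict_surjective
    (mem_nonZeroDivisors_of_ne_zero h0) (Subtype.ext ha)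
  have : Algebra.IsIntegral φ.range R := ⟨fun x => by
    obtain ⟨P, hP, hx⟩ := hφ x
    refine ⟨P.map φ.rangeRestrict, hP.map _, ?_⟩
    rw [Polynomial.eval₂_map]
    exact hx⟩
  have h2 := ringKrullDim_le_of_isIntegral (R := φ.range) (S := R)
  have h3 : (n : WithBot ℕ∞) + 1 ≤ n := by
    refine le_trans ?_ (h1.trans hA)
    gcongr
    exact hR.trans h2
  have : n + 1 ≤ n := by exact_mod_cast h3
  omega

instance MvPowerSeries.isDomain {σ W : Type*} [CommRing W] [IsDomain W] :
    IsDomain (MvPowerSeries σ W) :=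
  NoZeroDivisors.to_isDomain _

open IsLocalRing in
/-- A complete noetherian local domain of mixed characteristic with perfect residue field is a
finite extension of a power series ring over the Witt vectors of its residue field, whose variables
complete `p` to a system of parameters. -/
theorem exists_cohen_subring {p : ℕ} [hp : Fact p.Prime] {R : Type} [CommRing R] [IsDomain R]
    [IsNoetherianRing R] [IsLocalRing R] [IsAdicComplete (maximalIdeal R) R] [CharZero R]
    [CharP (ResidueField R) p] [PerfectRing (ResidueField R) p] :
    ∃ (n : ℕ) (φ : MvPowerSeries (Fin n) (WittVector p (ResidueField R)) →+* R),
      φ.IsIntegral ∧ Function.Injective φ ∧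
      IsSOP R (Fin.cons (p : R) (fun i => φ (MvPowerSeries.X i)) : Fin (n + 1) → R) := by
  have hpm : (p : R) ∈ maximalIdeal R := by
    rw [← residue_eq_zero_iff, map_natCast, CharP.cast_eq_zero]
  have hp0 : (p : R) ≠ 0 := Nat.cast_ne_zero.mpr hp.out.ne_zero
  obtain ⟨n, t, ht⟩ := exists_isSOP_cons hp0 hpm
  have htm : ∀ i, t i ∈ maximalIdeal R := fun i => by simpa using ht.2.1 i.succ
  have hker : RingHom.ker (residue R) = maximalIdeal R := ker_residue
  have hc : IsAdicComplete (RingHom.ker (residue R)) R := by rwa [hker]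
  obtain ⟨g, hg⟩ := WittVector.exists_ringHom_of_isAdicComplete (p := p) (residue_surjective (R := R))
  obtain ⟨φ, hφC, hφX⟩ := MvPowerSeries.exists_evalHom (maximalIdeal R) g htm
  have hint : φ.IsIntegral := by
    let _ : Algebra (MvPowerSeries (Fin n) (WittVector p (ResidueField R))) R := φ.toAlgebra
    let _ : Algebra (WittVector p (ResidueField R)) R := g.toAlgebra
    have hst : IsScalarTower (WittVector p (ResidueField R))
        (MvPowerSeries (Fin n) (WittVector p (ResidueField R))) R :=
      .of_algebraMap_eq fun w => (hφC w).symm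
    have hP : (Ideal.span {(p : WittVector p (ResidueField R))}).map
        (algebraMap (WittVector p (ResidueField R)) R) = Ideal.span {(p : R)} := by
      rw [Ideal.map_span, Set.image_singleton, map_natCast]
    have hI : (Ideal.span (Set.range (MvPowerSeries.X : Fin n → MvPowerSeries (Fin n)
        (WittVector p (ResidueField R))))).map (algebraMap (MvPowerSeries (Fin n)
        (WittVector p (ResidueField R))) R) = Ideal.span (Set.range t) := by
      rw [Ideal.map_span, ← Set.range_comp]
      congr 2
      exact funext hφX
    obtain ⟨e, he⟩ := Ideal.exists_pow_le_of_le_radical_of_fg ht.2.2.ge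
      ((isNoetherianRing_iff_ideal_fg R).mp inferInstance (maximalIdeal R))
    have hne : ∀ J : Ideal R, J ≤ maximalIdeal R → J ≠ ⊤ := fun J hJ h =>
      (maximalIdeal.isMaximal R).ne_top (top_le_iff.mp (h ▸ hJ))
    have hfin := IsLocalRing.finite_of_isPrecomplete
      (Ideal.span {(p : WittVector p (ResidueField R))})
      (Ideal.span (Set.range (MvPowerSeries.X : Fin n → MvPowerSeries (Fin n)
        (WittVector p (ResidueField R))))) (R := R) (e := e)
      (fun r => by
        refine ⟨WittVector.teichmuller p (residue R r), ?_⟩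
        rw [← residue_eq_zero_iff, map_sub, sub_eq_zero]
        exact ((hg _).trans (WittVector.teichmuller_coeff_zero p _)).symm)
      (hne _ (by rwa [hP, Ideal.span_singleton_le_iff_mem]))
      (hne _ (by
        rw [hI, Ideal.span_le]
        rintro _ ⟨i, rfl⟩
        exact htm i))
      (by
        rw [hP, hI]
        refine he.trans (Ideal.span_le.mpr ?_)
        rintro _ ⟨i, rfl⟩
        refine Fin.cases ?_ (fun i => ?_) i
        · exact Ideal.mem_sup_left (Ideal.mem_span_singleton_self _)
        · exact Ideal.mem_sup_right (Ideal.subset_span ⟨i, rfl⟩))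
    exact fun x => Algebra.IsIntegral.isIntegral x
  refine ⟨n, φ, hint, ?_, ?_⟩
  · exact injective_of_isIntegral_of_ringKrullDim_le hint
      (MvPowerSeries.ringKrullDim_le_wittVector (p := p) (ResidueField R) n) ht.1.le
  · simpa only [hφX] using ht

open IsLocalRing in
theorem IsSOP.exists_complete_bigCM_of_isIntegral {p n : ℕ} [hp : Fact p.Prime] {k A R T : Type}
    [Field k] [CharP k p] [CommRing A] [IsDomain A] [CharZero A] [CommRing R] [IsNoetherianRing R]
    [IsLocalRing R] [CommRing T] [IsDomain T] {φ : A →+* R} {α : R →+* T} (hφi : φ.IsIntegral)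
    (hφ : Function.Injective φ) (hα : α.IsIntegral) (hinj : Function.Injective α)
    (θ : A →+* WittVector p (MvPowerSeries (Fin n) k)) {x : Fin n → A}
    (hθX : ∀ i, θ (x i) = WittVector.teichmuller p (MvPowerSeries.X i))
    (hθd : ∀ a, (θ a).coeff 0 = 0 → (p : A) ∣ a) (hsep : ∀ a : A, (∀ l, (p : A) ^ l ∣ a) → a = 0)
    (hx : IsSOP R (Fin.cons (p : R) (fun i => φ (x i)) : Fin (n + 1) → R)) :
    ∃ (C : Type) (_ : CommRing C) (ι : T →+* C), IsBigCM (ι.comp α) ∧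
      IsAdicComplete ((maximalIdeal R).map (ι.comp α)) C := by
  let _ : Algebra A T := (α.comp φ).toAlgebra
  have hi : Algebra.IsIntegral A T := ⟨RingHom.IsIntegral.trans φ α hφi hα⟩
  obtain ⟨B, iB, ψ, hψ⟩ := exists_regular_algebra (T := T) (hinj.comp hφ) θ hθd hsep hθX
  refine hx.exists_complete_bigCM α ψ ?_
  have hcons : (fun i => ψ (α ((Fin.cons (p : R) (fun i => φ (x i)) : Fin (n + 1) → R) i))) =
      fun i => ψ (algebraMap A T ((Fin.cons (p : A) x : Fin (n + 1) → A) i)) := by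
    funext i
    refine Fin.cases ?_ (fun i => ?_) i
    · simp only [Fin.cons_zero, map_natCast]
    · rfl
  rw [hcons]
  exact hψ

open IsLocalRing in
theorem exists_complete_bigCM_of_isIntegral {p : ℕ} [hp : Fact p.Prime] {R T : Type} [CommRing R]
    [IsDomain R] [IsNoetherianRing R] [IsLocalRing R] [IsAdicComplete (maximalIdeal R) R]
    [CharZero R] [CharP (ResidueField R) p] [PerfectRing (ResidueField R) p] [CommRing T]
    [IsDomain T] {α : R →+* T} (hα : α.IsIntegral) (hinj : Function.Injective α) :
    ∃ (C : Type) (_ : CommRing C) (ι : T →+* C), IsBigCM (ι.comp α) ∧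
      IsAdicComplete ((maximalIdeal R).map (ι.comp α)) C := by
  obtain ⟨n, φ, hφi, hφ, hx⟩ := exists_cohen_subring (p := p) (R := R)
  obtain ⟨θ, hθX, hθ⟩ := WittVector.exists_ringHom_mvPowerSeries p (ResidueField R) (Fin n)
  have hZ : CharZero (MvPowerSeries (Fin n) (WittVector p (ResidueField R))) :=
    ⟨fun a b h => Nat.cast_injective (R := R) <| by simpa only [map_natCast] using congrArg φ h⟩
  exact hx.exists_complete_bigCM_of_isIntegral hφi hφ hα hinj θ hθX
    (fun a ha => MvPowerSeries.natCast_dvd_of_map_eq_zero ((hθ a).symm.trans ha))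
    (fun a ha => MvPowerSeries.eq_zero_of_forall_natCast_pow_dvd ha)

/-- **Theorem 3.3** (Shimomoto): for any complete noetherian local domain `R` of mixed
characteristic `(0,p)` with perfect residue field, there is an `R⁺`-algebra `C` which,
viewed as an `R`-algebra, is an `𝔪_R`-adically complete big Cohen-Macaulay `R`-algebra. -/
theorem exists_complete_CM_algebra_over_abs_int_closure
    (p : ℕ) (hp : p.Prime)
    (R : Type) [CommRing R] [IsDomain R] [IsNoetherianRing R] [IsLocalRing R]
    [IsAdicComplete (IsLocalRing.maximalIdeal R) R]
    [CharZero R] [CharP (IsLocalRing.ResidueField R) p]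
    (hperf : Function.Bijective fun a : IsLocalRing.ResidueField R => a ^ p)
    (Rplus : Type) [CommRing Rplus] [Algebra R Rplus]
    (hRplus : IsAbsIntClosure R Rplus) :
    ∃ (C : Type) (_ : CommRing C) (ι : Rplus →+* C),
      IsBigCM (ι.comp (algebraMap R Rplus)) ∧
      IsAdicComplete
        (Ideal.map (ι.comp (algebraMap R Rplus)) (IsLocalRing.maximalIdeal R)) C := by
  have := Fact.mk hp
  have : PerfectRing (IsLocalRing.ResidueField R) p := ⟨hperf⟩
  have := hRplus.isDomain
  exact exists_complete_bigCM_of_isIntegral (p := p)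
    (fun x => hRplus.isIntegral.isIntegral x) hRplus.injective
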